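/- Assume the standing assumptions in dimension n = 3, with u_k → u in L¹(Ω) where u takes only the values ±1 on Ω \ spt(μ) and is locally constant there. Then there exists a countable set Δ ⊆ Ω \ spt(μ) such that u_k(x) → u(x) for every x ∈ Ω \ (spt(μ) ∪ Δ). In particular, for every set C compactly contained in Ω \ spt(μ) and every s > 0 with ℋ^s(C) < ∞ (ℋ^s the s-dimensional Hausdorff measure), u_k → u ℋ^s-almost everywhere on C. -/

import Mathlib

open MeasureTheory Filter Metric Set

noncomputable section

abbrev E (n : ℕ) : Type := EuclideanSpace ℝ (Fin n)

def W (t : ℝ) : ℝ := (t ^ 2 - 1) ^ 2 / 4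

def W' (t : ℝ) : ℝ := t ^ 3 - t

def c0 : ℝ := 2 * Real.sqrt 2 / 3

def lap {n : ℕ} (u : E n → ℝ) (x : E n) : ℝ :=
  ∑ i, (fderiv ℝ (fderiv ℝ u) x) (EuclideanSpace.single i 1) (EuclideanSpace.single i 1)

def areaDensity {n : ℕ} (ev : ℝ) (u : E n → ℝ) (x : E n) : ℝ :=
  ev / 2 * ‖fderiv ℝ u x‖ ^ 2 + (1 / ev) * W (u x)

def willDensity {n : ℕ} (ev : ℝ) (u : E n → ℝ) (x : E n) : ℝ :=
  (ev * lap u x - (1 / ev) * W' (u x)) ^ 2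

def Se {n : ℕ} (ev : ℝ) (Ω : Set (E n)) (u : E n → ℝ) : ℝ :=
  (1 / c0) * ∫ x in Ω, areaDensity ev u x

def We {n : ℕ} (ev : ℝ) (Ω : Set (E n)) (u : E n → ℝ) : ℝ :=
  (1 / (c0 * ev)) * ∫ x in Ω, willDensity ev u x

def mue {n : ℕ} (ev : ℝ) (Ω : Set (E n)) (u : E n → ℝ) (U : Set (E n)) : ℝ :=
  (1 / c0) * ∫ x in U ∩ Ω, areaDensity ev u x

def ale {n : ℕ} (ev : ℝ) (Ω : Set (E n)) (u : E n → ℝ) (U : Set (E n)) : ℝ :=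
  (1 / (c0 * ev)) * ∫ x in U ∩ Ω, willDensity ev u x

def xiPlus {n : ℕ} (ev : ℝ) (Ω : Set (E n)) (u : E n → ℝ) (U : Set (E n)) : ℝ :=
  ∫ x in U ∩ Ω, max (ev / 2 * ‖fderiv ℝ u x‖ ^ 2 - (1 / ev) * W (u x)) 0

def sptM {n : ℕ} (μ : Measure (E n)) : Set (E n) :=
  {x | ∀ r > 0, 0 < μ (ball x r)}

def weakConvA {n : ℕ} (Ω : Set (E n)) (ε : ℕ → ℝ) (u : ℕ → E n → ℝ)
    (μ : Measure (E n)) : Prop :=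
  ∀ φ : BoundedContinuousFunction (E n) ℝ,
    Tendsto (fun k => (1 / c0) * ∫ x in Ω, φ x * areaDensity (ε k) (u k) x) atTop
      (nhds (∫ x, φ x ∂μ))

def weakConvW {n : ℕ} (Ω : Set (E n)) (ε : ℕ → ℝ) (u : ℕ → E n → ℝ)
    (α : Measure (E n)) : Prop :=
  ∀ φ : BoundedContinuousFunction (E n) ℝ,
    Tendsto (fun k => (1 / (c0 * ε k)) * ∫ x in Ω, φ x * willDensity (ε k) (u k) x) atTop
      (nhds (∫ x, φ x ∂α))

/-! ### Partial derivatives of functions on `ℝ³` -/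

open scoped ContDiff

/-- The `i`-th partial derivative. -/
def pd (i : Fin 3) (f : E 3 → ℝ) (x : E 3) : ℝ := fderiv ℝ f x (EuclideanSpace.single i 1)

/-- The Laplacian, as a sum of iterated partial derivatives. -/
def lapl (f : E 3 → ℝ) (x : E 3) : ℝ := ∑ i, pd i (pd i f) x

theorem contDiff_pd {f : E 3 → ℝ} (hf : ContDiff ℝ ∞ f) (i : Fin 3) : ContDiff ℝ ∞ (pd i f) :=
  (hf.fderiv_right (m := ∞) (by simp)).clm_apply contDiff_const

theorem contDiff_lapl {f : E 3 → ℝ} (hf : ContDiff ℝ ∞ f) : ContDiff ℝ ∞ (lapl f) :=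
  ContDiff.sum fun i _ => contDiff_pd (contDiff_pd hf i) i

theorem smooth_differentiable {f : E 3 → ℝ} (hf : ContDiff ℝ ∞ f) : Differentiable ℝ f :=
  hf.differentiable (by simp)

theorem pd_add (i : Fin 3) {f g : E 3 → ℝ} (hf : Differentiable ℝ f) (hg : Differentiable ℝ g) :
    pd i (fun x => f x + g x) = fun x => pd i f x + pd i g x := by
  funext x
  simp only [pd]
  rw [fderiv_fun_add (hf x) (hg x)]
  rfl

theorem pd_sub (i : Fin 3) {f g : E 3 → ℝ} (hf : Differentiable ℝ f) (hg : Differentiable ℝ g) :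
    pd i (fun x => f x - g x) = fun x => pd i f x - pd i g x := by
  funext x
  simp only [pd]
  rw [fderiv_fun_sub (hf x) (hg x)]
  rfl

theorem pd_mul (i : Fin 3) {f g : E 3 → ℝ} (hf : Differentiable ℝ f) (hg : Differentiable ℝ g) :
    pd i (fun x => f x * g x) = fun x => f x * pd i g x + g x * pd i f x := by
  funext x
  simp only [pd]
  rw [fderiv_fun_mul (hf x) (hg x)]
  simp

theorem pd_const (i : Fin 3) (c : ℝ) : pd i (fun _ : E 3 => c) = fun _ => 0 := by
  funext x
  simp [pd]

theorem pd_const_mul (i : Fin 3) (c : ℝ) {f : E 3 → ℝ} (hf : Differentiable ℝ f) :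
    pd i (fun x => c * f x) = fun x => c * pd i f x := by
  rw [pd_mul i (differentiable_const c) hf, pd_const]
  simp

theorem pd_sum (i : Fin 3) {f : Fin 3 → E 3 → ℝ} (hf : ∀ j, Differentiable ℝ (f j)) :
    pd i (fun x => ∑ j, f j x) = fun x => ∑ j, pd i (f j) x := by
  funext x
  simp only [pd]
  rw [fderiv_fun_sum fun j _ => hf j x]
  simp

theorem pd_coord (i j : Fin 3) : pd i (fun x : E 3 => x j) = fun _ => if i = j then 1 else 0 := by
  funext x
  have h : HasFDerivAt (fun x : E 3 => x j) (EuclideanSpace.proj j : E 3 →L[ℝ] ℝ) x :=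
    (EuclideanSpace.proj j : E 3 →L[ℝ] ℝ).hasFDerivAt
  simp only [pd]
  rw [h.fderiv]
  by_cases hij : i = j <;> simp [hij, eq_comm]

/-- Chain rule for a scalar function of a scalar field. -/
theorem pd_comp (i : Fin 3) {φ φ' : ℝ → ℝ} {f : E 3 → ℝ} (hφ : ∀ t, HasDerivAt φ (φ' t) t)
    (hf : Differentiable ℝ f) :
    pd i (fun x => φ (f x)) = fun x => φ' (f x) * pd i f x := by
  funext x
  have h := (hφ (f x)).comp_hasFDerivAt x (hf x).hasFDerivAt
  have h' : fderiv ℝ (fun x => φ (f x)) x = φ' (f x) • fderiv ℝ f x := h.fderiv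
  simp [pd, h']

theorem pd_comm {f : E 3 → ℝ} (hf : ContDiff ℝ ∞ f) (i j : Fin 3) (x : E 3) :
    pd i (pd j f) x = pd j (pd i f) x := by
  have hd : Differentiable ℝ (fderiv ℝ f) :=
    (hf.fderiv_right (m := ∞) (by simp)).differentiable (by simp)
  have key : ∀ a b : Fin 3, pd a (pd b f) x =
      fderiv ℝ (fderiv ℝ f) x (EuclideanSpace.single a 1) (EuclideanSpace.single b 1) := by
    intro a b
    unfold pd
    rw [fderiv_clm_apply (hd x) (differentiableAt_const _)]
    simp
  rw [key, key]
  exact (hf.contDiffAt.isSymmSndFDerivAt (by simpa using ENat.LEInfty.out)) _ _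

theorem lap_eq_lapl {f : E 3 → ℝ} (hf : ContDiff ℝ 2 f) : lap f = lapl f := by
  funext x
  have hd : Differentiable ℝ (fderiv ℝ f) :=
    (hf.fderiv_right (m := 1) (by norm_num)).differentiable (by simp)
  unfold lap lapl pd
  refine Finset.sum_congr rfl fun i _ => ?_
  rw [fderiv_clm_apply (hd x) (differentiableAt_const _)]
  simp

/-- The operator norm of the differential is the Euclidean norm of the gradient. -/
theorem norm_fderiv_sq (f : E 3 → ℝ) (x : E 3) :
    ‖fderiv ℝ f x‖ ^ 2 = ∑ i, pd i f x ^ 2 := by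
  set y : E 3 := (InnerProductSpace.toDual ℝ (E 3)).symm (fderiv ℝ f x) with hy
  have h1 : ‖fderiv ℝ f x‖ = ‖y‖ := by rw [hy, LinearIsometryEquiv.norm_map]
  rw [h1, EuclideanSpace.norm_sq_eq]
  refine Finset.sum_congr rfl fun i _ => ?_
  have h2 : pd i f x = inner ℝ y (EuclideanSpace.single i (1 : ℝ)) := by
    rw [hy, InnerProductSpace.toDual_symm_apply]; rfl
  rw [h2, EuclideanSpace.inner_single_right]
  simp

theorem lapl_add {f g : E 3 → ℝ} (hf : ContDiff ℝ ∞ f) (hg : ContDiff ℝ ∞ g) (x : E 3) :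
    lapl (fun x => f x + g x) x = lapl f x + lapl g x := by
  unfold lapl
  rw [← Finset.sum_add_distrib]
  refine Finset.sum_congr rfl fun i _ => ?_
  rw [pd_add i (smooth_differentiable hf) (smooth_differentiable hg),
    pd_add i (smooth_differentiable (contDiff_pd hf i)) (smooth_differentiable (contDiff_pd hg i))]

theorem lapl_const_mul (c : ℝ) {f : E 3 → ℝ} (hf : ContDiff ℝ ∞ f) (x : E 3) :
    lapl (fun x => c * f x) x = c * lapl f x := by
  unfold lapl
  rw [Finset.mul_sum]
  refine Finset.sum_congr rfl fun i _ => ?_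
  rw [pd_const_mul i c (smooth_differentiable hf),
    pd_const_mul i c (smooth_differentiable (contDiff_pd hf i))]

theorem lapl_mul {f g : E 3 → ℝ} (hf : ContDiff ℝ ∞ f) (hg : ContDiff ℝ ∞ g) (x : E 3) :
    lapl (fun x => f x * g x) x =
      f x * lapl g x + g x * lapl f x + 2 * ∑ i, pd i f x * pd i g x := by
  have h1 := smooth_differentiable hf
  have h2 := smooth_differentiable hg
  have h3 := fun i => smooth_differentiable (contDiff_pd hf i)
  have h4 := fun i => smooth_differentiable (contDiff_pd hg i)
  unfold lapl
  rw [Finset.mul_sum, Finset.mul_sum, Finset.mul_sum, ← Finset.sum_add_distrib,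
    ← Finset.sum_add_distrib]
  refine Finset.sum_congr rfl fun i _ => ?_
  rw [pd_mul i h1 h2, pd_add i (h1.fun_mul (h4 i)) (h2.fun_mul (h3 i)), pd_mul i h1 (h4 i),
    pd_mul i h2 (h3 i)]
  ring

theorem pd_sq (i : Fin 3) {f : E 3 → ℝ} (hf : Differentiable ℝ f) (x : E 3) :
    pd i (fun x => f x ^ 2) x = 2 * f x * pd i f x := by
  have h : (fun x => f x ^ 2) = fun x => f x * f x := by funext x; ring
  rw [h, pd_mul i hf hf]
  ring

theorem lapl_sq {f : E 3 → ℝ} (hf : ContDiff ℝ ∞ f) (x : E 3) :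
    lapl (fun x => f x ^ 2) x = 2 * f x * lapl f x + 2 * ∑ i, pd i f x ^ 2 := by
  have h : (fun x => f x ^ 2) = fun x => f x * f x := by funext x; ring
  rw [h, lapl_mul hf hf]
  simp only [← pow_two]
  ring

theorem lapl_sum {f : Fin 3 → E 3 → ℝ} (hf : ∀ j, ContDiff ℝ ∞ (f j)) (x : E 3) :
    lapl (fun x => ∑ j, f j x) x = ∑ j, lapl (f j) x := by
  unfold lapl
  rw [Finset.sum_comm]
  refine Finset.sum_congr rfl fun i _ => ?_
  rw [pd_sum i fun j => smooth_differentiable (hf j),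
    pd_sum i fun j => smooth_differentiable (contDiff_pd (hf j) i)]

theorem lapl_pd {f : E 3 → ℝ} (hf : ContDiff ℝ ∞ f) (j : Fin 3) (x : E 3) :
    lapl (pd j f) x = pd j (lapl f) x := by
  have h : lapl f = fun x => ∑ i, pd i (pd i f) x := rfl
  rw [h, pd_sum j fun i => smooth_differentiable (contDiff_pd (contDiff_pd hf i) i)]
  unfold lapl
  refine Finset.sum_congr rfl fun i _ => ?_
  have h2 : pd i (pd j f) = pd j (pd i f) := funext fun y => pd_comm hf i j y
  rw [h2]
  exact pd_comm (contDiff_pd hf i) i j x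

/-- The integral of a partial derivative of a compactly supported function vanishes. -/
theorem integral_pd_eq_zero {f : E 3 → ℝ} (hf : ContDiff ℝ ∞ f) (hc : HasCompactSupport f)
    (i : Fin 3) : ∫ x, pd i f x = 0 := by
  have hd : Continuous (pd i f) := (contDiff_pd hf i).continuous
  have hcd : HasCompactSupport (pd i f) := hc.fderiv_apply ℝ _
  have h := integral_mul_fderiv_eq_neg_fderiv_mul_of_integrable (μ := (volume : Measure (E 3)))
    (f := fun _ => (1 : ℝ)) (g := f) (v := EuclideanSpace.single i (1 : ℝ))
    (by simp) (by simp only [one_mul]; exact hd.integrable_of_hasCompactSupport hcd)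
    (by simpa using hf.continuous.integrable_of_hasCompactSupport hc)
    (fun _ _ => by fun_prop) (fun x _ => smooth_differentiable hf x)
  simpa [pd] using h

/-- The divergence theorem for compactly supported fields. -/
theorem integral_div_eq_zero {Y : Fin 3 → E 3 → ℝ} (hY : ∀ i, ContDiff ℝ ∞ (Y i))
    (hc : ∀ i, HasCompactSupport (Y i)) : ∫ x, ∑ i, pd i (Y i) x = 0 := by
  rw [integral_finsetSum]
  · exact Finset.sum_eq_zero fun i _ => integral_pd_eq_zero (hY i) (hc i) i
  · exact fun i _ => (contDiff_pd (hY i) i).continuous.integrable_of_hasCompactSupport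
      ((hc i).fderiv_apply ℝ _)

/-! ### A regularised discrepancy and its differential inequality -/

/-- Cauchy-Schwarz for the Hessian, shifted by a multiple of the identity and bordered by the
gradient of the regularisation. -/
theorem hessian_shift_nonneg (A : Fin 3 → Fin 3 → ℝ) (p sg n : Fin 3 → ℝ) (g σ N : ℝ)
    (hN : 0 < N) (hN2 : N ^ 2 = ∑ i, p i ^ 2 + σ ^ 2)
    (hn : ∀ i, N * n i = ∑ j, p j * A i j + σ * sg i) :
    0 ≤ (∑ i, ∑ j, A i j ^ 2 + ∑ i, sg i ^ 2 - ∑ i, n i ^ 2)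
      - 2 * g * (∑ i, A i i - (∑ i, n i * p i) / N) + 3 * g ^ 2 := by
  have row : ∀ i, (n i - g * p i / N) ^ 2 ≤
      ∑ j, (A i j - if i = j then g else 0) ^ 2 + sg i ^ 2 := by
    intro i
    have h1 : N * (n i - g * p i / N) =
        ∑ j, p j * (A i j - if i = j then g else 0) + σ * sg i := by
      have : N * (n i - g * p i / N) = N * n i - g * p i := by field_simp
      rw [this, hn]
      simp only [mul_sub, Finset.sum_sub_distrib]
      simp only [mul_ite, mul_zero, Finset.sum_ite_eq, Finset.mem_univ, if_true]
      ring
    have h2 : (N * (n i - g * p i / N)) ^ 2 ≤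
        N ^ 2 * (∑ j, (A i j - if i = j then g else 0) ^ 2 + sg i ^ 2) := by
      rw [h1, hN2]
      generalize hq : (fun j => A i j - if i = j then g else 0) = q
      have hq' : ∀ j, (A i j - if i = j then g else 0) = q j := fun j => congrFun hq j
      simp only [hq', Fin.sum_univ_three]
      nlinarith [sq_nonneg (p 0 * q 1 - p 1 * q 0), sq_nonneg (p 0 * q 2 - p 2 * q 0),
        sq_nonneg (p 1 * q 2 - p 2 * q 1), sq_nonneg (p 0 * sg i - σ * q 0),
        sq_nonneg (p 1 * sg i - σ * q 1), sq_nonneg (p 2 * sg i - σ * q 2)]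
    rw [mul_pow] at h2
    exact le_of_mul_le_mul_left h2 (by positivity)
  have hsum := Finset.sum_le_sum fun i (_ : i ∈ Finset.univ) => row i
  have hexp : ∑ i, (n i - g * p i / N) ^ 2 =
      ∑ i, n i ^ 2 - 2 * g * ((∑ i, n i * p i) / N) + g ^ 2 * (∑ i, p i ^ 2) / N ^ 2 := by
    simp only [Fin.sum_univ_three]
    field_simp
    ring
  have hpos : 0 ≤ g ^ 2 * (∑ i, p i ^ 2) / N ^ 2 := by positivity
  rw [hexp] at hsum
  simp only [Fin.sum_univ_three] at hsum hpos ⊢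
  simp at hsum
  linarith

/-- The second-order part of the Laplacian of `√(D² + σ²)`. -/
theorem norm_pair_laplacian (d sg r : Fin 3 → ℝ) (D σ R lD ls lR : ℝ) (hR : 0 < R)
    (hR2 : R ^ 2 = D ^ 2 + σ ^ 2) (hr : ∀ i, R * r i = D * d i + σ * sg i)
    (hlR : R * lR + ∑ i, r i ^ 2 = D * lD + ∑ i, d i ^ 2 + σ * ls + ∑ i, sg i ^ 2) :
    lR = (D * lD + σ * ls) / R + (∑ i, (σ * d i - D * sg i) ^ 2) / R ^ 3 := by
  have h1 : R ^ 2 * ∑ i, r i ^ 2 = ∑ i, (D * d i + σ * sg i) ^ 2 := by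
    rw [Finset.mul_sum]
    refine Finset.sum_congr rfl fun i _ => ?_
    rw [← hr]; ring
  have h2 : R ^ 3 * lR = R ^ 2 * (D * lD + σ * ls) + ∑ i, (σ * d i - D * sg i) ^ 2 := by
    have h3 : R ^ 3 * lR = R ^ 2 * (D * lD + ∑ i, d i ^ 2 + σ * ls + ∑ i, sg i ^ 2)
        - R ^ 2 * ∑ i, r i ^ 2 := by
      rw [← hlR]; ring
    rw [h3, h1, hR2]
    simp only [Fin.sum_univ_three]
    ring
  field_simp
  linarith

/-- The gradient of the coefficient `(D + R) / (2 R N)`, tested against `p`. -/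
theorem flux_coeff_gradient (p d sg n r Bd : Fin 3 → ℝ) (D σ R N B : ℝ) (hR : 0 < R) (hN : 0 < N)
    (hR2 : R ^ 2 = D ^ 2 + σ ^ 2) (hr : ∀ i, R * r i = D * d i + σ * sg i)
    (hB : R * N * B = (D + R) / 2)
    (hBd : ∀ i, R * N * Bd i + B * (r i * N + R * n i) = (d i + r i) / 2) :
    ∑ i, Bd i * p i = σ * (∑ i, (σ * d i - D * sg i) * p i) / (2 * R ^ 3 * N)
      - B * (∑ i, n i * p i) / N := by
  have hBeq : B = (D + R) / (2 * R * N) := by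
    field_simp
    linarith
  have key : ∀ i, Bd i = σ * (σ * d i - D * sg i) / (2 * R ^ 3 * N) - B * n i / N := by
    intro i
    have h1 : R * N * Bd i = (d i + r i) / 2 - B * (r i * N + R * n i) := by linarith [hBd i]
    have hri : r i = (D * d i + σ * sg i) / R := by
      field_simp
      linarith [hr i]
    have h2 : Bd i = ((d i + r i) / 2 - B * (r i * N + R * n i)) / (R * N) := by
      field_simp
      linarith
    rw [h2, hBeq, hri]
    field_simp
    have : σ ^ 2 = R ^ 2 - D ^ 2 := by linarith
    ring_nf
    rw [this]
    ring
  simp only [key, Fin.sum_univ_three]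
  ring

theorem potential_terms_ge (v g σ N H b : ℝ) (hσ : 0 < σ) (hσ1 : σ ≤ 1) (hN : σ ≤ N)
    (hb : b ^ 2 = 1 / 2) (hb1 : b ≤ 1) (hH0 : 0 ≤ H) (hH1 : H ≤ 1) :
    -(3 * v ^ 2) * σ - 2 * σ - v ^ 2 * σ - g ^ 2 / σ ≤
      H * (-(3 * v ^ 2 - 1) * σ ^ 2 / N - 2 * b * σ ^ 2 + 2 * b * v * g) := by
  have hN0 : 0 < N := hσ.trans_le hN
  have a1 : σ ^ 2 / N ≤ σ := by
    rw [div_le_iff₀ hN0, pow_two]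
    exact mul_le_mul_of_nonneg_left hN hσ.le
  have a0 : 0 ≤ σ ^ 2 / N := by positivity
  have a2 : -(3 * v ^ 2) * σ ≤ -(3 * v ^ 2 - 1) * σ ^ 2 / N := by
    have : -(3 * v ^ 2 - 1) * σ ^ 2 / N = σ ^ 2 / N - 3 * v ^ 2 * (σ ^ 2 / N) := by ring
    rw [this]
    linarith [mul_le_mul_of_nonneg_left a1 (by positivity : 0 ≤ 3 * v ^ 2)]
  have a3 : -(2 * σ) ≤ -(2 * b * σ ^ 2) := by
    have h1 : b * σ ^ 2 ≤ 1 * σ ^ 2 := mul_le_mul_of_nonneg_right hb1 (sq_nonneg σ)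
    have h2 : σ ^ 2 ≤ σ := by
      rw [pow_two]
      exact mul_le_of_le_one_left hσ.le hσ1
    linarith
  have a4 : -(v ^ 2 * σ) - g ^ 2 / σ ≤ 2 * b * v * g := by
    have e : v ^ 2 * σ + g ^ 2 / σ + 2 * b * v * g =
        ((b * v * σ + g) ^ 2 + (1 - b ^ 2) * (v * σ) ^ 2) / σ := by
      field_simp
      ring
    have : 0 ≤ v ^ 2 * σ + g ^ 2 / σ + 2 * b * v * g := by
      have h1 : 0 ≤ 1 - b ^ 2 := by linarith
      rw [e]
      positivity
    linarith
  have a5 : -(3 * v ^ 2) * σ - 2 * σ - v ^ 2 * σ - g ^ 2 / σ ≤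
      (-(3 * v ^ 2 - 1) * σ ^ 2 / N - 2 * b * σ ^ 2 + 2 * b * v * g) := by linarith
  have a6 : 0 ≤ 3 * v ^ 2 * σ + 2 * σ + v ^ 2 * σ + g ^ 2 / σ := by positivity
  calc -(3 * v ^ 2) * σ - 2 * σ - v ^ 2 * σ - g ^ 2 / σ
      ≤ H * (-(3 * v ^ 2) * σ - 2 * σ - v ^ 2 * σ - g ^ 2 / σ) := by
        linarith [mul_le_mul_of_nonneg_right hH1 a6]
    _ ≤ _ := mul_le_mul_of_nonneg_left a5 hH0

theorem hessian_terms_ge (g σ ls N H m q : ℝ) (hσ : 0 < σ) (hls : |ls| ≤ σ) (hN : σ ≤ N)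
    (hH0 : 0 ≤ H) (hH1 : H ≤ 1) (hcs : 0 ≤ m - 2 * g * q + 3 * g ^ 2) (hm : 0 ≤ m) :
    -(3 / 2 * (g ^ 2 / σ)) - σ ≤ H / N * (m - g * q + σ * ls) := by
  have hN0 : 0 < N := hσ.trans_le hN
  have a1 : -(3 / 2 * g ^ 2) - σ * σ ≤ m - g * q + σ * ls := by
    have : σ * (-σ) ≤ σ * ls := mul_le_mul_of_nonneg_left (abs_le.mp hls).1 hσ.le
    linarith
  have a2 : 0 ≤ H / N := by positivity
  have a3 : H / N ≤ 1 / σ := div_le_div₀ zero_le_one hH1 hσ hN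
  have a4 : -(3 / 2 * (g ^ 2 / σ)) - σ = 1 / σ * (-(3 / 2 * g ^ 2) - σ * σ) := by
    field_simp
  have a5 : -(3 / 2 * g ^ 2) - σ * σ ≤ 0 := by
    have : 0 ≤ 3 / 2 * g ^ 2 + σ * σ := by positivity
    linarith
  rw [a4]
  exact (mul_le_mul_of_nonpos_right a3 a5).trans (mul_le_mul_of_nonneg_left a1 a2)

theorem transport_terms_ge (g σ N R P zz zp : ℝ) (hσ : 0 < σ) (hN : σ ≤ N) (hR : σ ≤ R)
    (hP : P ≤ N ^ 2) (hz : zp ^ 2 ≤ zz * P) (hzz : 0 ≤ zz) :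
    -(g ^ 2 / σ) ≤ zz / (2 * R ^ 3) - g * σ * zp / (2 * R ^ 3 * N) := by
  have hN0 : 0 < N := hσ.trans_le hN
  have hR0 : 0 < R := hσ.trans_le hR
  have a1 : zz / (2 * R ^ 3) - g * σ * zp / (2 * R ^ 3 * N) =
      (zz - g * σ * (zp / N)) / (2 * R ^ 3) := by
    field_simp
  have a2 : (zp / N) ^ 2 ≤ zz := by
    rw [div_pow, div_le_iff₀ (by positivity)]
    exact hz.trans (mul_le_mul_of_nonneg_left hP hzz)
  have a3 : -(g ^ 2 * σ ^ 2) ≤ zz - g * σ * (zp / N) := by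
    nlinarith [sq_nonneg (g * σ - zp / N), sq_nonneg (g * σ)]
  rw [a1, le_div_iff₀ (by positivity)]
  have a5 : σ ^ 3 ≤ 2 * R ^ 3 := by
    have := pow_le_pow_left₀ hσ.le hR 3
    have := pow_pos hR0 3
    linarith
  have a6 : g ^ 2 * σ ^ 2 = g ^ 2 / σ * σ ^ 3 := by field_simp
  have a7 : 0 ≤ g ^ 2 / σ := by positivity
  have a8 := mul_le_mul_of_nonneg_left a5 a7
  linarith

theorem excess_identity (v g σ ls N D R H m P gp np lv lN lD zz zp b lG dv : ℝ)
    (hN0 : 0 < N)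
    (hb : b ^ 2 = 1 / 2) (hP : P = N ^ 2 - σ ^ 2)
    (hlv : lv = v ^ 3 - v + g) (hD : D = N + b * (v ^ 2 - 1))
    (hlN : N * lN = m + (3 * v ^ 2 - 1) * P + gp + σ * ls)
    (hlD : lD = lN + b * (2 * v * lv + 2 * P))
    (hlG : lG = H * lD + σ * ls / (2 * R) + zz / (2 * R ^ 3))
    (hdv : dv = H / N * gp + g * (σ * zp / (2 * R ^ 3 * N) - H / N * np / N)
      + g * (H / N) * lv) :
    lG - dv = H * (2 * v ^ 2 + 2 * b * N) * D
      + H * (-(3 * v ^ 2 - 1) * σ ^ 2 / N - 2 * b * σ ^ 2 + 2 * b * v * g)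
      + H / N * (m - g * (lv - np / N) + σ * ls) + σ * ls / (2 * R)
      + (zz / (2 * R ^ 3) - g * σ * zp / (2 * R ^ 3 * N)) := by
  have hlN' : lN = (m + (3 * v ^ 2 - 1) * P + gp + σ * ls) / N := by
    field_simp; linarith
  have hb2 : 2 * b ^ 2 = 1 := by linarith
  have e1 : H * (2 * v ^ 2 + 2 * b * N) * D =
      H * (2 * v ^ 2 * N + 2 * b * N ^ 2 + 2 * b * v ^ 2 * (v ^ 2 - 1)
        + N * (v ^ 2 - 1)) := by
    rw [hD]
    linear_combination (H * N * (v ^ 2 - 1)) * hb2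
  have e2 : g * (σ * zp / (2 * R ^ 3 * N) - H / N * np / N) =
      g * σ * zp / (2 * R ^ 3 * N) - H / N * (g * (np / N)) := by ring
  have e3 : H * lN = H / N * m + H * ((3 * v ^ 2 - 1) * (N - σ ^ 2 / N)) + H / N * gp
      + H / N * (σ * ls) := by
    rw [hlN', hP]
    field_simp
  rw [e1, hlG, hdv, e2, hlD, mul_add H lN, e3, hP, hlv]
  ring

/-- Scalar form of the differential inequality for the regularised discrepancy. -/
theorem excess_scalar_ineq (v g σ ls N D R H m P gp np lv lN lD zz zp b lG dv : ℝ)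
    (hσ : 0 < σ) (hσ1 : σ ≤ 1) (hls : |ls| ≤ σ) (hN : σ ≤ N) (hR : σ ≤ R)
    (hb : b ^ 2 = 1 / 2) (hb0 : 0 < b)
    (hH0 : 0 ≤ H) (hH1 : H ≤ 1) (hP : P = N ^ 2 - σ ^ 2)
    (hlv : lv = v ^ 3 - v + g) (hD : D = N + b * (v ^ 2 - 1))
    (hlN : N * lN = m + (3 * v ^ 2 - 1) * P + gp + σ * ls)
    (hlD : lD = lN + b * (2 * v * lv + 2 * P))
    (hlG : lG = H * lD + σ * ls / (2 * R) + zz / (2 * R ^ 3))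
    (hdv : dv = H / N * gp + g * (σ * zp / (2 * R ^ 3 * N) - H / N * np / N) + g * (H / N) * lv)
    (hcs : 0 ≤ m - 2 * g * (lv - np / N) + 3 * g ^ 2) (hm : 0 ≤ m)
    (hz : zp ^ 2 ≤ zz * P) (hzz : 0 ≤ zz) :
    H * (2 * v ^ 2 + 2 * b * N) * D - 5 * g ^ 2 / σ - 5 * σ * (1 + v ^ 2) ≤ lG - dv := by
  have hN0 : 0 < N := hσ.trans_le hN
  have hR0 : 0 < R := hσ.trans_le hR
  have hb1 : b ≤ 1 := by nlinarith
  have t1 := potential_terms_ge v g σ N H b hσ hσ1 hN hb hb1 hH0 hH1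
  have t2 := hessian_terms_ge g σ ls N H m (lv - np / N) hσ hls hN hH0 hH1 hcs hm
  have t3 : -σ ≤ σ * ls / (2 * R) := by
    rw [le_div_iff₀ (by positivity)]
    nlinarith [(abs_le.mp hls).1]
  have t4 := transport_terms_ge g σ N R P zz zp hσ hN hR (by rw [hP]; nlinarith) hz hzz
  rw [excess_identity v g σ ls N D R H m P gp np lv lN lD zz zp b lG dv hN0 hb hP hlv hD hlN
    hlD hlG hdv]
  have e5 : 5 * g ^ 2 / σ = 5 * (g ^ 2 / σ) := by ring
  have h1 : 0 ≤ g ^ 2 / σ := by positivity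
  have h2 : 0 ≤ v ^ 2 * σ := by positivity
  rw [e5]
  linarith

/-! ### The regularised discrepancy as a function -/

theorem contDiff_sqrt_of_pos {F : E 3 → ℝ} (hF : ContDiff ℝ ∞ F) (hpos : ∀ x, 0 < F x) :
    ContDiff ℝ ∞ fun x => √(F x) :=
  hF.sqrt fun x => (hpos x).ne'

theorem pd_sqrt {F : E 3 → ℝ} (hF : ContDiff ℝ ∞ F) (hpos : ∀ x, 0 < F x) (i : Fin 3) (x : E 3) :
    2 * √(F x) * pd i (fun x => √(F x)) x = pd i F x := by
  have h := pd_sq i (smooth_differentiable (contDiff_sqrt_of_pos hF hpos)) x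
  have e : (fun x => √(F x) ^ 2) = F := funext fun y => Real.sq_sqrt (hpos y).le
  rw [e] at h
  exact h.symm

theorem lapl_sqrt {F : E 3 → ℝ} (hF : ContDiff ℝ ∞ F) (hpos : ∀ x, 0 < F x) (x : E 3) :
    2 * √(F x) * lapl (fun x => √(F x)) x + 2 * ∑ i, pd i (fun x => √(F x)) x ^ 2 =
      lapl F x := by
  have h := lapl_sq (contDiff_sqrt_of_pos hF hpos) x
  have e : (fun x => √(F x) ^ 2) = F := funext fun y => Real.sq_sqrt (hpos y).le
  rw [e] at h
  exact h.symm

theorem hasDerivAt_W' (t : ℝ) : HasDerivAt W' (3 * t ^ 2 - 1) t := by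
  have h : HasDerivAt (fun s : ℝ => s ^ 3 - s) (3 * t ^ 2 - 1) t := by
    simpa using (hasDerivAt_pow 3 t).fun_sub (hasDerivAt_id' t)
  exact h

/-- The squared length of the gradient. -/
def gradSq (v : E 3 → ℝ) (x : E 3) : ℝ := ∑ i, pd i v x ^ 2

/-- The residual `Δv - W'(v)` of the Allen-Cahn equation. -/
def acRes (v : E 3 → ℝ) (x : E 3) : ℝ := lapl v x - W' (v x)

/-- The regularised length of the gradient. -/
def regGrad (v σ : E 3 → ℝ) (x : E 3) : ℝ := √(gradSq v x + σ x ^ 2)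

/-- The regularised gradient minus `√(2 W)`, written so that it is smooth. -/
def regDisc (v σ : E 3 → ℝ) (x : E 3) : ℝ := regGrad v σ x + √(1 / 2) * (v x ^ 2 - 1)

/-- The regularised absolute value of the discrepancy. -/
def regAbs (v σ : E 3 → ℝ) (x : E 3) : ℝ := √(regDisc v σ x ^ 2 + σ x ^ 2)

/-- The regularised positive part of the discrepancy. -/
def excess (v σ : E 3 → ℝ) (x : E 3) : ℝ := (regDisc v σ x + regAbs v σ x) / 2

/-- The coefficient of the flux that compensates for the residual. -/
def fluxCoeff (v σ : E 3 → ℝ) (x : E 3) : ℝ := excess v σ x / (regAbs v σ x * regGrad v σ x)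

section Smoothness

variable {v σ : E 3 → ℝ}

theorem gradSq_nonneg (v : E 3 → ℝ) (x : E 3) : 0 ≤ gradSq v x :=
  Finset.sum_nonneg fun _ _ => sq_nonneg _

theorem contDiff_gradSq (hv : ContDiff ℝ ∞ v) : ContDiff ℝ ∞ (gradSq v) :=
  ContDiff.sum fun i _ => (contDiff_pd hv i).pow 2

theorem contDiff_acRes (hv : ContDiff ℝ ∞ v) : ContDiff ℝ ∞ (acRes v) :=
  (contDiff_lapl hv).sub ((hv.pow 3).sub hv)

theorem regGrad_arg_pos (hpos : ∀ x, 0 < σ x) (x : E 3) : 0 < gradSq v x + σ x ^ 2 := by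
  have := gradSq_nonneg v x
  have := hpos x
  positivity

theorem regAbs_arg_pos (hpos : ∀ x, 0 < σ x) (x : E 3) : 0 < regDisc v σ x ^ 2 + σ x ^ 2 := by
  have := hpos x
  positivity

theorem contDiff_regGrad (hv : ContDiff ℝ ∞ v) (hσ : ContDiff ℝ ∞ σ) (hpos : ∀ x, 0 < σ x) :
    ContDiff ℝ ∞ (regGrad v σ) :=
  contDiff_sqrt_of_pos ((contDiff_gradSq hv).add (hσ.pow 2)) (regGrad_arg_pos hpos)

theorem contDiff_regDisc (hv : ContDiff ℝ ∞ v) (hσ : ContDiff ℝ ∞ σ) (hpos : ∀ x, 0 < σ x) :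
    ContDiff ℝ ∞ (regDisc v σ) :=
  (contDiff_regGrad hv hσ hpos).add (contDiff_const.mul ((hv.pow 2).sub contDiff_const))

theorem contDiff_regAbs (hv : ContDiff ℝ ∞ v) (hσ : ContDiff ℝ ∞ σ) (hpos : ∀ x, 0 < σ x) :
    ContDiff ℝ ∞ (regAbs v σ) :=
  contDiff_sqrt_of_pos (((contDiff_regDisc hv hσ hpos).pow 2).add (hσ.pow 2))
    (regAbs_arg_pos hpos)

theorem contDiff_excess (hv : ContDiff ℝ ∞ v) (hσ : ContDiff ℝ ∞ σ) (hpos : ∀ x, 0 < σ x) :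
    ContDiff ℝ ∞ (excess v σ) :=
  ((contDiff_regDisc hv hσ hpos).add (contDiff_regAbs hv hσ hpos)).div_const 2

theorem regGrad_ge (x : E 3) : σ x ≤ regGrad v σ x :=
  Real.le_sqrt_of_sq_le (by linarith [gradSq_nonneg v x])

theorem regAbs_ge (x : E 3) : σ x ≤ regAbs v σ x :=
  Real.le_sqrt_of_sq_le (by linarith [sq_nonneg (regDisc v σ x)])

theorem regGrad_pos (hpos : ∀ x, 0 < σ x) (x : E 3) : 0 < regGrad v σ x :=
  (hpos x).trans_le (regGrad_ge x)

theorem regAbs_pos (hpos : ∀ x, 0 < σ x) (x : E 3) : 0 < regAbs v σ x :=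
  (hpos x).trans_le (regAbs_ge x)

theorem abs_regDisc_le (x : E 3) : |regDisc v σ x| ≤ regAbs v σ x :=
  Real.abs_le_sqrt (by linarith [sq_nonneg (σ x)])

theorem contDiff_fluxCoeff (hv : ContDiff ℝ ∞ v) (hσ : ContDiff ℝ ∞ σ) (hpos : ∀ x, 0 < σ x) :
    ContDiff ℝ ∞ (fluxCoeff v σ) :=
  (contDiff_excess hv hσ hpos).div ((contDiff_regAbs hv hσ hpos).mul (contDiff_regGrad hv hσ hpos))
    fun x => (mul_pos (regAbs_pos hpos x) (regGrad_pos hpos x)).ne'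

theorem excess_nonneg (x : E 3) : 0 ≤ excess v σ x := by
  have := neg_le_of_abs_le (abs_regDisc_le (v := v) (σ := σ) x)
  unfold excess
  linarith

theorem excess_le_regAbs (x : E 3) : excess v σ x ≤ regAbs v σ x := by
  have := le_of_abs_le (abs_regDisc_le (v := v) (σ := σ) x)
  unfold excess
  linarith

end Smoothness

/-- The differential inequality satisfied by the regularised discrepancy. -/
theorem excess_diff_ineq {v σ : E 3 → ℝ} (hv : ContDiff ℝ ∞ v) (hσ : ContDiff ℝ ∞ σ)
    (hpos : ∀ x, 0 < σ x) (x : E 3) (hσ1 : σ x ≤ 1) (hls : |lapl σ x| ≤ σ x) :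
    excess v σ x / regAbs v σ x * (2 * v x ^ 2 + 2 * √(1 / 2) * regGrad v σ x) * regDisc v σ x
        - 5 * acRes v x ^ 2 / σ x - 5 * σ x * (1 + v x ^ 2) ≤
      lapl (excess v σ) x
        - ∑ i, pd i (fun y => acRes v y * fluxCoeff v σ y * pd i v y) x := by
  have dv := smooth_differentiable hv
  have dσ := smooth_differentiable hσ
  have sp := fun i => contDiff_pd hv i
  have dp := fun i => smooth_differentiable (sp i)
  have sN := contDiff_regGrad hv hσ hpos
  have sD := contDiff_regDisc hv hσ hpos
  have sR := contDiff_regAbs hv hσ hpos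
  have sB := contDiff_fluxCoeff hv hσ hpos
  have sg := contDiff_acRes hv
  have dN := smooth_differentiable sN
  have dD := smooth_differentiable sD
  have dR := smooth_differentiable sR
  have dB := smooth_differentiable sB
  have dg := smooth_differentiable sg
  have hN0 := regGrad_pos (v := v) hpos x
  have hR0 := regAbs_pos (v := v) hpos x
  have hb : √(1 / 2 : ℝ) ^ 2 = 1 / 2 := Real.sq_sqrt (by norm_num)
  have hb0 : 0 < √(1 / 2 : ℝ) := Real.sqrt_pos.mpr (by norm_num)
  -- the regularised gradient
  have hN2 : regGrad v σ x ^ 2 = gradSq v x + σ x ^ 2 := Real.sq_sqrt (regGrad_arg_pos hpos x).le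
  have hn : ∀ i, regGrad v σ x * pd i (regGrad v σ) x =
      ∑ j, pd j v x * pd i (pd j v) x + σ x * pd i σ x := by
    intro i
    have h := pd_sqrt ((contDiff_gradSq hv).add (hσ.pow 2)) (regGrad_arg_pos (v := v) hpos) i x
    rw [pd_add i (smooth_differentiable (contDiff_gradSq hv))
      (smooth_differentiable (hσ.pow 2))] at h
    change 2 * regGrad v σ x * pd i (regGrad v σ) x =
      pd i (fun y => ∑ j, (fun z => pd j v z ^ 2) y) x + pd i (fun y => σ y ^ 2) x at h
    rw [pd_sq i dσ, pd_sum i fun j => (dp j).fun_pow 2] at h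
    simp only [pd_sq i (dp _), Fin.sum_univ_three] at h ⊢
    linarith
  have hpl : ∀ j, lapl (pd j v) x = (3 * v x ^ 2 - 1) * pd j v x + pd j (acRes v) x := by
    intro j
    rw [lapl_pd hv]
    have e : lapl v = fun y => W' (v y) + acRes v y := by
      funext y; unfold acRes; ring
    have dW : Differentiable ℝ fun y => W' (v y) :=
      smooth_differentiable ((hv.pow 3).sub hv)
    rw [e, pd_add j dW dg, pd_comp j hasDerivAt_W' dv]
  have hlN : regGrad v σ x * lapl (regGrad v σ) x + ∑ i, pd i (regGrad v σ) x ^ 2 =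
      (3 * v x ^ 2 - 1) * gradSq v x + ∑ j, pd j v x * pd j (acRes v) x
      + ∑ i, ∑ j, pd i (pd j v) x ^ 2 + σ x * lapl σ x + ∑ i, pd i σ x ^ 2 := by
    have h := lapl_sqrt ((contDiff_gradSq hv).add (hσ.pow 2)) (regGrad_arg_pos (v := v) hpos) x
    rw [lapl_add (contDiff_gradSq hv) (hσ.pow 2)] at h
    change 2 * regGrad v σ x * lapl (regGrad v σ) x + 2 * ∑ i, pd i (regGrad v σ) x ^ 2 =
      lapl (fun y => ∑ j, (fun z => pd j v z ^ 2) y) x + lapl (fun y => σ y ^ 2) x at h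
    rw [lapl_sq hσ, lapl_sum fun j => (sp j).pow 2] at h
    simp only [lapl_sq (sp _), hpl] at h
    simp only [gradSq, Fin.sum_univ_three] at h ⊢
    linarith
  -- the discrepancy
  have eD : regDisc v σ = fun y => regGrad v σ y + √(1 / 2) * (v y ^ 2 + (-1)) := rfl
  have hlD : lapl (regDisc v σ) x = lapl (regGrad v σ) x
      + √(1 / 2) * (2 * v x * lapl v x + 2 * gradSq v x) := by
    have hc : lapl (fun _ : E 3 => (-1 : ℝ)) x = 0 := by
      unfold lapl
      refine Finset.sum_eq_zero fun i _ => ?_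
      rw [pd_const, pd_const]
    rw [eD, lapl_add sN (contDiff_const.mul ((hv.pow 2).add contDiff_const)),
      lapl_const_mul _ ((hv.pow 2).add contDiff_const), lapl_add (hv.pow 2) contDiff_const,
      lapl_sq hv, hc, add_zero]
    rfl
  -- its regularised absolute value
  have hR2 : regAbs v σ x ^ 2 = regDisc v σ x ^ 2 + σ x ^ 2 :=
    Real.sq_sqrt (regAbs_arg_pos hpos x).le
  have hr : ∀ i, regAbs v σ x * pd i (regAbs v σ) x =
      regDisc v σ x * pd i (regDisc v σ) x + σ x * pd i σ x := by
    intro i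
    have h := pd_sqrt ((sD.pow 2).add (hσ.pow 2)) (regAbs_arg_pos (v := v) hpos) i x
    rw [pd_add i (smooth_differentiable (sD.pow 2)) (smooth_differentiable (hσ.pow 2))] at h
    simp only at h
    rw [pd_sq i dD, pd_sq i dσ] at h
    change 2 * regAbs v σ x * pd i (regAbs v σ) x = _ at h
    linarith
  have hlR : regAbs v σ x * lapl (regAbs v σ) x + ∑ i, pd i (regAbs v σ) x ^ 2 =
      regDisc v σ x * lapl (regDisc v σ) x + ∑ i, pd i (regDisc v σ) x ^ 2
      + σ x * lapl σ x + ∑ i, pd i σ x ^ 2 := by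
    have h := lapl_sqrt ((sD.pow 2).add (hσ.pow 2)) (regAbs_arg_pos (v := v) hpos) x
    rw [lapl_add (sD.pow 2) (hσ.pow 2), lapl_sq sD, lapl_sq hσ] at h
    change 2 * regAbs v σ x * lapl (regAbs v σ) x + 2 * ∑ i, pd i (regAbs v σ) x ^ 2 = _ at h
    linarith
  have hlR' := norm_pair_laplacian _ _ _ _ _ _ _ _ _ hR0 hR2 hr hlR
  have eG : excess v σ = fun y => (1 / 2) * (regDisc v σ y + regAbs v σ y) := by
    funext y; unfold excess; ring
  have hG : lapl (excess v σ) x = excess v σ x / regAbs v σ x * lapl (regDisc v σ) x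
      + σ x * lapl σ x / (2 * regAbs v σ x)
      + (∑ i, (σ x * pd i (regDisc v σ) x - regDisc v σ x * pd i σ x) ^ 2)
        / (2 * regAbs v σ x ^ 3) := by
    rw [eG, lapl_const_mul _ (sD.add sR), lapl_add sD sR, hlR']
    field_simp
    ring
  -- the flux
  have hBmul : (fun y => regAbs v σ y * regGrad v σ y * fluxCoeff v σ y) =
      fun y => (1 / 2) * (regDisc v σ y + regAbs v σ y) := by
    funext y
    have h1 := regAbs_pos (v := v) hpos y
    have h2 := regGrad_pos (v := v) hpos y
    unfold fluxCoeff excess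
    field_simp
  have hB : regAbs v σ x * regGrad v σ x * fluxCoeff v σ x =
      (regDisc v σ x + regAbs v σ x) / 2 := by
    have := congrFun hBmul x
    linarith
  have hBd : ∀ i, regAbs v σ x * regGrad v σ x * pd i (fluxCoeff v σ) x + fluxCoeff v σ x *
      (pd i (regAbs v σ) x * regGrad v σ x + regAbs v σ x * pd i (regGrad v σ) x) =
      (pd i (regDisc v σ) x + pd i (regAbs v σ) x) / 2 := by
    intro i
    have h := congrFun (congrArg (pd i) hBmul) x
    rw [pd_mul i (dR.fun_mul dN) dB, pd_const_mul i _ (dD.fun_add dR), pd_add i dD dR,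
      pd_mul i dR dN] at h
    simp only at h
    linarith
  have hflux := flux_coeff_gradient (fun i => pd i v x) _ _ _ _ (fun i => pd i (fluxCoeff v σ) x)
    _ _ _ _ _ hR0 hN0 hR2 hr hB hBd
  have hBH : fluxCoeff v σ x = excess v σ x / regAbs v σ x / regGrad v σ x := by
    unfold fluxCoeff; rw [div_div]
  have hdv : ∑ i, pd i (fun y => acRes v y * fluxCoeff v σ y * pd i v y) x =
      excess v σ x / regAbs v σ x / regGrad v σ x * (∑ j, pd j v x * pd j (acRes v) x)
      + acRes v x * (σ x * (∑ i, (σ x * pd i (regDisc v σ) x - regDisc v σ x * pd i σ x)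
        * pd i v x) / (2 * regAbs v σ x ^ 3 * regGrad v σ x)
        - excess v σ x / regAbs v σ x / regGrad v σ x * (∑ i, pd i (regGrad v σ) x * pd i v x)
          / regGrad v σ x)
      + acRes v x * (excess v σ x / regAbs v σ x / regGrad v σ x) * lapl v x := by
    rw [← hBH, ← hflux]
    simp only [pd_mul _ (dg.fun_mul dB) (dp _), pd_mul _ dg dB]
    simp only [lapl, Fin.sum_univ_three]
    ring
  have hcs0 := hessian_shift_nonneg (fun i j => pd i (pd j v) x) (fun i => pd i v x)
    (fun i => pd i σ x) (fun i => pd i (regGrad v σ) x) 0 (σ x) (regGrad v σ x) hN0 hN2 hn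
  have hcs := hessian_shift_nonneg (fun i j => pd i (pd j v) x) (fun i => pd i v x)
    (fun i => pd i σ x) (fun i => pd i (regGrad v σ) x) (acRes v x) (σ x) (regGrad v σ x) hN0 hN2
    hn
  refine excess_scalar_ineq (v x) (acRes v x) (σ x) (lapl σ x) (regGrad v σ x) (regDisc v σ x)
    (regAbs v σ x) (excess v σ x / regAbs v σ x)
    (∑ i, ∑ j, pd i (pd j v) x ^ 2 + ∑ i, pd i σ x ^ 2 - ∑ i, pd i (regGrad v σ) x ^ 2)
    (gradSq v x) (∑ j, pd j v x * pd j (acRes v) x) (∑ i, pd i (regGrad v σ) x * pd i v x)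
    (lapl v x) (lapl (regGrad v σ) x) (lapl (regDisc v σ) x)
    (∑ i, (σ x * pd i (regDisc v σ) x - regDisc v σ x * pd i σ x) ^ 2)
    (∑ i, (σ x * pd i (regDisc v σ) x - regDisc v σ x * pd i σ x) * pd i v x) (√(1 / 2))
    (lapl (excess v σ) x) _ (hpos x) hσ1 hls (regGrad_ge x) (regAbs_ge x) hb hb0
    (div_nonneg (excess_nonneg x) hR0.le) ((div_le_one hR0).mpr (excess_le_regAbs x))
    (by linarith) (by unfold acRes W'; ring) rfl (by linarith) hlD hG hdv hcs (by linarith)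
    (Finset.sum_mul_sq_le_sq_mul_sq _ _ _) (Finset.sum_nonneg fun _ _ => sq_nonneg _)

/-! ### Two divergence identities -/

/-- The energy density of the rescaled functional. -/
def acEnergy (v : E 3 → ℝ) (x : E 3) : ℝ := gradSq v x / 2 + W (v x)

/-- The radial derivative. -/
def radial (v : E 3 → ℝ) (x : E 3) : ℝ := ∑ j, x j * pd j v x

theorem hasDerivAt_W (t : ℝ) : HasDerivAt W (W' t) t := by
  have h : HasDerivAt (fun s : ℝ => (s ^ 2 - 1) ^ 2 / 4) (W' t) t := by
    have h := (((hasDerivAt_pow 2 t).sub_const 1).fun_pow 2).div_const 4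
    refine h.congr_deriv ?_
    simp [W']
    ring
  exact h

theorem W_nonneg (t : ℝ) : 0 ≤ W t := by
  unfold W
  positivity

theorem acEnergy_nonneg (v : E 3 → ℝ) (x : E 3) : 0 ≤ acEnergy v x := by
  have := gradSq_nonneg v x
  have := W_nonneg (v x)
  unfold acEnergy
  positivity

theorem contDiff_W : ContDiff ℝ ∞ W := by
  unfold W
  fun_prop

theorem contDiff_coord (j : Fin 3) : ContDiff ℝ ∞ fun x : E 3 => x j := by
  fun_prop

theorem contDiff_acEnergy {v : E 3 → ℝ} (hv : ContDiff ℝ ∞ v) : ContDiff ℝ ∞ (acEnergy v) :=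
  ((contDiff_gradSq hv).div_const 2).add (contDiff_W.comp hv)

theorem contDiff_radial {v : E 3 → ℝ} (hv : ContDiff ℝ ∞ v) : ContDiff ℝ ∞ (radial v) :=
  ContDiff.sum fun j _ => (contDiff_coord j).mul (contDiff_pd hv j)

theorem pd_acEnergy {v : E 3 → ℝ} (hv : ContDiff ℝ ∞ v) (i : Fin 3) (x : E 3) :
    pd i (acEnergy v) x = ∑ j, pd j v x * pd i (pd j v) x + W' (v x) * pd i v x := by
  have dp := fun j => smooth_differentiable (contDiff_pd hv j)
  have e : acEnergy v = fun y => (1 / 2) * (∑ j, (fun z => pd j v z ^ 2) y) + W (v y) := by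
    funext y
    unfold acEnergy gradSq
    ring
  have h1 : Differentiable ℝ fun y => ∑ j, (fun z => pd j v z ^ 2) y :=
    smooth_differentiable (contDiff_gradSq hv)
  have h2 : Differentiable ℝ fun y => W (v y) := smooth_differentiable (contDiff_W.comp hv)
  rw [e, pd_add i (h1.const_mul (1 / 2)) h2,
    pd_const_mul i _ h1, pd_sum i fun j => (dp j).fun_pow 2,
    pd_comp i hasDerivAt_W (smooth_differentiable hv)]
  simp only [pd_sq i (dp _), Fin.sum_univ_three]
  ring

theorem pd_radial {v : E 3 → ℝ} (hv : ContDiff ℝ ∞ v) (i : Fin 3) (x : E 3) :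
    pd i (radial v) x = pd i v x + ∑ j, x j * pd i (pd j v) x := by
  have dp := fun j => smooth_differentiable (contDiff_pd hv j)
  have dx := fun j => smooth_differentiable (contDiff_coord j)
  have e : radial v = fun y => ∑ j, (fun z : E 3 => z j * pd j v z) y := rfl
  rw [e, pd_sum i fun j => (dx j).fun_mul (dp j)]
  simp only [pd_mul i (dx _) (dp _), pd_coord]
  fin_cases i <;> simp [Fin.sum_univ_three] <;> ring

/-- The divergence of the stress-energy tensor paired with a radial field. -/
theorem div_pohozaev {v η : E 3 → ℝ} (hv : ContDiff ℝ ∞ v) (hη : ContDiff ℝ ∞ η) (x : E 3) :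
    ∑ i, pd i (fun y => η y * (acEnergy v y * y i - radial v y * pd i v y)) x =
      η x * (3 * acEnergy v x - gradSq v x - radial v x * acRes v x)
      + acEnergy v x * (∑ i, x i * pd i η x) - radial v x * ∑ i, pd i η x * pd i v x := by
  have dη := smooth_differentiable hη
  have de := smooth_differentiable (contDiff_acEnergy hv)
  have dr := smooth_differentiable (contDiff_radial hv)
  have dp := fun j => smooth_differentiable (contDiff_pd hv j)
  have dx := fun j => smooth_differentiable (contDiff_coord j)
  have key : ∀ i, pd i (fun y => η y * (acEnergy v y * y i - radial v y * pd i v y)) x =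
      η x * (acEnergy v x + x i * (∑ j, pd j v x * pd i (pd j v) x + W' (v x) * pd i v x)
        - (radial v x * pd i (pd i v) x
          + pd i v x * (pd i v x + ∑ j, x j * pd i (pd j v) x)))
        + (acEnergy v x * x i - radial v x * pd i v x) * pd i η x := by
    intro i
    rw [pd_mul i dη ((de.fun_mul (dx i)).fun_sub (dr.fun_mul (dp i))),
      pd_sub i (de.fun_mul (dx i)) (dr.fun_mul (dp i)), pd_mul i de (dx i), pd_mul i dr (dp i)]
    simp only [pd_coord, if_true, pd_acEnergy hv, pd_radial hv]
    ring
  simp only [key]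
  have c01 := pd_comm hv 0 1 x
  have c02 := pd_comm hv 0 2 x
  have c12 := pd_comm hv 1 2 x
  have hr : radial v x = x 0 * pd 0 v x + x 1 * pd 1 v x + x 2 * pd 2 v x := by
    simp [radial, Fin.sum_univ_three]
  simp only [acRes, lapl, gradSq, Fin.sum_univ_three, c01, c02, c12, hr]
  ring

/-- The divergence of the field that tests the differential inequality for the excess. -/
theorem div_excess_field {G η F : E 3 → ℝ} {v : E 3 → ℝ} (hG : ContDiff ℝ ∞ G)
    (hη : ContDiff ℝ ∞ η) (hF : ContDiff ℝ ∞ F) (hv : ContDiff ℝ ∞ v) (x : E 3) :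
    ∑ i, pd i (fun y => η y * pd i G y - G y * pd i η y - η y * (F y * pd i v y)) x =
      η x * (lapl G x - ∑ i, pd i (fun y => F y * pd i v y) x) - G x * lapl η x
      - F x * ∑ i, pd i η x * pd i v x := by
  have dη := smooth_differentiable hη
  have dG := smooth_differentiable hG
  have dF := smooth_differentiable hF
  have dp := fun j => smooth_differentiable (contDiff_pd hv j)
  have dGp := fun j => smooth_differentiable (contDiff_pd hG j)
  have dηp := fun j => smooth_differentiable (contDiff_pd hη j)
  have key : ∀ i, pd i (fun y => η y * pd i G y - G y * pd i η y - η y * (F y * pd i v y)) x =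
      η x * (pd i (pd i G) x - pd i (fun y => F y * pd i v y) x) - G x * pd i (pd i η) x
      - F x * (pd i η x * pd i v x) := by
    intro i
    rw [pd_sub i ((dη.fun_mul (dGp i)).fun_sub (dG.fun_mul (dηp i)))
      (dη.fun_mul (dF.fun_mul (dp i))), pd_sub i (dη.fun_mul (dGp i)) (dG.fun_mul (dηp i)),
      pd_mul i dη (dGp i), pd_mul i dG (dηp i), pd_mul i dη (dF.fun_mul (dp i))]
    ring
  simp only [key, lapl, Fin.sum_univ_three]
  ring

/-! ### The weight and the cutoff -/

/-- The weight `1 / (|x|² + 64)`. -/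
def wt (x : E 3) : ℝ := (‖x‖ ^ 2 + 64)⁻¹

theorem wt_pos (x : E 3) : 0 < wt x := by
  unfold wt
  positivity

theorem wt_mul (x : E 3) : ‖x‖ ^ 2 * wt x = 1 - 64 * wt x := by
  unfold wt
  field_simp
  ring

theorem wt_le (x : E 3) : wt x ≤ 1 / 64 := by
  unfold wt
  rw [inv_eq_one_div]
  exact one_div_le_one_div_of_le (by norm_num) (by linarith [sq_nonneg ‖x‖])

theorem contDiff_wt : ContDiff ℝ ∞ wt := by
  unfold wt
  exact ((contDiff_norm_sq ℝ).add contDiff_const).inv fun x => by positivity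

theorem pd_wt (i : Fin 3) (x : E 3) : pd i wt x = -2 * x i * wt x ^ 2 := by
  have dw := smooth_differentiable contDiff_wt
  have dx := fun j => smooth_differentiable (contDiff_coord j)
  have e : (fun y => (∑ j, (fun z : E 3 => z j ^ 2) y + 64) * wt y) = fun _ => 1 := by
    funext y
    have := wt_mul y
    rw [EuclideanSpace.real_norm_sq_eq] at this
    linarith
  have ds : Differentiable ℝ fun y : E 3 => ∑ j, (fun z : E 3 => z j ^ 2) y := by fun_prop
  have h := congrFun (congrArg (pd i) e) x
  rw [pd_const, pd_mul i (ds.add_const 64) dw, pd_add i ds (differentiable_const 64),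
    pd_sum i fun j => (dx j).fun_pow 2, pd_const] at h
  simp only [pd_sq i (dx _), pd_coord] at h
  have h2 : (∑ j, x j ^ 2 + 64) * wt x = 1 := congrFun e x
  have h3 : ∑ j, 2 * x j * (if i = j then (1 : ℝ) else 0) = 2 * x i := by simp
  rw [h3] at h
  have h4 : wt x * ((∑ j, x j ^ 2 + 64) * pd i wt x) = pd i wt x := by
    rw [← mul_assoc, mul_comm (wt x), h2, one_mul]
  rw [← h4, show (∑ j, x j ^ 2 + 64) * pd i wt x = -(wt x * (2 * x i)) by linarith]
  ring

theorem lapl_wt (x : E 3) : lapl wt x = 2 * wt x ^ 2 - 512 * wt x ^ 3 := by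
  have dw := smooth_differentiable contDiff_wt
  have dx := fun j => smooth_differentiable (contDiff_coord j)
  have e : ∀ i, pd i wt = fun y => (-2) * (y i * wt y ^ 2) := fun i => by
    funext y
    rw [pd_wt]
    ring
  have h : ∀ i, pd i (pd i wt) x = -2 * wt x ^ 2 + 8 * x i ^ 2 * wt x ^ 3 := by
    intro i
    rw [e i, pd_const_mul i _ ((dx i).fun_mul (dw.fun_pow 2)), pd_mul i (dx i) (dw.fun_pow 2)]
    simp only [pd_sq i dw, pd_coord, pd_wt, if_true]
    ring
  have h2 := wt_mul x
  rw [EuclideanSpace.real_norm_sq_eq] at h2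
  simp only [lapl, h, Fin.sum_univ_three] at h2 ⊢
  linear_combination (8 * wt x ^ 2) * h2

theorem abs_lapl_wt_le (x : E 3) : |lapl wt x| ≤ wt x / 8 := by
  have h1 := wt_pos x
  have h2 := wt_le x
  rw [lapl_wt, abs_le]
  constructor <;> nlinarith [mul_pos h1 h1, mul_pos (mul_pos h1 h1) h1]

theorem pd_comp_affine (i : Fin 3) {f : E 3 → ℝ} (hf : Differentiable ℝ f) (c : ℝ) (a x : E 3) :
    pd i (fun y => f (a + c • y)) x = c * pd i f (a + c • x) := by
  have h1 : HasFDerivAt (fun y : E 3 => a + c • y) (c • ContinuousLinearMap.id ℝ (E 3)) x :=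
    ((hasFDerivAt_id x).const_smul c).const_add a
  have h2 : fderiv ℝ (fun y => f (a + c • y)) x =
      (fderiv ℝ f (a + c • x)).comp (c • ContinuousLinearMap.id ℝ (E 3)) :=
    ((hf (a + c • x)).hasFDerivAt.comp x h1).fderiv
  simp [pd, h2]

/-- A cutoff between the balls of radius `L` and `2 L`, with derivatives of the natural size. -/
structure IsCutoff (χ : E 3 → ℝ) (K L : ℝ) : Prop where
  smooth : ContDiff ℝ ∞ χ
  nonneg : ∀ x, 0 ≤ χ x
  le_one : ∀ x, χ x ≤ 1
  eq_one : ∀ x, ‖x‖ ≤ L → χ x = 1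
  eq_zero : ∀ x, 2 * L ≤ ‖x‖ → χ x = 0
  grad_le : ∀ x, gradSq χ x ≤ (K / L) ^ 2
  lapl_le : ∀ x, |lapl χ x| ≤ K / L ^ 2

theorem exists_bound_of_hasCompactSupport {f : E 3 → ℝ} (hf : Continuous f)
    (hc : HasCompactSupport f) : ∃ C, ∀ x, |f x| ≤ C := by
  obtain ⟨C, hC⟩ := hc.exists_bound_of_continuous hf
  exact ⟨C, fun x => by simpa using hC x⟩

theorem exists_isCutoff : ∃ K, 1 ≤ K ∧ ∀ L, 0 < L → ∃ χ, IsCutoff χ K L := by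
  let f : ContDiffBump (0 : E 3) := ⟨1, 2, by norm_num, by norm_num⟩
  have hf : ContDiff ℝ ∞ f := f.contDiff
  have hc : HasCompactSupport f := f.hasCompactSupport
  have hcp : ∀ i, HasCompactSupport (pd i f) := fun i => hc.fderiv_apply ℝ _
  have hcg : HasCompactSupport (gradSq f) := by
    refine hc.mono' fun x hx => ?_
    by_contra hx'
    apply hx
    have hz : ∀ i, pd i f x = 0 := fun i => by
      have : x ∉ tsupport (pd i f) := fun h => hx' (tsupport_fderiv_apply_subset ℝ _ h)
      exact image_eq_zero_of_notMem_tsupport this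
    simp [gradSq, hz]
  have hcl : HasCompactSupport (lapl f) := by
    refine hc.mono' fun x hx => ?_
    by_contra hx'
    apply hx
    have hz : ∀ i, pd i (pd i f) x = 0 := fun i => by
      have : x ∉ tsupport (pd i (pd i f)) := fun h =>
        hx' (tsupport_fderiv_apply_subset ℝ _ (tsupport_fderiv_apply_subset ℝ _ h))
      exact image_eq_zero_of_notMem_tsupport this
    simp [lapl, hz]
  obtain ⟨C1, hC1⟩ := exists_bound_of_hasCompactSupport (contDiff_gradSq hf).continuous hcg
  obtain ⟨C2, hC2⟩ := exists_bound_of_hasCompactSupport (contDiff_lapl hf).continuous hcl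
  refine ⟨1 + |C1| + |C2|, by linarith [abs_nonneg C1, abs_nonneg C2], fun L hL => ?_⟩
  have df := smooth_differentiable hf
  have hpd : ∀ i, pd i (fun y : E 3 => f (0 + L⁻¹ • y)) =
      fun y => L⁻¹ * pd i f (0 + L⁻¹ • y) := fun i =>
    funext fun y => pd_comp_affine i df L⁻¹ 0 y
  have hg : ∀ x, gradSq (fun y : E 3 => f (0 + L⁻¹ • y)) x =
      (L⁻¹) ^ 2 * gradSq f (0 + L⁻¹ • x) := fun x => by
    simp only [gradSq, hpd, Fin.sum_univ_three]
    ring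
  have hl : ∀ x, lapl (fun y : E 3 => f (0 + L⁻¹ • y)) x =
      (L⁻¹) ^ 2 * lapl f (0 + L⁻¹ • x) := fun x => by
    have h2 : ∀ i, pd i (pd i fun y : E 3 => f (0 + L⁻¹ • y)) x =
        L⁻¹ * (L⁻¹ * pd i (pd i f) (0 + L⁻¹ • x)) := fun i => by
      have dfi := smooth_differentiable (contDiff_pd hf i)
      rw [hpd, pd_const_mul i _ (by fun_prop)]
      simp only [pd_comp_affine i dfi]
    simp only [lapl, h2, Fin.sum_univ_three]
    ring
  have hnorm : ∀ x : E 3, ‖0 + L⁻¹ • x‖ = ‖x‖ / L := fun x => by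
    rw [zero_add, norm_smul, norm_inv, Real.norm_of_nonneg hL.le, inv_mul_eq_div]
  refine ⟨fun y => f (0 + L⁻¹ • y), ⟨by fun_prop, fun x => f.nonneg, fun x => f.le_one,
    fun x hx => f.one_of_mem_closedBall ?_, fun x hx => f.zero_of_le_dist ?_,
    fun x => ?_, fun x => ?_⟩⟩
  · rw [mem_closedBall_zero_iff, hnorm]
    exact (div_le_one hL).mpr hx
  · rw [dist_zero_right, hnorm, le_div_iff₀ hL]
    exact hx
  · rw [hg, div_pow, div_eq_inv_mul, inv_pow]
    refine mul_le_mul_of_nonneg_left ?_ (by positivity)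
    have := le_of_abs_le (hC1 (0 + L⁻¹ • x))
    nlinarith [le_abs_self C1, abs_nonneg C1, abs_nonneg C2]
  · rw [hl, abs_mul, abs_of_nonneg (by positivity), div_eq_inv_mul, inv_pow]
    refine mul_le_mul_of_nonneg_left ?_ (by positivity)
    have := hC2 (0 + L⁻¹ • x)
    linarith [le_abs_self C2, abs_nonneg C1]

/-! ### Scalar bounds for the excess -/

theorem half_sqrt_bounds : √(1 / 2 : ℝ) ^ 2 = 1 / 2 ∧ 2 / 3 ≤ √(1 / 2 : ℝ) ∧ √(1 / 2 : ℝ) ≤ 1 := by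
  refine ⟨Real.sq_sqrt (by norm_num), Real.le_sqrt_of_sq_le (by norm_num),
    Real.sqrt_le_iff.mpr (by norm_num)⟩

theorem disc_coercive {v σ N D R b : ℝ} (hσ : 0 < σ) (hN : σ ≤ N) (hb : b ^ 2 = 1 / 2)
    (hb1 : 2 / 3 ≤ b) (hD : D = N + b * (v ^ 2 - 1)) (hR : 0 < R) (hR2 : R ^ 2 = D ^ 2 + σ ^ 2) :
    (1 / 4 + N / 3) * max D 0 - σ ≤ (D + R) / 2 / R * (2 * v ^ 2 + 2 * b * N) * D := by
  have hb0 : 0 < b := by linarith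
  have hN0 : 0 < N := by linarith
  rcases le_or_gt 0 D with h | h
  · rw [max_eq_left h]
    have hH : 1 / 2 ≤ (D + R) / 2 / R := by
      rw [div_div, div_le_div_iff₀ (by norm_num) (by positivity)]
      linarith
    have hQ : 1 / 2 + 2 * (N / 3) ≤ 2 * v ^ 2 + 2 * b * N := by
      have h1 : 2 / 3 * N ≤ b * N := mul_le_mul_of_nonneg_right hb1 hN0.le
      have h2 : 0 ≤ b * D := by positivity
      have h3 : b * D = b * N + b ^ 2 * (v ^ 2 - 1) := by rw [hD]; ring
      rw [hb] at h3
      linarith [sq_nonneg v]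
    have h1 : 0 ≤ (1 / 2 + 2 * (N / 3)) * D := by positivity
    have h2 := mul_le_mul_of_nonneg_right hQ h
    have h3 : (1 / 2 + 2 * (N / 3)) * D * (1 / 2) ≤
        (2 * v ^ 2 + 2 * b * N) * D * ((D + R) / 2 / R) :=
      mul_le_mul h2 hH (by norm_num) (h1.trans h2)
    linarith
  · rw [max_eq_right h.le]
    have hRσ : σ ≤ R := by
      by_contra hc
      push Not at hc
      nlinarith
    have hv : v ^ 2 < 1 := by
      by_contra hc
      push Not at hc
      have : 0 ≤ b * (v ^ 2 - 1) := mul_nonneg hb0.le (by linarith)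
      linarith
    have hbN : b * N ≤ 1 / 2 * (1 - v ^ 2) := by
      have h3 : b * D = b * N + b ^ 2 * (v ^ 2 - 1) := by rw [hD]; ring
      rw [hb] at h3
      have := mul_neg_of_pos_of_neg hb0 h
      linarith
    have hQ : 2 * v ^ 2 + 2 * b * N ≤ 2 := by linarith
    have hQ0 : 0 ≤ 2 * v ^ 2 + 2 * b * N := by positivity
    have hDR : -D ≤ R := by nlinarith
    have hG : (D + R) / 2 / R * (-D) ≤ σ / 2 := by
      rw [div_div, div_mul_eq_mul_div, div_le_div_iff₀ (by positivity) (by norm_num)]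
      have h1 : (D + R) * (-D) ≤ (D + R) * R := mul_le_mul_of_nonneg_left hDR (by linarith)
      have h2 : (D + R) * R ≤ (D + R) * (R - D) :=
        mul_le_mul_of_nonneg_left (by linarith) (by linarith)
      have h3 : (D + R) * (R - D) = σ ^ 2 := by linear_combination hR2
      have h4 : σ ^ 2 ≤ σ * R := by nlinarith
      linarith
    have h0 : 0 ≤ (D + R) / 2 / R * (-D) :=
      mul_nonneg (by apply div_nonneg _ hR.le; linarith) (by linarith)
    have := mul_le_mul hQ hG h0 (by norm_num)
    linarith

theorem excess_le_posPart {σ D R : ℝ} (hσ : 0 < σ) (hR2 : R ^ 2 = D ^ 2 + σ ^ 2) :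
    (D + R) / 2 ≤ max D 0 + σ / 2 := by
  have h : R ≤ |D| + σ := by
    apply abs_le_of_sq_le_sq' _ (by positivity) |>.2
    rw [hR2, add_sq, sq_abs]
    have := abs_nonneg D
    nlinarith
  rcases le_or_gt 0 D with hD | hD
  · rw [abs_of_nonneg hD] at h
    linarith [le_max_left D 0]
  · rw [abs_of_neg hD] at h
    linarith [le_max_right D 0]

theorem discrepancy_le {v σ N D P b : ℝ} (hN0 : 0 < N) (hN : N ^ 2 = P + σ ^ 2)
    (hb : b ^ 2 = 1 / 2) (hD : D = N + b * (v ^ 2 - 1)) :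
    P / 2 - W v ≤ N * max D 0 := by
  have hW : W v = (b * (v ^ 2 - 1)) ^ 2 / 2 := by
    rw [mul_pow, hb]; unfold W; ring
  rw [hW]
  generalize b * (v ^ 2 - 1) = t at hD
  have h1 : P ≤ N ^ 2 := by nlinarith
  rcases le_or_gt 0 D with h | h
  · rw [max_eq_left h, hD]
    nlinarith [sq_nonneg (N + t)]
  · rw [max_eq_right h.le]
    nlinarith

theorem excess_le_energy {v σ N D P b : ℝ} (hσ : 0 < σ) (hσ1 : σ ≤ 1)
    (hN : N ^ 2 = P + σ ^ 2) (hb1 : b ≤ 1) (hb0 : 0 < b) (hP : 0 ≤ P)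
    (hD : D = N + b * (v ^ 2 - 1)) :
    max D 0 + σ / 2 ≤ 3 + 2 * (P / 2 + W v) := by
  have h1 : N ≤ 1 + P / 2 := by nlinarith [sq_nonneg (N - 1)]
  have h2 : b * (v ^ 2 - 1) ≤ v ^ 2 := by nlinarith [sq_nonneg v]
  have h3 : v ^ 2 ≤ 3 / 2 + 2 * W v := by unfold W; nlinarith [sq_nonneg (v ^ 2 - 2)]
  have h4 := W_nonneg v
  have h5 : max D 0 ≤ 1 + P / 2 + (3 / 2 + 2 * W v) := max_le (by linarith) (by linarith)
  linarith

/-! ### Bounds for the cut-off weight -/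

theorem abs_sum_mul_le_sqrt (a b : Fin 3 → ℝ) :
    |∑ i, a i * b i| ≤ √(∑ i, a i ^ 2) * √(∑ i, b i ^ 2) := by
  rw [← Real.sqrt_mul (Finset.sum_nonneg fun _ _ => sq_nonneg _)]
  exact Real.abs_le_sqrt (Finset.sum_mul_sq_le_sq_mul_sq _ _ _)

theorem sqrt_sum_coord (x : E 3) : √(∑ i, x i ^ 2) = ‖x‖ := by
  rw [← EuclideanSpace.real_norm_sq_eq, Real.sqrt_sq (norm_nonneg x)]

namespace IsCutoff

variable {χ : E 3 → ℝ} {K L : ℝ}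

theorem pd_eq_zero (h : IsCutoff χ K L) {x : E 3} (hx : ‖x‖ < L) (i : Fin 3) : pd i χ x = 0 := by
  have he : χ =ᶠ[nhds x] fun _ => 1 := by
    filter_upwards [continuous_norm.continuousAt.eventually_lt continuousAt_const hx] with y hy
    exact h.eq_one y hy.le
  rw [pd, he.fderiv_eq]
  simp

theorem lapl_eq_zero (h : IsCutoff χ K L) {x : E 3} (hx : ‖x‖ < L) : lapl χ x = 0 := by
  refine Finset.sum_eq_zero fun i _ => ?_
  have he : pd i χ =ᶠ[nhds x] fun _ => 0 := by
    filter_upwards [continuous_norm.continuousAt.eventually_lt continuousAt_const hx] with y hy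
    exact h.pd_eq_zero hy i
  rw [pd, he.fderiv_eq]
  simp

theorem sqrt_gradSq_le (h : IsCutoff χ K L) (hK : 1 ≤ K) (hL : 0 < L) (x : E 3) :
    √(gradSq χ x) ≤ K / L := by
  rw [← Real.sqrt_sq (by positivity : 0 ≤ K / L)]
  exact Real.sqrt_le_sqrt (h.grad_le x)

theorem wt_le_of_le {x : E 3} (hL : 0 < L) (hx : L ≤ ‖x‖) : wt x ≤ 1 / L ^ 2 := by
  unfold wt
  rw [inv_eq_one_div]
  exact one_div_le_one_div_of_le (by positivity) (by nlinarith)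

theorem norm_mul_wt_le_of_le {x : E 3} (hL : 0 < L) (hx : L ≤ ‖x‖) : ‖x‖ * wt x ≤ 1 / L := by
  unfold wt
  rw [← div_eq_mul_inv, div_le_div_iff₀ (by positivity) hL]
  nlinarith

theorem norm_mul_wt_mul_grad_le (h : IsCutoff χ K L) (hK : 1 ≤ K) (hL : 0 < L) (x : E 3) :
    ‖x‖ * wt x * √(gradSq χ x) ≤ K / L ^ 2 := by
  rcases lt_or_ge ‖x‖ L with hx | hx
  · have : gradSq χ x = 0 := by simp [gradSq, h.pd_eq_zero hx]
    rw [this, Real.sqrt_zero, mul_zero]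
    positivity
  · calc ‖x‖ * wt x * √(gradSq χ x) ≤ 1 / L * (K / L) :=
        mul_le_mul (norm_mul_wt_le_of_le hL hx) (h.sqrt_gradSq_le hK hL x) (Real.sqrt_nonneg _)
          (by positivity)
      _ = K / L ^ 2 := by field_simp

theorem wt_mul_grad_le (h : IsCutoff χ K L) (hK : 1 ≤ K) (hL : 0 < L) (x : E 3) :
    wt x * √(gradSq χ x) ≤ K / L ^ 3 := by
  rcases lt_or_ge ‖x‖ L with hx | hx
  · have : gradSq χ x = 0 := by simp [gradSq, h.pd_eq_zero hx]
    rw [this, Real.sqrt_zero, mul_zero]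
    positivity
  · calc wt x * √(gradSq χ x) ≤ 1 / L ^ 2 * (K / L) :=
        mul_le_mul (wt_le_of_le hL hx) (h.sqrt_gradSq_le hK hL x) (Real.sqrt_nonneg _)
          (by positivity)
      _ = K / L ^ 3 := by field_simp

theorem lapl_mul_wt_le (h : IsCutoff χ K L) (hK : 1 ≤ K) (hL : 0 < L) (x : E 3) :
    |lapl (fun y => χ y * wt y) x| ≤ χ x * wt x / 8 + 5 * K / L ^ 4 := by
  have h1 : lapl (fun y => χ y * wt y) x =
      χ x * lapl wt x + (wt x * lapl χ x - 4 * wt x ^ 2 * ∑ i, x i * pd i χ x) := by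
    rw [lapl_mul h.smooth contDiff_wt]
    simp only [pd_wt, Fin.sum_univ_three]
    ring
  have h2 : |χ x * lapl wt x| ≤ χ x * wt x / 8 := by
    rw [abs_mul, abs_of_nonneg (h.nonneg x), mul_div_assoc]
    exact mul_le_mul_of_nonneg_left (abs_lapl_wt_le x) (h.nonneg x)
  have h3 : |wt x * lapl χ x - 4 * wt x ^ 2 * ∑ i, x i * pd i χ x| ≤ 5 * K / L ^ 4 := by
    rcases lt_or_ge ‖x‖ L with hx | hx
    · simp only [h.pd_eq_zero hx, h.lapl_eq_zero hx, mul_zero, Finset.sum_const_zero, sub_zero,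
        abs_zero]
      positivity
    · have hw := wt_le_of_le hL hx
      have hw0 := (wt_pos x).le
      have a1 : |wt x * lapl χ x| ≤ 1 / L ^ 2 * (K / L ^ 2) := by
        rw [abs_mul, abs_of_nonneg hw0]
        exact mul_le_mul hw (h.lapl_le x) (abs_nonneg _) (by positivity)
      have a2 : |4 * wt x ^ 2 * ∑ i, x i * pd i χ x| ≤ 4 * (1 / L ^ 2 * (K / L ^ 2)) := by
        have hcs := abs_sum_mul_le_sqrt (fun i => x i) (fun i => pd i χ x)
        rw [sqrt_sum_coord] at hcs
        rw [abs_mul, abs_of_nonneg (by positivity)]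
        calc 4 * wt x ^ 2 * |∑ i, x i * pd i χ x|
            ≤ 4 * wt x ^ 2 * (‖x‖ * √(gradSq χ x)) :=
              mul_le_mul_of_nonneg_left hcs (by positivity)
          _ = 4 * (wt x * (‖x‖ * wt x * √(gradSq χ x))) := by ring
          _ ≤ 4 * (1 / L ^ 2 * (K / L ^ 2)) := by
              refine mul_le_mul_of_nonneg_left (mul_le_mul hw
                (h.norm_mul_wt_mul_grad_le hK hL x) (by positivity) (by positivity)) (by norm_num)
      have e : 5 * K / L ^ 4 = 1 / L ^ 2 * (K / L ^ 2) + 4 * (1 / L ^ 2 * (K / L ^ 2)) := by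
        field_simp; ring
      rw [e]
      exact (abs_sub _ _).trans (add_le_add a1 a2)
  rw [h1]
  exact (abs_add_le _ _).trans (add_le_add h2 h3)

end IsCutoff

/-! ### The weighted energy estimate -/

theorem pd_mul_wt {χ : E 3 → ℝ} (hχ : ContDiff ℝ ∞ χ) (i : Fin 3) (x : E 3) :
    pd i (fun y => χ y * wt y) x = wt x * pd i χ x - 2 * χ x * wt x ^ 2 * x i := by
  rw [pd_mul i (smooth_differentiable hχ) (smooth_differentiable contDiff_wt)]
  simp only [pd_wt]
  ring

theorem grad_mul_wt_inner {χ : E 3 → ℝ} (hχ : ContDiff ℝ ∞ χ) (v : E 3 → ℝ) (x : E 3) :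
    ∑ i, pd i (fun y => χ y * wt y) x * pd i v x =
      wt x * (∑ i, pd i χ x * pd i v x) - 2 * χ x * wt x ^ 2 * radial v x := by
  simp only [pd_mul_wt hχ, radial, Fin.sum_univ_three]
  ring

theorem abs_radial_le (v : E 3 → ℝ) (x : E 3) : |radial v x| ≤ ‖x‖ * √(gradSq v x) := by
  have h := abs_sum_mul_le_sqrt (fun i => x i) (fun i => pd i v x)
  rwa [sqrt_sum_coord] at h

theorem pohozaev_ge {v χ : E 3 → ℝ} {K L : ℝ} (hv : ContDiff ℝ ∞ v) (hχ : IsCutoff χ K L)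
    (hK : 1 ≤ K) (hL : 0 < L) (x : E 3) :
    128 * χ x * wt x ^ 2 * acEnergy v x - χ x * wt x * (gradSq v x / 2 - W (v x))
        - acRes v x ^ 2 / 4 - 3 * K / L ^ 2 * acEnergy v x ≤
      ∑ i, pd i (fun y => χ y * wt y * (acEnergy v y * y i - radial v y * pd i v y)) x := by
  rw [div_pohozaev hv (hχ.smooth.mul contDiff_wt), grad_mul_wt_inner hχ.smooth]
  have hx : ∑ i, x i * pd i (fun y => χ y * wt y) x =
      wt x * (∑ i, x i * pd i χ x) - 2 * χ x * wt x * (1 - 64 * wt x) := by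
    have h := wt_mul x
    rw [EuclideanSpace.real_norm_sq_eq] at h
    simp only [pd_mul_wt hχ.smooth, Fin.sum_univ_three] at h ⊢
    linear_combination (-2 * χ x * wt x) * h
  rw [hx]
  have hp0 := gradSq_nonneg v x
  have he0 := acEnergy_nonneg v x
  have hW0 := W_nonneg (v x)
  have hw0 := (wt_pos x).le
  have hχ0 := hχ.nonneg x
  have hχ1 := hχ.le_one x
  have hPe : gradSq v x ≤ 2 * acEnergy v x := by unfold acEnergy; linarith
  have hs := Real.sqrt_nonneg (gradSq χ x)
  have hkey := hχ.norm_mul_wt_mul_grad_le hK hL x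
  have hkey0 : 0 ≤ ‖x‖ * wt x * √(gradSq χ x) := by positivity
  have c1 : |acEnergy v x * (wt x * ∑ i, x i * pd i χ x)| ≤ K / L ^ 2 * acEnergy v x := by
    have h := abs_sum_mul_le_sqrt (fun i => x i) (fun i => pd i χ x)
    rw [sqrt_sum_coord] at h
    rw [abs_mul, abs_mul, abs_of_nonneg he0, abs_of_nonneg hw0, mul_comm (acEnergy v x)]
    refine mul_le_mul_of_nonneg_right ?_ he0
    calc wt x * |∑ i, x i * pd i χ x| ≤ wt x * (‖x‖ * √(gradSq χ x)) :=
          mul_le_mul_of_nonneg_left h hw0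
      _ = ‖x‖ * wt x * √(gradSq χ x) := by ring
      _ ≤ _ := hkey
  have c2 : |radial v x * (wt x * ∑ i, pd i χ x * pd i v x)| ≤ 2 * (K / L ^ 2) * acEnergy v x := by
    have h := abs_sum_mul_le_sqrt (fun i => pd i χ x) (fun i => pd i v x)
    rw [abs_mul, abs_mul, abs_of_nonneg hw0]
    calc |radial v x| * (wt x * |∑ i, pd i χ x * pd i v x|)
        ≤ (‖x‖ * √(gradSq v x)) * (wt x * (√(gradSq χ x) * √(gradSq v x))) :=
          mul_le_mul (abs_radial_le v x) (mul_le_mul_of_nonneg_left h hw0) (by positivity)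
            (by positivity)
      _ = ‖x‖ * wt x * √(gradSq χ x) * gradSq v x := by
          have := Real.mul_self_sqrt hp0
          linear_combination (‖x‖ * wt x * √(gradSq χ x)) * this
      _ ≤ K / L ^ 2 * (2 * acEnergy v x) :=
          mul_le_mul hkey hPe hp0 (hkey0.trans hkey)
      _ = _ := by ring
  have c3 : χ x * wt x * (radial v x * acRes v x) ≤
      2 * χ x * wt x ^ 2 * radial v x ^ 2 + acRes v x ^ 2 / 4 := by
    have h1 : 0 ≤ χ x * (wt x * radial v x - acRes v x / 2) ^ 2 := by positivity
    have h2 : 0 ≤ χ x * (wt x * radial v x) ^ 2 := by positivity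
    have h3 : 0 ≤ (1 - χ x) * acRes v x ^ 2 := mul_nonneg (by linarith) (sq_nonneg _)
    nlinarith
  have eE : acEnergy v x = gradSq v x / 2 + W (v x) := rfl
  have b1 := neg_le_of_abs_le c1
  have b2 := le_of_abs_le c2
  have i1 : χ x * wt x * (3 * acEnergy v x - gradSq v x - radial v x * acRes v x)
      + acEnergy v x * (wt x * ∑ i, x i * pd i χ x - 2 * χ x * wt x * (1 - 64 * wt x))
      - radial v x * (wt x * ∑ i, pd i χ x * pd i v x - 2 * χ x * wt x ^ 2 * radial v x) =
      128 * χ x * wt x ^ 2 * acEnergy v x - χ x * wt x * (gradSq v x / 2 - W (v x))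
      + acEnergy v x * (wt x * ∑ i, x i * pd i χ x)
      - radial v x * (wt x * ∑ i, pd i χ x * pd i v x)
      + (2 * χ x * wt x ^ 2 * radial v x ^ 2 - χ x * wt x * (radial v x * acRes v x)) := by
    rw [eE]
    ring
  rw [i1]
  have e3 : 3 * K / L ^ 2 * acEnergy v x =
    K / L ^ 2 * acEnergy v x + 2 * (K / L ^ 2) * acEnergy v x := by ring
  linarith

theorem fluxCoeff_mul_grad_le {v σ : E 3 → ℝ} (hpos : ∀ x, 0 < σ x) (x : E 3) :
    0 ≤ fluxCoeff v σ x ∧ fluxCoeff v σ x * √(gradSq v x) ≤ 1 := by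
  have hR := regAbs_pos (v := v) hpos x
  have hN := regGrad_pos (v := v) hpos x
  have hG := excess_nonneg (v := v) (σ := σ) x
  have hGR := excess_le_regAbs (v := v) (σ := σ) x
  have hP : √(gradSq v x) ≤ regGrad v σ x :=
    Real.sqrt_le_sqrt (by linarith [sq_nonneg (σ x)])
  refine ⟨by unfold fluxCoeff; positivity, ?_⟩
  unfold fluxCoeff
  rw [div_mul_eq_mul_div, div_le_one (by positivity)]
  exact mul_le_mul hGR hP (Real.sqrt_nonneg _) hR.le

set_option maxHeartbeats 1000000 in
-- many nonlinear estimates in one declaration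
theorem excess_field_ge {v χ : E 3 → ℝ} {K L κ : ℝ} (hv : ContDiff ℝ ∞ v) (hχ : IsCutoff χ K L)
    (hK : 1 ≤ K) (hL : 1 ≤ L) (hκ : 0 < κ) (hκ1 : κ ≤ 1) (x : E 3) :
    χ x * wt x * (gradSq v x / 2 - W (v x)) / 3
        - κ * (χ x * wt x ^ 2) * (15 + 10 * acEnergy v x)
        - 7 * (acRes v x ^ 2 / κ) - 5 * K / L ^ 4 * (3 + 2 * acEnergy v x) - K ^ 2 / L ^ 6 ≤
      ∑ i, pd i (fun y => χ y * wt y * pd i (excess v fun z => κ * wt z) y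
        - excess v (fun z => κ * wt z) y * pd i (fun z => χ z * wt z) y
        - χ y * wt y * (acRes v y * fluxCoeff v (fun z => κ * wt z) y * pd i v y)) x := by
  set σ : E 3 → ℝ := fun z => κ * wt z with hσdef
  have hL0 : 0 < L := by linarith
  have hσ : ContDiff ℝ ∞ σ := contDiff_const.mul contDiff_wt
  have hpos : ∀ z, 0 < σ z := fun z => mul_pos hκ (wt_pos z)
  have hw0 := wt_pos x
  have hw1 := wt_le x
  have hσ1 : σ x ≤ 1 := by
    have : κ * wt x ≤ 1 * (1 / 64) := mul_le_mul hκ1 hw1 hw0.le zero_le_one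
    change κ * wt x ≤ 1
    linarith
  have hls : |lapl σ x| ≤ σ x := by
    rw [hσdef, lapl_const_mul κ contDiff_wt, abs_mul, abs_of_pos hκ]
    exact mul_le_mul_of_nonneg_left ((abs_lapl_wt_le x).trans (by linarith)) hκ.le
  have hineq := excess_diff_ineq hv hσ hpos x hσ1 hls
  rw [div_excess_field (contDiff_excess hv hσ hpos) (hχ.smooth.mul contDiff_wt)
    ((contDiff_acRes hv).mul (contDiff_fluxCoeff hv hσ hpos)) hv]
  obtain ⟨hb, hb1, hb2⟩ := half_sqrt_bounds
  have hN0 := regGrad_pos (v := v) hpos x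
  have hR0 := regAbs_pos (v := v) hpos x
  have hR2 : regAbs v σ x ^ 2 = regDisc v σ x ^ 2 + σ x ^ 2 :=
    Real.sq_sqrt (regAbs_arg_pos hpos x).le
  have hN2 : regGrad v σ x ^ 2 = gradSq v x + σ x ^ 2 := Real.sq_sqrt (regGrad_arg_pos hpos x).le
  have k1 := disc_coercive (v := v x) (D := regDisc v σ x) (hpos x)
    (regGrad_ge (v := v) x) hb hb1 rfl
    hR0 hR2
  have k2 := excess_le_posPart (hpos x) hR2
  have k3 := discrepancy_le hN0 hN2 hb (D := regDisc v σ x) (v := v x) rfl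
  have k4 := excess_le_energy (hpos x) hσ1 hN2 hb2 (by linarith) (gradSq_nonneg v x)
    (D := regDisc v σ x) (v := v x) rfl
  change _ ≤ excess v σ x / regAbs v σ x * _ * _ at k1
  change excess v σ x ≤ _ at k2
  change _ ≤ 3 + 2 * acEnergy v x at k4
  have hη0 : 0 ≤ χ x * wt x := mul_nonneg (hχ.nonneg x) hw0.le
  have hχ0 := hχ.nonneg x
  have hχ1 := hχ.le_one x
  have he0 := acEnergy_nonneg v x
  have hM0 : 0 ≤ max (regDisc v σ x) 0 := le_max_right _ _
  generalize hM : max (regDisc v σ x) 0 = M at k1 k2 k3 k4 hM0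
  -- the Laplacian of the weight
  have l1 : excess v σ x * lapl (fun y => χ y * wt y) x ≤
      (M + σ x / 2) * (χ x * wt x / 8) + 5 * K / L ^ 4 * (3 + 2 * acEnergy v x) := by
    have h1 := (le_abs_self _).trans (hχ.lapl_mul_wt_le hK hL0 x)
    have hG := excess_nonneg (v := v) (σ := σ) x
    have hC : 0 ≤ 5 * K / L ^ 4 := by positivity
    calc excess v σ x * lapl (fun y => χ y * wt y) x
        ≤ excess v σ x * (χ x * wt x / 8 + 5 * K / L ^ 4) := mul_le_mul_of_nonneg_left h1 hG
      _ = excess v σ x * (χ x * wt x / 8) + 5 * K / L ^ 4 * excess v σ x := by ring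
      _ ≤ _ := add_le_add (mul_le_mul_of_nonneg_right k2 (by positivity))
          (mul_le_mul_of_nonneg_left (k2.trans k4) hC)
  -- the transport term
  have l2 : acRes v x * fluxCoeff v σ x * ∑ i, pd i (fun y => χ y * wt y) x * pd i v x ≤
      acRes v x ^ 2 / κ + acRes v x ^ 2 / κ + κ * (χ x * wt x ^ 2) + K ^ 2 / L ^ 6 := by
    obtain ⟨hB0, hB1⟩ := fluxCoeff_mul_grad_le (v := v) hpos x
    rw [grad_mul_wt_inner hχ.smooth]
    have hcs := abs_sum_mul_le_sqrt (fun i => pd i χ x) (fun i => pd i v x)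
    change _ ≤ √(gradSq χ x) * √(gradSq v x) at hcs
    have a1 : |wt x * ∑ i, pd i χ x * pd i v x - 2 * χ x * wt x ^ 2 * radial v x| ≤
        (K / L ^ 3 + 2 * χ x * wt x ^ 2 * ‖x‖) * √(gradSq v x) := by
      refine (abs_sub _ _).trans ?_
      rw [add_mul, abs_mul, abs_mul, abs_of_pos hw0,
        abs_of_nonneg (by positivity : 0 ≤ 2 * χ x * wt x ^ 2)]
      refine add_le_add ?_ ?_
      · calc wt x * |∑ i, pd i χ x * pd i v x| ≤ wt x * (√(gradSq χ x) * √(gradSq v x)) :=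
              mul_le_mul_of_nonneg_left hcs hw0.le
          _ = wt x * √(gradSq χ x) * √(gradSq v x) := by ring
          _ ≤ _ := mul_le_mul_of_nonneg_right (hχ.wt_mul_grad_le hK hL0 x) (Real.sqrt_nonneg _)
      · rw [mul_assoc _ ‖x‖]
        exact mul_le_mul_of_nonneg_left (abs_radial_le v x) (by positivity)
    have a2 : |acRes v x * fluxCoeff v σ x *
        (wt x * ∑ i, pd i χ x * pd i v x - 2 * χ x * wt x ^ 2 * radial v x)| ≤
        |acRes v x| * (K / L ^ 3 + 2 * χ x * wt x ^ 2 * ‖x‖) := by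
      rw [mul_assoc, abs_mul, abs_mul, abs_of_nonneg hB0]
      refine mul_le_mul_of_nonneg_left ?_ (abs_nonneg _)
      have hc : 0 ≤ K / L ^ 3 + 2 * χ x * wt x ^ 2 * ‖x‖ := by positivity
      calc _ ≤ fluxCoeff v σ x * ((K / L ^ 3 + 2 * χ x * wt x ^ 2 * ‖x‖) * √(gradSq v x)) :=
            mul_le_mul_of_nonneg_left a1 hB0
        _ = (K / L ^ 3 + 2 * χ x * wt x ^ 2 * ‖x‖) * (fluxCoeff v σ x * √(gradSq v x)) := by ring
        _ ≤ _ := by simpa using mul_le_mul_of_nonneg_left hB1 hc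
    have a3 : |acRes v x| * (K / L ^ 3) ≤ acRes v x ^ 2 / κ + K ^ 2 / L ^ 6 := by
      have h1 : acRes v x ^ 2 ≤ acRes v x ^ 2 / κ := by
        rw [le_div_iff₀ hκ]
        exact mul_le_of_le_one_right (sq_nonneg _) hκ1
      have h2 : K ^ 2 / L ^ 6 = (K / L ^ 3) ^ 2 := by rw [div_pow]; ring
      rw [h2]
      rw [← sq_abs] at h1 ⊢
      nlinarith [sq_nonneg (|acRes v x| - K / L ^ 3), sq_nonneg (K / L ^ 3),
        sq_nonneg (|acRes v x|)]
    have a4 : |acRes v x| * (2 * χ x * wt x ^ 2 * ‖x‖) ≤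
        acRes v x ^ 2 / κ + κ * (χ x * wt x ^ 2) := by
      have h1 : 0 ≤ (|acRes v x| - κ * wt x ^ 2 * ‖x‖) ^ 2 / κ := by positivity
      have h2 : (|acRes v x| - κ * wt x ^ 2 * ‖x‖) ^ 2 / κ =
          acRes v x ^ 2 / κ - 2 * |acRes v x| * (wt x ^ 2 * ‖x‖)
          + κ * wt x ^ 3 * (‖x‖ ^ 2 * wt x) := by
        rw [← sq_abs (acRes v x)]
        field_simp
        ring
      have h3 : κ * wt x ^ 3 * (‖x‖ ^ 2 * wt x) ≤ κ * wt x ^ 2 := by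
        rw [wt_mul]
        have : wt x * (1 - 64 * wt x) ≤ 1 := by nlinarith
        calc κ * wt x ^ 3 * (1 - 64 * wt x) = κ * wt x ^ 2 * (wt x * (1 - 64 * wt x)) := by ring
          _ ≤ κ * wt x ^ 2 * 1 := mul_le_mul_of_nonneg_left this (by positivity)
          _ = _ := by ring
      have h4 : 2 * |acRes v x| * (wt x ^ 2 * ‖x‖) ≤ acRes v x ^ 2 / κ + κ * wt x ^ 2 := by
        linarith
      have h5 : χ x * (acRes v x ^ 2 / κ) ≤ acRes v x ^ 2 / κ :=
        mul_le_of_le_one_left (by positivity) hχ1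
      calc _ = χ x * (2 * |acRes v x| * (wt x ^ 2 * ‖x‖)) := by ring
        _ ≤ χ x * (acRes v x ^ 2 / κ + κ * wt x ^ 2) := mul_le_mul_of_nonneg_left h4 hχ0
        _ = χ x * (acRes v x ^ 2 / κ) + κ * (χ x * wt x ^ 2) := by ring
        _ ≤ _ := by linarith
    have a5 := (le_abs_self _).trans a2
    rw [mul_add] at a5
    linarith
  -- the differential inequality
  have hv2 : v x ^ 2 ≤ 3 / 2 + 2 * acEnergy v x := by
    have h1 : v x ^ 2 ≤ 3 / 2 + 2 * W (v x) := by unfold W; nlinarith [sq_nonneg (v x ^ 2 - 2)]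
    have : W (v x) ≤ acEnergy v x := by
      have := gradSq_nonneg v x
      unfold acEnergy
      linarith
    linarith
  have l3 : χ x * wt x * ((1 / 4 + regGrad v σ x / 3) * M - σ x - 5 * acRes v x ^ 2 / σ x
      - 5 * σ x * (5 / 2 + 2 * acEnergy v x)) ≤ χ x * wt x * (lapl (excess v σ) x
        - ∑ i, pd i (fun y => acRes v y * fluxCoeff v σ y * pd i v y) x) := by
    refine mul_le_mul_of_nonneg_left (le_trans ?_ hineq) hη0
    have : 5 * σ x * (1 + v x ^ 2) ≤ 5 * σ x * (5 / 2 + 2 * acEnergy v x) :=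
      mul_le_mul_of_nonneg_left (by linarith) (by linarith [hpos x])
    linarith
  have l4 : χ x * wt x * (5 * acRes v x ^ 2 / σ x) ≤ 5 * (acRes v x ^ 2 / κ) := by
    have : χ x * wt x * (5 * acRes v x ^ 2 / σ x) = χ x * (5 * (acRes v x ^ 2 / κ)) := by
      change χ x * wt x * (5 * acRes v x ^ 2 / (κ * wt x)) = _
      field_simp
    rw [this]
    exact mul_le_of_le_one_left (by positivity) hχ1
  have l5 : χ x * wt x * (gradSq v x / 2 - W (v x)) / 3 ≤
      χ x * wt x * (regGrad v σ x / 3 * M) := by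
    have := mul_le_mul_of_nonneg_left k3 hη0
    linarith
  have l6 : 0 ≤ χ x * wt x * M := by positivity
  have l7 : χ x * wt x * σ x = κ * (χ x * wt x ^ 2) := by
    change χ x * wt x * (κ * wt x) = _
    ring
  have l8 : 0 ≤ κ * (χ x * wt x ^ 2) := by positivity
  have l9 : χ x * wt x * ((1 / 4 + regGrad v σ x / 3) * M - σ x - 5 * acRes v x ^ 2 / σ x
      - 5 * σ x * (5 / 2 + 2 * acEnergy v x)) =
      χ x * wt x * M / 4 + χ x * wt x * (regGrad v σ x / 3 * M)
      - χ x * wt x * (5 * acRes v x ^ 2 / σ x)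
      - κ * (χ x * wt x ^ 2) * (27 / 2 + 10 * acEnergy v x) := by
    rw [← l7]
    ring
  have l10 : (M + σ x / 2) * (χ x * wt x / 8) =
      χ x * wt x * M / 8 + κ * (χ x * wt x ^ 2) / 16 := by
    rw [← l7]
    ring
  rw [l9] at l3
  rw [l10] at l1
  linarith

theorem pd_eq_zero_of_lt_norm {f : E 3 → ℝ} {r : ℝ} (h : ∀ y, r < ‖y‖ → f y = 0) (i : Fin 3)
    {x : E 3} (hx : r < ‖x‖) : pd i f x = 0 := by
  have he : f =ᶠ[nhds x] fun _ => 0 := by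
    filter_upwards [continuousAt_const.eventually_lt continuous_norm.continuousAt hx] with y hy
    exact h y hy
  rw [pd, he.fderiv_eq]
  simp

/-- The divergence theorem on a ball, for fields that vanish outside it. -/
theorem integral_closedBall_div {Y : Fin 3 → E 3 → ℝ} {r : ℝ} (hY : ∀ i, ContDiff ℝ ∞ (Y i))
    (h0 : ∀ i y, r < ‖y‖ → Y i y = 0) :
    ∫ x in closedBall (0 : E 3) r, ∑ i, pd i (Y i) x = 0 := by
  rw [setIntegral_eq_integral_of_forall_compl_eq_zero]
  · refine integral_div_eq_zero hY fun i => HasCompactSupport.intro (isCompact_closedBall 0 r) ?_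
    intro y hy
    exact h0 i y (by simpa using hy)
  · intro x hx
    exact Finset.sum_eq_zero fun i _ => pd_eq_zero_of_lt_norm (h0 i) i (by simpa using hx)

theorem integrable_wt_sq : Integrable fun x : E 3 => wt x ^ 2 := by
  have h : Integrable fun x : E 3 => (1 + ‖x‖ ^ 2) ^ (-(4 : ℝ) / 2) :=
    integrable_rpow_neg_one_add_norm_sq (by simp; norm_num)
  refine h.mono' (contDiff_wt.pow 2).continuous.aestronglyMeasurable
    (Filter.Eventually.of_forall fun x => ?_)
  have hs : (0 : ℝ) < 1 + ‖x‖ ^ 2 := by positivity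
  have e : (1 + ‖x‖ ^ 2) ^ (-(4 : ℝ) / 2) = ((1 + ‖x‖ ^ 2)⁻¹) ^ 2 := by
    rw [show (-(4 : ℝ) / 2) = -((2 : ℕ) : ℝ) by norm_num, Real.rpow_neg hs.le, Real.rpow_natCast,
      inv_pow]
  rw [e, Real.norm_of_nonneg (by have := wt_pos x; positivity)]
  refine pow_le_pow_left₀ (wt_pos x).le ?_ 2
  unfold wt
  exact inv_anti₀ hs (by linarith)

theorem weighted_pointwise {v χ : E 3 → ℝ} {K L κ : ℝ} (hv : ContDiff ℝ ∞ v)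
    (hχ : IsCutoff χ K L) (hK : 1 ≤ K) (hL : 1 ≤ L) (hκ : 0 < κ) (hκ1 : κ ≤ 1) (x : E 3) :
    98 * (χ x * wt x ^ 2 * acEnergy v x) ≤
      3 * ∑ i, pd i (fun y => χ y * wt y * pd i (excess v fun z => κ * wt z) y
        - excess v (fun z => κ * wt z) y * pd i (fun z => χ z * wt z) y
        - χ y * wt y * (acRes v y * fluxCoeff v (fun z => κ * wt z) y * pd i v y)) x
      + ∑ i, pd i (fun y => χ y * wt y * (acEnergy v y * y i - radial v y * pd i v y)) x
      + 45 * κ * wt x ^ 2 + 22 / κ * acRes v x ^ 2 + 33 * K / L ^ 2 * acEnergy v x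
      + 48 * K ^ 2 / L ^ 4 := by
  have h1 := pohozaev_ge hv hχ hK (by linarith) x
  have h2 := excess_field_ge hv hχ hK hL hκ hκ1 x
  have he := acEnergy_nonneg v x
  have hw : 0 ≤ χ x * wt x ^ 2 := mul_nonneg (hχ.nonneg x) (sq_nonneg _)
  have hL0 : 0 < L := by linarith
  have a1 : κ * (χ x * wt x ^ 2) * acEnergy v x ≤ χ x * wt x ^ 2 * acEnergy v x := by
    rw [mul_assoc]
    exact mul_le_of_le_one_left (by positivity) hκ1
  have a2 : κ * (χ x * wt x ^ 2) ≤ κ * wt x ^ 2 :=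
    mul_le_mul_of_nonneg_left (mul_le_of_le_one_left (sq_nonneg _) (hχ.le_one x)) hκ.le
  have a3 : acRes v x ^ 2 / 4 + 21 * (acRes v x ^ 2 / κ) ≤ 22 / κ * acRes v x ^ 2 := by
    have : acRes v x ^ 2 ≤ acRes v x ^ 2 / κ := by
      rw [le_div_iff₀ hκ]
      exact mul_le_of_le_one_right (sq_nonneg _) hκ1
    have e : 22 / κ * acRes v x ^ 2 = 22 * (acRes v x ^ 2 / κ) := by ring
    rw [e]
    linarith [sq_nonneg (acRes v x)]
  have hL2 : 1 ≤ L ^ 2 := one_le_pow₀ hL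
  have a4 : K / L ^ 4 ≤ K / L ^ 2 :=
    div_le_div_of_nonneg_left (by linarith) (by positivity) (pow_le_pow_right₀ hL (by norm_num))
  have a5 : K / L ^ 4 ≤ K ^ 2 / L ^ 4 := by gcongr; nlinarith
  have a6 : K ^ 2 / L ^ 6 ≤ K ^ 2 / L ^ 4 :=
    div_le_div_of_nonneg_left (by positivity) (by positivity) (pow_le_pow_right₀ hL (by norm_num))
  have a7 : K / L ^ 4 * acEnergy v x ≤ K / L ^ 2 * acEnergy v x := mul_le_mul_of_nonneg_right a4 he
  have e1 : 5 * K / L ^ 4 * (3 + 2 * acEnergy v x) =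
    15 * (K / L ^ 4) + 10 * (K / L ^ 4 * acEnergy v x) := by ring
  have e2 : 3 * K / L ^ 2 * acEnergy v x = 3 * (K / L ^ 2 * acEnergy v x) := by ring
  have e3 : 33 * K / L ^ 2 * acEnergy v x = 33 * (K / L ^ 2 * acEnergy v x) := by ring
  have e4 : 48 * K ^ 2 / L ^ 4 = 48 * (K ^ 2 / L ^ 4) := by ring
  rw [e1] at h2
  rw [e2] at h1
  rw [e3, e4]
  linarith

/-- The energy in a fixed ball is controlled by the residual and by the energy density on a large
scale. -/
theorem energy_ball_le : ∃ C, 0 < C ∧ ∀ (v : E 3 → ℝ) (κ L : ℝ), ContDiff ℝ ∞ v → 0 < κ → κ ≤ 1 →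
    8 ≤ L → ∫ x in closedBall (0 : E 3) 8, acEnergy v x ≤
      C * (κ + 1 / κ * (∫ x in closedBall (0 : E 3) (2 * L), acRes v x ^ 2)
        + 1 / L ^ 2 * (∫ x in closedBall (0 : E 3) (2 * L), acEnergy v x) + 1 / L) := by
  obtain ⟨K, hK, hcut⟩ := exists_isCutoff
  set I := ∫ x : E 3, wt x ^ 2 with hI
  have hI0 : 0 ≤ I := integral_nonneg fun x => sq_nonneg _
  set V := (volume : Measure (E 3)).real (closedBall 0 1) with hV
  have hV0 : 0 ≤ V := measureReal_nonneg
  refine ⟨168 * (45 * I + 33 * K + 384 * K ^ 2 * V + 22), by positivity,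
    fun v κ L hv hκ hκ1 hL => ?_⟩
  have hL0 : 0 < L := by linarith
  obtain ⟨χ, hχ⟩ := hcut L hL0
  have hσ : ContDiff ℝ ∞ fun z => κ * wt z := contDiff_const.mul contDiff_wt
  have hpos : ∀ z, 0 < κ * wt z := fun z => mul_pos hκ (wt_pos z)
  have hη : ContDiff ℝ ∞ fun z => χ z * wt z := hχ.smooth.mul contDiff_wt
  set Y1 : Fin 3 → E 3 → ℝ := fun i y =>
    χ y * wt y * (acEnergy v y * y i - radial v y * pd i v y) with hY1
  set Y2 : Fin 3 → E 3 → ℝ := fun i y => χ y * wt y * pd i (excess v fun z => κ * wt z) y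
    - excess v (fun z => κ * wt z) y * pd i (fun z => χ z * wt z) y
    - χ y * wt y * (acRes v y * fluxCoeff v (fun z => κ * wt z) y * pd i v y) with hY2
  have sY1 : ∀ i, ContDiff ℝ ∞ (Y1 i) := fun i =>
    hη.mul (((contDiff_acEnergy hv).mul (contDiff_coord i)).sub
      ((contDiff_radial hv).mul (contDiff_pd hv i)))
  have sY2 : ∀ i, ContDiff ℝ ∞ (Y2 i) := fun i =>
    ((hη.mul (contDiff_pd (contDiff_excess hv hσ hpos) i)).sub
      ((contDiff_excess hv hσ hpos).mul (contDiff_pd hη i))).sub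
      (hη.mul (((contDiff_acRes hv).mul (contDiff_fluxCoeff hv hσ hpos)).mul (contDiff_pd hv i)))
  have zη : ∀ y : E 3, 2 * L < ‖y‖ → χ y * wt y = 0 := fun y hy => by
    rw [hχ.eq_zero y hy.le, zero_mul]
  have zY1 : ∀ i (y : E 3), 2 * L < ‖y‖ → Y1 i y = 0 := fun i y hy => by
    simp only [hY1, zη y hy, zero_mul]
  have zY2 : ∀ i (y : E 3), 2 * L < ‖y‖ → Y2 i y = 0 := fun i y hy => by
    simp only [hY2, zη y hy, pd_eq_zero_of_lt_norm zη i hy, zero_mul, mul_zero, sub_zero]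
  have int1 := integral_closedBall_div sY1 zY1
  have int2 := integral_closedBall_div sY2 zY2
  set B := closedBall (0 : E 3) (2 * L) with hB
  have hBc : IsCompact B := isCompact_closedBall 0 (2 * L)
  have hBm : MeasurableSet B := measurableSet_closedBall
  have cd1 : Continuous fun x => ∑ i, pd i (Y1 i) x :=
    continuous_finsetSum _ fun i _ => (contDiff_pd (sY1 i) i).continuous
  have cd2 : Continuous fun x => ∑ i, pd i (Y2 i) x :=
    continuous_finsetSum _ fun i _ => (contDiff_pd (sY2 i) i).continuous
  have cw : Continuous fun x => wt x ^ 2 := (contDiff_wt.pow 2).continuous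
  have ce : Continuous (acEnergy v) := (contDiff_acEnergy hv).continuous
  have cg : Continuous fun x => acRes v x ^ 2 := ((contDiff_acRes hv).pow 2).continuous
  have cl : Continuous fun x => 98 * (χ x * wt x ^ 2 * acEnergy v x) :=
    continuous_const.mul ((hχ.smooth.continuous.mul cw).mul ce)
  have ii : ∀ {f : E 3 → ℝ}, Continuous f → IntegrableOn f B := fun hf =>
    hf.continuousOn.integrableOn_compact hBc
  have main : ∫ x in B, 98 * (χ x * wt x ^ 2 * acEnergy v x) ≤
      ∫ x in B, (3 * ∑ i, pd i (Y2 i) x + ∑ i, pd i (Y1 i) x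
      + 45 * κ * wt x ^ 2 + 22 / κ * acRes v x ^ 2 + 33 * K / L ^ 2 * acEnergy v x
      + 48 * K ^ 2 / L ^ 4) := by
    refine setIntegral_mono (ii cl) (ii (by fun_prop)) fun x => ?_
    exact weighted_pointwise hv hχ hK (by linarith) hκ hκ1 x
  rw [integral_add (ii (by fun_prop)) (ii (by fun_prop)),
    integral_add (ii (by fun_prop)) (ii (by fun_prop)),
    integral_add (ii (by fun_prop)) (ii (by fun_prop)),
    integral_add (ii (by fun_prop)) (ii (by fun_prop)),
    integral_add (ii (by fun_prop)) (ii (by fun_prop)), integral_const_mul, integral_const_mul,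
    integral_const_mul, integral_const_mul, integral_const_mul, int1, int2, setIntegral_const]
    at main
  have hVol : (volume : Measure (E 3)).real B = 8 * L ^ 3 * V := by
    rw [hB, Measure.real, Measure.addHaar_closedBall' volume 0 (by linarith : 0 ≤ 2 * L),
      ENNReal.toReal_mul, ENNReal.toReal_ofReal (by positivity)]
    simp only [finrank_euclideanSpace, Fintype.card_fin]
    rw [hV, Measure.real]
    ring
  have hw : ∫ x in B, wt x ^ 2 ≤ I := setIntegral_le_integral integrable_wt_sq
    (Filter.Eventually.of_forall fun x => sq_nonneg _)
  have hle : 98 / 16384 * ∫ x in closedBall (0 : E 3) 8, acEnergy v x ≤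
      ∫ x in B, 98 * (χ x * wt x ^ 2 * acEnergy v x) := by
    rw [← integral_const_mul]
    have hsub : closedBall (0 : E 3) 8 ⊆ B := closedBall_subset_closedBall (by linarith)
    calc ∫ x in closedBall (0 : E 3) 8, 98 / 16384 * acEnergy v x
        ≤ ∫ x in closedBall (0 : E 3) 8, 98 * (χ x * wt x ^ 2 * acEnergy v x) := by
          refine setIntegral_mono_on ((ii (by fun_prop)).mono_set hsub) ((ii cl).mono_set hsub)
            measurableSet_closedBall fun x hx => ?_
          have hx8 : ‖x‖ ≤ 8 := by simpa using hx
          rw [hχ.eq_one x (by linarith)]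
          have : 1 / 128 ≤ wt x := by
            unfold wt
            rw [inv_eq_one_div]
            exact one_div_le_one_div_of_le (by positivity) (by nlinarith [norm_nonneg x])
          have h2 : (1 / 128 : ℝ) ^ 2 ≤ wt x ^ 2 := pow_le_pow_left₀ (by norm_num) this 2
          have := mul_le_mul_of_nonneg_right h2 (acEnergy_nonneg v x)
          linarith
      _ ≤ _ := by
          refine setIntegral_mono_set (ii cl) (Filter.Eventually.of_forall fun x => ?_)
            hsub.eventuallyLE
          have := hχ.nonneg x
          have := acEnergy_nonneg v x
          simp only [Pi.zero_apply]
          positivity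
  rw [integral_const_mul] at hle
  rw [hVol] at main
  simp only [smul_eq_mul] at main
  set J := ∫ x in B, acRes v x ^ 2
  set M := ∫ x in B, acEnergy v x
  have hJ0 : 0 ≤ J := integral_nonneg fun x => sq_nonneg _
  have hM0 : 0 ≤ M := integral_nonneg fun x => acEnergy_nonneg v x
  have hwκ : 45 * κ * ∫ x in B, wt x ^ 2 ≤ 45 * I * κ := by nlinarith
  have eV : 8 * L ^ 3 * V * (48 * K ^ 2 / L ^ 4) = 384 * K ^ 2 * V * (1 / L) := by
    field_simp
    ring
  have eJ : 22 / κ * J = 22 * (1 / κ * J) := by ring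
  have eM : 33 * K / L ^ 2 * M = 33 * K * (1 / L ^ 2 * M) := by ring
  rw [eV, eJ, eM] at main
  have p1 : 0 ≤ 1 / κ * J := by positivity
  have p2 : 0 ≤ 1 / L ^ 2 * M := by positivity
  have p3 : 0 ≤ 1 / L := by positivity
  have q1 : 0 ≤ 384 * K ^ 2 * V := by positivity
  have hfin : 45 * I * κ + 22 * (1 / κ * J) + 33 * K * (1 / L ^ 2 * M)
      + 384 * K ^ 2 * V * (1 / L) ≤
      (45 * I + 33 * K + 384 * K ^ 2 * V + 22) * (κ + 1 / κ * J + 1 / L ^ 2 * M + 1 / L) := by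
    generalize 1 / κ * J = a at *
    generalize 1 / L ^ 2 * M = c at *
    generalize 1 / L = d at *
    generalize 384 * K ^ 2 * V = q at *
    have hKK : 0 ≤ 33 * K := by linarith
    have hII : 0 ≤ 45 * I := by linarith
    generalize 33 * K = r at *
    generalize 45 * I = w at *
    have : 0 ≤ w * (a + c + d) + r * (κ + a + d) + q * (κ + a + c) + 22 * (κ + c + d) := by
      positivity
    linarith
  have h0 : 0 ≤ ∫ x in closedBall (0 : E 3) 8, acEnergy v x :=
    integral_nonneg fun x => acEnergy_nonneg v x
  linarith

/-! ### Pointwise oscillation bounds -/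

theorem setIntegral_shift_le {F : E 3 → ℝ} (hF : Continuous F) (h0 : ∀ x, 0 ≤ F x) {r s : ℝ}
    {z : E 3} (h : ‖z‖ + r ≤ s) :
    ∫ x in closedBall (0 : E 3) r, F (x + z) ≤ ∫ x in closedBall (0 : E 3) s, F x := by
  have hp : (fun x : E 3 => x + z) ⁻¹' closedBall z r = closedBall 0 r := by
    ext x
    simp [dist_eq_norm]
  rw [← hp, (measurePreserving_add_right volume z).setIntegral_preimage_emb
    (measurableEmbedding_addRight z)]
  refine setIntegral_mono_set (hF.continuousOn.integrableOn_compact (isCompact_closedBall 0 s))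
    (Filter.Eventually.of_forall fun x => h0 x) (LE.le.eventuallyLE ?_)
  exact closedBall_subset_closedBall' (by rw [dist_zero_right]; linarith)

theorem abs_integral_mul_shift_sub_le {ψ v : E 3 → ℝ} {M : ℝ} (hψ : Continuous ψ)
    (hM : ∀ x, |ψ x| ≤ M) (hv : ContDiff ℝ 1 v) {y : E 3} (hy : ‖y‖ ≤ 1) :
    |(∫ x in closedBall (0 : E 3) 2, ψ x * v (x + y)) - ∫ x in closedBall (0 : E 3) 2, ψ x * v x| ≤
      M * ∫ x in closedBall (0 : E 3) 4, ‖fderiv ℝ v x‖ := by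
  have hM0 : 0 ≤ M := (abs_nonneg _).trans (hM 0)
  have cf : Continuous (fderiv ℝ v) := hv.continuous_fderiv (by norm_num)
  have cv : Continuous v := hv.continuous
  have hB : IsCompact (closedBall (0 : E 3) 2) := isCompact_closedBall 0 2
  obtain ⟨C, hC⟩ := (isCompact_closedBall (0 : E 3) 4).exists_bound_of_continuousOn cf.continuousOn
  have hC0 : 0 ≤ C := (norm_nonneg _).trans (hC 0 (by simp))
  have hder : ∀ t ∈ Ioo (-1 : ℝ) 2, HasDerivAt
      (fun t : ℝ => ∫ x in closedBall (0 : E 3) 2, ψ x * v (x + t • y))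
      (∫ x in closedBall (0 : E 3) 2, ψ x * fderiv ℝ v (x + t • y) y) t := by
    intro t ht
    refine (hasDerivAt_integral_of_dominated_loc_of_deriv_le (μ := volume.restrict (closedBall 0 2))
      (F := fun (t : ℝ) (x : E 3) => ψ x * v (x + t • y))
      (F' := fun (t : ℝ) (x : E 3) => ψ x * fderiv ℝ v (x + t • y) y)
      (bound := fun _ => M * C) (Ioo_mem_nhds ht.1 ht.2) ?_ ?_ ?_ ?_ ?_ ?_).2
    · exact Filter.Eventually.of_forall fun s =>
        (by fun_prop : Continuous fun x => ψ x * v (x + s • y)).aestronglyMeasurable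
    · exact (by fun_prop : Continuous fun x => ψ x * v (x + t • y)).continuousOn.integrableOn_compact
        hB
    · exact (by fun_prop : Continuous fun x => ψ x * fderiv ℝ v (x + t • y) y).aestronglyMeasurable
    · refine (ae_restrict_iff' measurableSet_closedBall).2 (Filter.Eventually.of_forall ?_)
      intro x hx s hs
      have hx2 : ‖x‖ ≤ 2 := by simpa using hx
      have hs2 : |s| ≤ 2 := abs_le.2 ⟨by linarith [hs.1], hs.2.le⟩
      have hmem : x + s • y ∈ closedBall (0 : E 3) 4 := by
        rw [mem_closedBall_zero_iff]
        refine (norm_add_le _ _).trans ?_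
        rw [norm_smul, Real.norm_eq_abs]
        nlinarith [abs_nonneg s, norm_nonneg y]
      rw [norm_mul, Real.norm_eq_abs]
      refine mul_le_mul (hM x) ?_ (norm_nonneg _) hM0
      refine ((fderiv ℝ v _).le_opNorm y).trans ?_
      nlinarith [hC _ hmem, norm_nonneg y]
    · exact continuous_const.continuousOn.integrableOn_compact hB
    · refine Filter.Eventually.of_forall fun x s _ => ?_
      have h1 : HasDerivAt (fun s : ℝ => x + s • y) y s := by
        simpa using ((hasDerivAt_id s).smul_const y).const_add x
      have h2 := ((hv.differentiable (by norm_num)) (x + s • y)).hasFDerivAt.comp_hasDerivAt s h1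
      exact h2.const_mul (ψ x)
  have key := norm_image_sub_le_of_norm_deriv_le_segment_01'
    (f := fun t : ℝ => ∫ x in closedBall (0 : E 3) 2, ψ x * v (x + t • y))
    (C := M * ∫ x in closedBall (0 : E 3) 4, ‖fderiv ℝ v x‖)
    (fun t ht => (hder t ⟨by linarith [ht.1], by linarith [ht.2]⟩).hasDerivWithinAt) ?_
  · simpa using key
  · intro t ht
    have hty : ‖t • y‖ ≤ 2 := by
      rw [norm_smul, Real.norm_eq_abs, abs_of_nonneg ht.1]
      nlinarith [ht.1, ht.2, norm_nonneg y]
    calc ‖∫ x in closedBall (0 : E 3) 2, ψ x * fderiv ℝ v (x + t • y) y‖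
        ≤ ∫ x in closedBall (0 : E 3) 2, M * ‖fderiv ℝ v (x + t • y)‖ := by
          refine norm_integral_le_of_norm_le ?_ (Filter.Eventually.of_forall fun x => ?_)
          · exact (by fun_prop : Continuous fun x =>
              M * ‖fderiv ℝ v (x + t • y)‖).continuousOn.integrableOn_compact hB
          · rw [norm_mul, Real.norm_eq_abs]
            refine mul_le_mul (hM x) ?_ (norm_nonneg _) hM0
            refine ((fderiv ℝ v _).le_opNorm y).trans ?_
            nlinarith [norm_nonneg (fderiv ℝ v (x + t • y))]
      _ ≤ _ := by
          rw [integral_const_mul]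
          refine mul_le_mul_of_nonneg_left ?_ hM0
          exact setIntegral_shift_le cf.norm (fun x => norm_nonneg _) (by linarith)

/-- The regularised Newtonian kernel. -/
def newt (τ : ℝ) (x : E 3) : ℝ := (√(‖x‖ ^ 2 + τ ^ 2))⁻¹

section Kernel

variable {τ : ℝ}

theorem newt_pos (hτ : 0 < τ) (x : E 3) : 0 < newt τ x := by
  unfold newt
  positivity

theorem newt_sq (τ : ℝ) (x : E 3) : newt τ x ^ 2 = (‖x‖ ^ 2 + τ ^ 2)⁻¹ := by
  rw [newt, inv_pow, Real.sq_sqrt (by positivity)]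

theorem newt_sq_mul (hτ : 0 < τ) (x : E 3) : newt τ x ^ 2 * (‖x‖ ^ 2 + τ ^ 2) = 1 := by
  rw [newt_sq]
  exact inv_mul_cancel₀ (by positivity)

theorem contDiff_newt (hτ : 0 < τ) : ContDiff ℝ ∞ (newt τ) :=
  (((contDiff_norm_sq ℝ).add contDiff_const).sqrt fun x => by positivity).inv fun x => by positivity

theorem pd_newt (hτ : 0 < τ) (i : Fin 3) (x : E 3) : pd i (newt τ) x = -(x i * newt τ x ^ 3) := by
  have dw := smooth_differentiable (contDiff_newt hτ)
  have dx := fun j => smooth_differentiable (contDiff_coord j)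
  have e : (fun y => (∑ j, (fun z : E 3 => z j ^ 2) y + τ ^ 2) * newt τ y ^ 2) = fun _ => 1 := by
    funext y
    have := newt_sq_mul hτ y
    rw [EuclideanSpace.real_norm_sq_eq] at this
    linarith
  have dsum : Differentiable ℝ fun y : E 3 => ∑ j, (fun z : E 3 => z j ^ 2) y := by fun_prop
  have h := congrFun (congrArg (pd i) e) x
  rw [pd_const, pd_mul i (dsum.add_const _) (dw.fun_pow 2),
    pd_add i dsum (differentiable_const _), pd_sum i fun j => (dx j).fun_pow 2, pd_const] at h
  simp only [pd_sq i (dx _), pd_sq i dw, pd_coord] at h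
  rw [← EuclideanSpace.real_norm_sq_eq] at h
  simp only [mul_ite, mul_one, mul_zero, Finset.sum_ite_eq, Finset.mem_univ, if_true, add_zero] at h
  have hp := newt_pos hτ x
  have h2 := newt_sq_mul hτ x
  have h3 : 2 * newt τ x * ((‖x‖ ^ 2 + τ ^ 2) * pd i (newt τ) x + newt τ x * x i) = 0 := by linarith
  have h4 : (‖x‖ ^ 2 + τ ^ 2) * pd i (newt τ) x + newt τ x * x i = 0 := by
    rcases mul_eq_zero.1 h3 with h | h
    · linarith
    · exact h
  linear_combination newt τ x ^ 2 * h4 - pd i (newt τ) x * h2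

theorem lapl_newt (hτ : 0 < τ) (x : E 3) : lapl (newt τ) x = -(3 * τ ^ 2 * newt τ x ^ 5) := by
  have dw := smooth_differentiable (contDiff_newt hτ)
  have dx := fun j => smooth_differentiable (contDiff_coord j)
  have e : ∀ i, pd i (newt τ) = fun y => (-1) * (y i * (newt τ y * newt τ y ^ 2)) := fun i => by
    funext y
    rw [pd_newt hτ]
    ring
  unfold lapl
  simp only [e]
  have h1 : ∀ i : Fin 3, pd i (fun y => (-1) * (y i * (newt τ y * newt τ y ^ 2))) x =
      -(newt τ x ^ 3) + 3 * x i ^ 2 * newt τ x ^ 5 := fun i => by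
    rw [pd_const_mul i _ ((dx i).fun_mul (dw.fun_mul (dw.fun_pow 2))),
      pd_mul i (dx i) (dw.fun_mul (dw.fun_pow 2)), pd_mul i dw (dw.fun_pow 2)]
    simp only [pd_sq i dw, pd_coord, pd_newt hτ, if_true]
    ring
  simp only [h1]
  have h2 := newt_sq_mul hτ x
  rw [EuclideanSpace.real_norm_sq_eq] at h2
  simp only [Fin.sum_univ_three] at h2 ⊢
  linear_combination 3 * newt τ x ^ 3 * h2

end Kernel

theorem pd_shift (i : Fin 3) (f : E 3 → ℝ) (y : E 3) :
    pd i (fun x => f (x + y)) = fun x => pd i f (x + y) := by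
  funext x
  simp only [pd]
  rw [fderiv_comp_add_right]

theorem lapl_shift (f : E 3 → ℝ) (y : E 3) :
    lapl (fun x => f (x + y)) = fun x => lapl f (x + y) := by
  funext x
  simp only [lapl, pd_shift]

/-- The far-field part of the Laplacian of the truncated kernel. -/
def farField (χ : E 3 → ℝ) (τ : ℝ) (x : E 3) : ℝ :=
  newt τ x * lapl χ x + 2 * ∑ i, pd i χ x * pd i (newt τ) x

theorem newt_le_one {τ : ℝ} {x : E 3} (hτ : 0 < τ) (hx : 1 ≤ ‖x‖) : newt τ x ≤ 1 := by
  have h := newt_sq_mul hτ x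
  have h0 := newt_pos hτ x
  have hF : 1 ≤ ‖x‖ ^ 2 + τ ^ 2 := by nlinarith [sq_nonneg τ]
  have h2 : newt τ x ^ 2 ≤ 1 := by nlinarith [pow_pos h0 2]
  exact (sq_le_one_iff₀ h0.le).1 h2

theorem abs_farField_le {χ : E 3 → ℝ} {K τ : ℝ} (hχ : IsCutoff χ K 1) (hK : 1 ≤ K) (hτ : 0 < τ)
    (x : E 3) : |farField χ τ x| ≤ 3 * K := by
  unfold farField
  rcases lt_or_ge ‖x‖ 1 with hx | hx
  · rw [hχ.lapl_eq_zero hx]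
    simp only [hχ.pd_eq_zero hx, zero_mul, Finset.sum_const_zero, mul_zero, add_zero, abs_zero]
    linarith
  · have h1 := newt_le_one hτ hx
    have h0 := newt_pos hτ x
    have hl := hχ.lapl_le x
    have hg := hχ.sqrt_gradSq_le hK one_pos x
    have hn : √(∑ i, pd i (newt τ) x ^ 2) ≤ 1 := by
      rw [Real.sqrt_le_one]
      have e : ∑ i, pd i (newt τ) x ^ 2 = ‖x‖ ^ 2 * newt τ x ^ 2 * newt τ x ^ 4 := by
        rw [EuclideanSpace.real_norm_sq_eq]
        simp only [pd_newt hτ, Fin.sum_univ_three]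
        ring
      rw [e]
      have h2 : ‖x‖ ^ 2 * newt τ x ^ 2 ≤ 1 := by
        nlinarith [newt_sq_mul hτ x, mul_pos (pow_pos hτ 2) (pow_pos h0 2)]
      exact mul_le_one₀ h2 (by positivity) (pow_le_one₀ h0.le h1)
    have hs := abs_sum_mul_le_sqrt (fun i => pd i χ x) fun i => pd i (newt τ) x
    have hg' : √(∑ i, pd i χ x ^ 2) ≤ K := by simpa [gradSq] using hg
    have hs2 : |∑ i, pd i χ x * pd i (newt τ) x| ≤ K * 1 :=
      hs.trans (mul_le_mul hg' hn (Real.sqrt_nonneg _) (by linarith))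
    calc _ ≤ |newt τ x * lapl χ x| + |2 * ∑ i, pd i χ x * pd i (newt τ) x| := abs_add_le _ _
      _ ≤ 1 * K + 2 * (K * 1) := by
          rw [abs_mul, abs_mul, abs_of_pos h0, abs_two]
          have hl' : |lapl χ x| ≤ K := by simpa using hl
          gcongr
      _ = 3 * K := by ring

theorem contDiff_farField {χ : E 3 → ℝ} {τ : ℝ} (hχ : ContDiff ℝ ∞ χ) (hτ : 0 < τ) :
    ContDiff ℝ ∞ (farField χ τ) :=
  ((contDiff_newt hτ).mul (contDiff_lapl hχ)).add (contDiff_const.mul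
    (ContDiff.sum fun i _ => (contDiff_pd hχ i).mul (contDiff_pd (contDiff_newt hτ) i)))

theorem div_green {f g : E 3 → ℝ} (hf : ContDiff ℝ ∞ f) (hg : ContDiff ℝ ∞ g) (x : E 3) :
    ∑ i, pd i (fun y => f y * pd i g y - g y * pd i f y) x = f x * lapl g x - g x * lapl f x := by
  have df := smooth_differentiable hf
  have dg := smooth_differentiable hg
  have dpf := fun i => smooth_differentiable (contDiff_pd hf i)
  have dpg := fun i => smooth_differentiable (contDiff_pd hg i)
  unfold lapl
  rw [Finset.mul_sum, Finset.mul_sum, ← Finset.sum_sub_distrib]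
  refine Finset.sum_congr rfl fun i _ => ?_
  rw [pd_sub i (df.fun_mul (dpg i)) (dg.fun_mul (dpf i)), pd_mul i df (dpg i), pd_mul i dg (dpf i)]
  ring

/-- Green's representation with the truncated regularised kernel. -/
theorem green_representation {χ w : E 3 → ℝ} {K τ : ℝ} (hχ : IsCutoff χ K 1) (hτ : 0 < τ)
    (hw : ContDiff ℝ ∞ w) :
    ∫ x in closedBall (0 : E 3) 2, 3 * τ ^ 2 * newt τ x ^ 5 * (χ x * w x) =
      (∫ x in closedBall (0 : E 3) 2, farField χ τ x * w x)
        - ∫ x in closedBall (0 : E 3) 2, χ x * newt τ x * lapl w x := by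
  have hn := contDiff_newt hτ
  have hΓ : ContDiff ℝ ∞ fun x => χ x * newt τ x := hχ.smooth.mul hn
  have z : ∀ y : E 3, 2 < ‖y‖ → χ y * newt τ y = 0 := fun y hy => by
    rw [hχ.eq_zero y (by linarith), zero_mul]
  have h := integral_closedBall_div (r := 2)
    (Y := fun i y => χ y * newt τ y * pd i w y - w y * pd i (fun x => χ x * newt τ x) y)
    (fun i => (hΓ.mul (contDiff_pd hw i)).sub (hw.mul (contDiff_pd hΓ i)))
    (fun i y hy => by rw [z y hy, pd_eq_zero_of_lt_norm z i hy]; ring)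
  have ii : ∀ {f : E 3 → ℝ}, ContDiff ℝ ∞ f → IntegrableOn f (closedBall (0 : E 3) 2) := fun hf =>
    hf.continuous.continuousOn.integrableOn_compact (isCompact_closedBall 0 2)
  have e : ∀ x, ∑ i, pd i (fun y => χ y * newt τ y * pd i w y
      - w y * pd i (fun x => χ x * newt τ x) y) x =
      3 * τ ^ 2 * newt τ x ^ 5 * (χ x * w x)
        - (farField χ τ x * w x - χ x * newt τ x * lapl w x) := fun x => by
    rw [div_green hΓ hw, lapl_mul hχ.smooth hn, lapl_newt hτ, farField]
    ring
  simp only [e] at h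
  have s1 : ContDiff ℝ ∞ fun x => 3 * τ ^ 2 * newt τ x ^ 5 * (χ x * w x) :=
    (contDiff_const.mul (hn.pow 5)).mul (hχ.smooth.mul hw)
  have s2 : ContDiff ℝ ∞ fun x => farField χ τ x * w x := (contDiff_farField hχ.smooth hτ).mul hw
  have s3 : ContDiff ℝ ∞ fun x => χ x * newt τ x * lapl w x := hΓ.mul (contDiff_lapl hw)
  rw [integral_sub (ii s1) (ii (s2.sub s3)), integral_sub (ii s2) (ii s3)] at h
  linarith

theorem integrableOn_inv_norm_sq (r : ℝ) :
    IntegrableOn (fun x : E 3 => (‖x‖ ^ 2)⁻¹) (closedBall (0 : E 3) r) := by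
  have h : IntegrableOn (fun x : E 3 => (‖x‖ ^ 2)⁻¹) (ball (0 : E 3) (r + 1)) := by
    rw [integrableOn_fun_norm_addHaar volume (f := fun t : ℝ => (t ^ 2)⁻¹)]
    have : IntegrableOn (fun _ : ℝ => (1 : ℝ)) (Ioo 0 (r + 1)) := by
      rw [integrableOn_const_iff]
      right
      simp
    refine this.congr_fun (fun t ht => ?_) measurableSet_Ioo
    have : t ≠ 0 := ht.1.ne'
    simp only [finrank_euclideanSpace, Fintype.card_fin, smul_eq_mul]
    norm_num
    field_simp
  exact h.mono_set (closedBall_subset_ball (by linarith))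

/-- The unscaled approximate identity produced by the regularised kernel. -/
def poissonProfile (x : E 3) : ℝ := 3 * newt 1 x ^ 5

theorem poissonProfile_pos (x : E 3) : 0 < poissonProfile x :=
  mul_pos (by norm_num) (pow_pos (newt_pos one_pos x) 5)

theorem integrable_poissonProfile : Integrable poissonProfile := by
  have h : Integrable fun x : E 3 => (1 + ‖x‖ ^ 2) ^ (-(4 : ℝ) / 2) :=
    integrable_rpow_neg_one_add_norm_sq (by simp; norm_num)
  refine (h.const_mul 3).mono'
    (contDiff_const.mul ((contDiff_newt one_pos).pow 5)).continuous.aestronglyMeasurable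
    (Filter.Eventually.of_forall fun x => ?_)
  have hs : (0 : ℝ) < 1 + ‖x‖ ^ 2 := by positivity
  have h0 := newt_pos one_pos x
  have e : (1 + ‖x‖ ^ 2) ^ (-(4 : ℝ) / 2) = newt 1 x ^ 4 := by
    have : newt 1 x ^ 4 = (newt 1 x ^ 2) ^ 2 := by ring
    rw [this, newt_sq, show (-(4 : ℝ) / 2) = -((2 : ℕ) : ℝ) by norm_num, Real.rpow_neg hs.le,
      Real.rpow_natCast, inv_pow, one_pow, add_comm]
  have h1 : newt 1 x ≤ 1 := by
    have h2 : newt 1 x ^ 2 ≤ 1 := by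
      nlinarith [newt_sq_mul one_pos x, mul_nonneg (sq_nonneg (newt 1 x)) (sq_nonneg ‖x‖)]
    exact (sq_le_one_iff₀ h0.le).1 h2
  rw [Real.norm_of_nonneg (poissonProfile_pos x).le, e, poissonProfile]
  have : newt 1 x ^ 5 ≤ newt 1 x ^ 4 := pow_le_pow_of_le_one h0.le h1 (by norm_num)
  linarith

theorem integral_poissonProfile_pos : 0 < ∫ x, poissonProfile x := by
  rw [integral_pos_iff_support_of_nonneg (fun x => (poissonProfile_pos x).le)
    integrable_poissonProfile]
  have : Function.support poissonProfile = univ :=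
    Set.eq_univ_of_forall fun x => (poissonProfile_pos x).ne'
  rw [this]
  exact isOpen_univ.measure_pos volume univ_nonempty

theorem tendsto_poissonProfile :
    Tendsto (fun x : E 3 => ‖x‖ ^ 3 * poissonProfile x) (Bornology.cobounded (E 3)) (nhds 0) := by
  have h1 : Tendsto (fun x : E 3 => 3 * ‖x‖⁻¹) (Bornology.cobounded (E 3)) (nhds 0) := by
    simpa using (tendsto_inv_atTop_zero.comp tendsto_norm_cobounded_atTop).const_mul (3 : ℝ)
  have hev : ∀ᶠ x : E 3 in Bornology.cobounded (E 3), 1 ≤ ‖x‖ :=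
    tendsto_norm_cobounded_atTop.eventually_ge_atTop 1
  refine squeeze_zero' (Filter.Eventually.of_forall fun x => mul_nonneg (by positivity)
    (poissonProfile_pos x).le) ?_ h1
  filter_upwards [hev] with x hx
  have h0 := newt_pos one_pos x
  have hle : newt 1 x ≤ ‖x‖⁻¹ := by
    unfold newt
    exact inv_anti₀ (by linarith) (Real.le_sqrt_of_sq_le (by linarith))
  have hxp : 0 < ‖x‖ := by linarith
  have h4 : newt 1 x ^ 5 ≤ ‖x‖⁻¹ ^ 5 := pow_le_pow_left₀ h0.le hle 5
  have h5 : ‖x‖⁻¹ ^ 5 ≤ ‖x‖⁻¹ ^ 4 :=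
    pow_le_pow_of_le_one (by positivity) (inv_le_one_of_one_le₀ hx) (by norm_num)
  calc ‖x‖ ^ 3 * poissonProfile x ≤ ‖x‖ ^ 3 * (3 * ‖x‖⁻¹ ^ 4) := by
        unfold poissonProfile
        gcongr
        exact h4.trans h5
    _ = 3 * ‖x‖⁻¹ := by field_simp

theorem newt_rescale {c : ℝ} (hc : 0 < c) (x : E 3) : newt 1 (c • x) = c⁻¹ * newt c⁻¹ x := by
  unfold newt
  rw [norm_smul, Real.norm_of_nonneg hc.le]
  have : (c * ‖x‖) ^ 2 + 1 ^ 2 = c ^ 2 * (‖x‖ ^ 2 + c⁻¹ ^ 2) := by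
    field_simp
  rw [this, Real.sqrt_mul (by positivity), Real.sqrt_sq hc.le, mul_inv]

theorem tendsto_poisson_integral {χ w : E 3 → ℝ} {K : ℝ} (hχ : IsCutoff χ K 1)
    (hw : ContDiff ℝ ∞ w) :
    Tendsto (fun c : ℝ => ∫ x in closedBall (0 : E 3) 2,
      3 * c⁻¹ ^ 2 * newt c⁻¹ x ^ 5 * (χ x * w x)) atTop
      (nhds ((∫ x, poissonProfile x) * w 0)) := by
  set m := ∫ x, poissonProfile x with hm
  have hm0 : 0 < m := integral_poissonProfile_pos
  have cg : Continuous fun x => χ x * w x := (hχ.smooth.mul hw).continuous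
  have zg : ∀ x, x ∉ closedBall (0 : E 3) 2 → χ x * w x = 0 := fun x hx => by
    have : 2 < ‖x‖ := by simpa using hx
    rw [hχ.eq_zero x (by linarith), zero_mul]
  have hg : Integrable fun x => χ x * w x :=
    cg.integrable_of_hasCompactSupport (HasCompactSupport.intro (isCompact_closedBall 0 2) zg)
  have h := tendsto_integral_comp_smul_smul_of_integrable (μ := (volume : Measure (E 3)))
    (φ := fun x => m⁻¹ * poissonProfile x)
    (fun x => mul_nonneg (by positivity) (poissonProfile_pos x).le)
    (by rw [integral_const_mul]; exact inv_mul_cancel₀ hm0.ne')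
    (by
      simp only [finrank_euclideanSpace, Fintype.card_fin]
      have := tendsto_poissonProfile.const_mul m⁻¹
      rw [mul_zero] at this
      exact this.congr fun x => by ring)
    hg cg.continuousAt
  have h2 := h.const_mul m
  rw [hχ.eq_one 0 (by simp), one_mul] at h2
  refine h2.congr' ?_
  filter_upwards [eventually_gt_atTop 0] with c hc
  rw [setIntegral_eq_integral_of_forall_compl_eq_zero (fun x hx => by rw [zg x hx, mul_zero]),
    ← integral_const_mul]
  refine integral_congr_ae (Filter.Eventually.of_forall fun x => ?_)
  simp only [finrank_euclideanSpace, Fintype.card_fin, smul_eq_mul, poissonProfile,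
    newt_rescale hc]
  field_simp

theorem abs_mul_le_weighted (a b : ℝ) {s : ℝ} (hs : 0 < s) :
    |a * b| ≤ s * a ^ 2 + 1 / s * b ^ 2 := by
  have e : s * a ^ 2 + 1 / s * b ^ 2 - |a| * |b| =
      ((s * |a| - |b|) ^ 2 + (s * |a|) * |b|) / s := by
    rw [← sq_abs a, ← sq_abs b]
    field_simp
    ring
  have : 0 ≤ ((s * |a| - |b|) ^ 2 + (s * |a|) * |b|) / s := by positivity
  rw [abs_mul]
  linarith

theorem abs_integral_newt_mul_le {χ f : E 3 → ℝ} {K τ s : ℝ} (hχ : IsCutoff χ K 1) (hτ : 0 < τ)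
    (hs : 0 < s) (hf : Continuous f) {y : E 3} (hy : ‖y‖ ≤ 1) :
    |∫ x in closedBall (0 : E 3) 2, χ x * newt τ x * f (x + y)| ≤
      s * (∫ x in closedBall (0 : E 3) 2, (‖x‖ ^ 2)⁻¹)
        + 1 / s * ∫ x in closedBall (0 : E 3) 4, f x ^ 2 := by
  have hi : IntegrableOn (fun x => f (x + y) ^ 2) (closedBall (0 : E 3) 2) :=
    (by fun_prop : Continuous fun x => f (x + y) ^ 2).continuousOn.integrableOn_compact
      (isCompact_closedBall 0 2)
  calc |∫ x in closedBall (0 : E 3) 2, χ x * newt τ x * f (x + y)|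
      ≤ ∫ x in closedBall (0 : E 3) 2, (s * (‖x‖ ^ 2)⁻¹ + 1 / s * f (x + y) ^ 2) := by
        have h := norm_integral_le_of_norm_le (μ := volume.restrict (closedBall (0 : E 3) 2))
          (f := fun x => χ x * newt τ x * f (x + y))
          (((integrableOn_inv_norm_sq 2).const_mul s).add (hi.const_mul (1 / s))) ?_
        · exact h
        · have h0 : ∀ᵐ x ∂(volume.restrict (closedBall (0 : E 3) 2)), x ≠ 0 :=
            Measure.ae_ne _ 0
          filter_upwards [h0] with x hx
          refine (abs_mul_le_weighted _ _ hs).trans ?_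
          simp only [Pi.add_apply]
          gcongr
          rw [mul_pow, newt_sq]
          have h1 : χ x ^ 2 ≤ 1 := pow_le_one₀ (hχ.nonneg x) (hχ.le_one x)
          have h2 : (‖x‖ ^ 2 + τ ^ 2)⁻¹ ≤ (‖x‖ ^ 2)⁻¹ :=
            inv_anti₀ (by positivity) (by linarith [sq_nonneg τ])
          have h3 : 0 ≤ (‖x‖ ^ 2 + τ ^ 2)⁻¹ := by positivity
          nlinarith
    _ = s * (∫ x in closedBall (0 : E 3) 2, (‖x‖ ^ 2)⁻¹)
        + 1 / s * ∫ x in closedBall (0 : E 3) 2, f (x + y) ^ 2 := by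
        rw [integral_add ((integrableOn_inv_norm_sq 2).const_mul s) (hi.const_mul (1 / s)),
          integral_const_mul, integral_const_mul]
    _ ≤ _ := by
        gcongr
        exact setIntegral_shift_le (F := fun x => f x ^ 2) (hf.pow 2) (fun x => sq_nonneg _)
          (by linarith)

theorem integral_norm_fderiv_le {v : E 3 → ℝ} (hv : ContDiff ℝ ∞ v) {s : ℝ} (hs : 0 < s) :
    ∫ x in closedBall (0 : E 3) 4, ‖fderiv ℝ v x‖ ≤
      s * (volume : Measure (E 3)).real (closedBall 0 4)
        + 1 / s * ∫ x in closedBall (0 : E 3) 4, gradSq v x := by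
  have hB := isCompact_closedBall (0 : E 3) 4
  have c1 : Continuous fun x => ‖fderiv ℝ v x‖ := (hv.continuous_fderiv (by simp)).norm
  have c2 : Continuous fun x => 1 / s * gradSq v x :=
    continuous_const.mul (contDiff_gradSq hv).continuous
  have ic : IntegrableOn (fun _ : E 3 => s) (closedBall (0 : E 3) 4) :=
    continuous_const.continuousOn.integrableOn_compact hB
  have i2 := c2.continuousOn.integrableOn_compact (μ := volume) hB
  calc ∫ x in closedBall (0 : E 3) 4, ‖fderiv ℝ v x‖
      ≤ ∫ x in closedBall (0 : E 3) 4, (s + 1 / s * gradSq v x) := by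
        refine setIntegral_mono (c1.continuousOn.integrableOn_compact hB)
          (ic.add i2) fun x => ?_
        have h := abs_mul_le_weighted 1 ‖fderiv ℝ v x‖ hs
        rw [norm_fderiv_sq, one_mul, abs_of_nonneg (norm_nonneg _)] at h
        simpa [gradSq] using h
    _ = _ := by
        rw [integral_add ic i2, integral_const_mul, setIntegral_const, smul_eq_mul, mul_comm s]

/-- Control of the oscillation by the gradient and the Laplacian in `L²`. -/
theorem exists_oscillation_le : ∃ C, 0 < C ∧ ∀ (v : E 3 → ℝ) (s : ℝ) (y : E 3), ContDiff ℝ ∞ v →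
    0 < s → ‖y‖ ≤ 1 → |v y - v 0| ≤
      C * (s + 1 / s * ((∫ x in closedBall (0 : E 3) 4, gradSq v x)
        + ∫ x in closedBall (0 : E 3) 4, lapl v x ^ 2)) := by
  obtain ⟨K, hK, hcut⟩ := exists_isCutoff
  obtain ⟨χ, hχ⟩ := hcut 1 one_pos
  set m := ∫ x, poissonProfile x with hm
  have hm0 : 0 < m := integral_poissonProfile_pos
  set N := ∫ x in closedBall (0 : E 3) 2, (‖x‖ ^ 2)⁻¹ with hN
  have hN0 : 0 ≤ N := integral_nonneg fun x => by positivity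
  set V := (volume : Measure (E 3)).real (closedBall 0 4) with hV
  have hV0 : 0 ≤ V := measureReal_nonneg
  refine ⟨(3 * K * V + 2 * N + 3 * K + 2) / m, by positivity, fun v s y hv hs hy => ?_⟩
  set G := ∫ x in closedBall (0 : E 3) 4, gradSq v x with hG
  set D := ∫ x in closedBall (0 : E 3) 4, lapl v x ^ 2 with hD
  have hG0 : 0 ≤ G := integral_nonneg fun x => gradSq_nonneg v x
  have hD0 : 0 ≤ D := integral_nonneg fun x => sq_nonneg _
  have hvy : ContDiff ℝ ∞ fun x => v (x + y) := hv.comp (contDiff_id.add contDiff_const)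
  have lim := ((tendsto_poisson_integral hχ hvy).sub (tendsto_poisson_integral hχ hv)).abs
  rw [zero_add, ← mul_sub, abs_mul, abs_of_pos hm0] at lim
  have bound : m * |v y - v 0| ≤
      3 * K * (s * V + 1 / s * G) + 2 * (s * N + 1 / s * D) := by
    refine le_of_tendsto lim ?_
    filter_upwards [eventually_gt_atTop 0] with c hc
    have hτ : 0 < c⁻¹ := inv_pos.2 hc
    rw [green_representation hχ hτ hvy, green_representation hχ hτ hv]
    have b1 := abs_integral_mul_shift_sub_le (contDiff_farField hχ.smooth hτ).continuous
      (abs_farField_le hχ hK hτ) (hv.of_le (by simp)) hy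
    have b2 := integral_norm_fderiv_le hv hs
    have b3 := abs_integral_newt_mul_le hχ hτ hs (contDiff_lapl hv).continuous hy
    have b4 := abs_integral_newt_mul_le hχ hτ hs (contDiff_lapl hv).continuous
      (y := 0) (by simp)
    simp only [add_zero] at b4
    rw [lapl_shift]
    have b5 := b1.trans (mul_le_mul_of_nonneg_left b2 (by linarith : 0 ≤ 3 * K))
    rw [abs_le] at b3 b4 b5 ⊢
    constructor <;> linarith [b3.1, b3.2, b4.1, b4.2, b5.1, b5.2]
  rw [div_mul_eq_mul_div, le_div_iff₀ hm0, mul_comm _ m]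
  refine bound.trans ?_
  have hs1 : 0 ≤ 1 / s := by positivity
  generalize 1 / s = t at *
  have : 0 ≤ s * (3 * K + 2) + (t * G) * (3 * K * V + 2 * N + 2)
      + (t * D) * (3 * K * V + 2 * N + 3 * K) := by positivity
  linarith

theorem div_potential_field {η v : E 3 → ℝ} (hη : ContDiff ℝ ∞ η) (hv : ContDiff ℝ ∞ v) (x : E 3) :
    ∑ i, pd i (fun y => η y ^ 2 * (W' (v y) * pd i v y)) x =
      η x ^ 2 * ((3 * v x ^ 2 - 1) * gradSq v x + W' (v x) ^ 2 + W' (v x) * acRes v x)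
        + 2 * η x * W' (v x) * ∑ i, pd i η x * pd i v x := by
  have dη := smooth_differentiable hη
  have dv := smooth_differentiable hv
  have dW : Differentiable ℝ fun y => W' (v y) := fun y =>
    ((hasDerivAt_W' (v y)).comp_hasFDerivAt y (dv y).hasFDerivAt).differentiableAt
  have dp := fun i => smooth_differentiable (contDiff_pd hv i)
  have e : ∀ i, pd i (fun y => η y ^ 2 * (W' (v y) * pd i v y)) x =
      η x ^ 2 * (W' (v x) * pd i (pd i v) x + pd i v x * ((3 * v x ^ 2 - 1) * pd i v x))
        + W' (v x) * pd i v x * (2 * η x * pd i η x) := fun i => by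
    rw [pd_mul i (dη.fun_pow 2) (dW.fun_mul (dp i)), pd_mul i dW (dp i)]
    simp only [pd_sq i dη, pd_comp i hasDerivAt_W' dv]
  simp only [e, acRes, gradSq, lapl, Fin.sum_univ_three]
  ring

theorem potential_pointwise {χ v : E 3 → ℝ} {K L : ℝ} (hχ : IsCutoff χ K L) (hv : ContDiff ℝ ∞ v)
    (x : E 3) : χ x ^ 2 * W' (v x) ^ 2 / 2 ≤
      ∑ i, pd i (fun y => χ y ^ 2 * (W' (v y) * pd i v y)) x
        + (1 + 4 * (K / L) ^ 2) * gradSq v x + acRes v x ^ 2 := by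
  rw [div_potential_field hχ.smooth hv]
  have hcs : (∑ i, pd i χ x * pd i v x) ^ 2 ≤ (K / L) ^ 2 * gradSq v x :=
    (Finset.sum_mul_sq_le_sq_mul_sq _ _ _).trans
      (mul_le_mul_of_nonneg_right (hχ.grad_le x) (gradSq_nonneg v x))
  have h1 : χ x ^ 2 ≤ 1 := pow_le_one₀ (hχ.nonneg x) (hχ.le_one x)
  have h0 : 0 ≤ χ x ^ 2 := sq_nonneg _
  have hg := gradSq_nonneg v x
  generalize ∑ i, pd i χ x * pd i v x = P at *
  generalize gradSq v x = G at *
  generalize acRes v x = g at *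
  generalize W' (v x) = w at *
  have a1 : χ x ^ 2 * G ≤ G := mul_le_of_le_one_left hg h1
  have a2 : χ x ^ 2 * g ^ 2 ≤ g ^ 2 := mul_le_of_le_one_left (sq_nonneg _) h1
  have a3 : 0 ≤ χ x ^ 2 * (3 * v x ^ 2) * G := by positivity
  have a4 : 0 ≤ χ x ^ 2 * (w / 2 + g) ^ 2 := by positivity
  have a5 := sq_nonneg (χ x * w / 2 + 2 * P)
  nlinarith

/-- An `L²` bound for the Laplacian in terms of the gradient and the residual. -/
theorem exists_integral_lapl_sq_le : ∃ C, 0 < C ∧ ∀ v : E 3 → ℝ, ContDiff ℝ ∞ v →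
    ∫ x in closedBall (0 : E 3) 4, lapl v x ^ 2 ≤
      C * ((∫ x in closedBall (0 : E 3) 8, gradSq v x)
        + ∫ x in closedBall (0 : E 3) 8, acRes v x ^ 2) := by
  obtain ⟨K, hK, hcut⟩ := exists_isCutoff
  obtain ⟨χ, hχ⟩ := hcut 4 (by norm_num)
  refine ⟨4 * (1 + 4 * (K / 4) ^ 2) + 6, by positivity, fun v hv => ?_⟩
  set B := closedBall (0 : E 3) 8 with hB
  have hBc : IsCompact B := isCompact_closedBall 0 8
  have hsub : closedBall (0 : E 3) 4 ⊆ B := closedBall_subset_closedBall (by norm_num)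
  have ii : ∀ {f : E 3 → ℝ}, Continuous f → IntegrableOn f B := fun hf =>
    hf.continuousOn.integrableOn_compact hBc
  have sW : ContDiff ℝ ∞ fun x => W' (v x) := (hv.pow 3).sub hv
  have sY : ∀ i, ContDiff ℝ ∞ fun y => χ y ^ 2 * (W' (v y) * pd i v y) := fun i =>
    (hχ.smooth.pow 2).mul (sW.mul (contDiff_pd hv i))
  have hdiv := integral_closedBall_div (r := 8) sY fun i y hy => by
    rw [hχ.eq_zero y (by linarith)]
    ring
  have cd : Continuous fun x => ∑ i, pd i (fun y => χ y ^ 2 * (W' (v y) * pd i v y)) x :=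
    continuous_finsetSum _ fun i _ => (contDiff_pd (sY i) i).continuous
  have cG : Continuous (gradSq v) := (contDiff_gradSq hv).continuous
  have cg : Continuous fun x => acRes v x ^ 2 := ((contDiff_acRes hv).pow 2).continuous
  have cW : Continuous fun x => χ x ^ 2 * W' (v x) ^ 2 / 2 :=
    (((hχ.smooth.pow 2).mul (sW.pow 2)).div_const 2).continuous
  have cl : Continuous fun x => lapl v x ^ 2 := ((contDiff_lapl hv).pow 2).continuous
  have main : ∫ x in B, χ x ^ 2 * W' (v x) ^ 2 / 2 ≤ ∫ x in B,
      (∑ i, pd i (fun y => χ y ^ 2 * (W' (v y) * pd i v y)) x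
        + (1 + 4 * (K / 4) ^ 2) * gradSq v x + acRes v x ^ 2) :=
    setIntegral_mono (ii cW) (ii (by fun_prop)) fun x => potential_pointwise hχ hv x
  rw [integral_add (ii (by fun_prop)) (ii (by fun_prop)),
    integral_add (ii (by fun_prop)) (ii (by fun_prop)), integral_const_mul, hdiv] at main
  have hlap : ∫ x in closedBall (0 : E 3) 4, lapl v x ^ 2 ≤
      ∫ x in B, (4 * (χ x ^ 2 * W' (v x) ^ 2 / 2) + 2 * acRes v x ^ 2) := by
    calc ∫ x in closedBall (0 : E 3) 4, lapl v x ^ 2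
        ≤ ∫ x in closedBall (0 : E 3) 4, (4 * (χ x ^ 2 * W' (v x) ^ 2 / 2) + 2 * acRes v x ^ 2) := by
          refine setIntegral_mono_on ((ii cl).mono_set hsub)
            ((ii (by fun_prop)).mono_set hsub) measurableSet_closedBall fun x hx => ?_
          rw [hχ.eq_one x (by simpa using hx)]
          have : lapl v x = acRes v x + W' (v x) := by unfold acRes; ring
          rw [this]
          nlinarith [sq_nonneg (acRes v x - W' (v x))]
      _ ≤ _ := setIntegral_mono_set (ii (by fun_prop))
          (Filter.Eventually.of_forall fun x => by simp only [Pi.zero_apply]; positivity)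
          hsub.eventuallyLE
  rw [integral_add (ii (by fun_prop)) (ii (by fun_prop)), integral_const_mul,
    integral_const_mul] at hlap
  set G := ∫ x in B, gradSq v x
  set R := ∫ x in B, acRes v x ^ 2
  have hG0 : 0 ≤ G := integral_nonneg fun x => gradSq_nonneg v x
  have hR0 : 0 ≤ R := integral_nonneg fun x => sq_nonneg _
  nlinarith [mul_nonneg (sq_nonneg (K / 4)) hR0]

theorem sq_abs_sub_one_le (t : ℝ) : (|t| - 1) ^ 2 ≤ 4 * W t := by
  unfold W
  rw [← sq_abs t]
  nlinarith [abs_nonneg t, mul_nonneg (abs_nonneg t) (sq_nonneg (|t| - 1)),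
    mul_nonneg (mul_nonneg (abs_nonneg t) (abs_nonneg t)) (sq_nonneg (|t| - 1))]

theorem abs_abs_sub_one_le_of_small {κ : ℝ} (hκ : 0 < κ) : ∃ δ, 0 < δ ∧ ∀ v : E 3 → ℝ,
    ContDiff ℝ ∞ v → ∫ x in closedBall (0 : E 3) 8, acEnergy v x ≤ δ →
    ∫ x in closedBall (0 : E 3) 8, acRes v x ^ 2 ≤ δ → |(|v 0| - 1)| ≤ κ := by
  obtain ⟨C, hC, hosc⟩ := exists_oscillation_le
  obtain ⟨C', hC', hlap⟩ := exists_integral_lapl_sq_le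
  set V := (volume : Measure (E 3)).real (closedBall 0 1) with hV
  have hV0 : 0 < V :=
    ENNReal.toReal_pos (measure_closedBall_pos volume 0 one_pos).ne' measure_closedBall_lt_top.ne
  set s := κ / (4 * C) with hs
  have hs0 : 0 < s := by positivity
  refine ⟨min (s ^ 2 / (2 + 3 * C')) (κ ^ 2 * V / 16), by positivity, fun v hv he hg => ?_⟩
  set B := closedBall (0 : E 3) 8 with hB
  have ii : ∀ {f : E 3 → ℝ}, Continuous f → IntegrableOn f B := fun hf =>
    hf.continuousOn.integrableOn_compact (isCompact_closedBall 0 8)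
  have ce : Continuous (acEnergy v) := (contDiff_acEnergy hv).continuous
  have cG : Continuous (gradSq v) := (contDiff_gradSq hv).continuous
  have cW : Continuous fun x => W (v x) := (contDiff_W.comp hv).continuous
  have sub4 : closedBall (0 : E 3) 4 ⊆ B := closedBall_subset_closedBall (by norm_num)
  have sub1 : closedBall (0 : E 3) 1 ⊆ B := closedBall_subset_closedBall (by norm_num)
  set δ := min (s ^ 2 / (2 + 3 * C')) (κ ^ 2 * V / 16) with hδ
  have hG : ∫ x in B, gradSq v x ≤ 2 * δ := by
    refine le_trans ?_ (mul_le_mul_of_nonneg_left he zero_le_two)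
    rw [← integral_const_mul]
    refine setIntegral_mono (ii cG) (ii (by fun_prop)) fun x => ?_
    have := W_nonneg (v x)
    simp only [acEnergy]
    linarith
  have hG4 : ∫ x in closedBall (0 : E 3) 4, gradSq v x ≤ 2 * δ :=
    (setIntegral_mono_set (ii cG) (Filter.Eventually.of_forall fun x => gradSq_nonneg v x)
      sub4.eventuallyLE).trans hG
  have hW1 : ∫ x in closedBall (0 : E 3) 1, W (v x) ≤ δ := by
    refine le_trans ?_ he
    refine (setIntegral_mono_set (ii cW) (Filter.Eventually.of_forall fun x => W_nonneg (v x))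
      sub1.eventuallyLE).trans (setIntegral_mono (ii cW) (ii ce) fun x => ?_)
    have := gradSq_nonneg v x
    simp only [acEnergy]
    linarith
  have hL := hlap v hv
  have hD : (∫ x in closedBall (0 : E 3) 4, gradSq v x)
      + ∫ x in closedBall (0 : E 3) 4, lapl v x ^ 2 ≤ s ^ 2 := by
    have h1 : C' * ((∫ x in B, gradSq v x) + ∫ x in B, acRes v x ^ 2) ≤ C' * (3 * δ) :=
      mul_le_mul_of_nonneg_left (by linarith) hC'.le
    have h2 : δ * (2 + 3 * C') ≤ s ^ 2 := by
      rw [← le_div_iff₀ (by positivity)]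
      exact min_le_left _ _
    linarith
  obtain ⟨y, hy, hWy⟩ := exists_le_setAverage (μ := (volume : Measure (E 3)))
    (s := closedBall (0 : E 3) 1) (f := fun x => W (v x))
    (measure_closedBall_pos volume 0 one_pos).ne' measure_closedBall_lt_top.ne
    ((ii cW).mono_set sub1)
  rw [setAverage_eq, smul_eq_mul, ← hV] at hWy
  have hWy2 : W (v y) ≤ κ ^ 2 / 16 := by
    refine hWy.trans ?_
    rw [inv_mul_le_iff₀ hV0]
    have : δ ≤ κ ^ 2 * V / 16 := min_le_right _ _
    linarith
  have hvy : |(|v y| - 1)| ≤ κ / 2 := by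
    refine abs_le_of_sq_le_sq ?_ (by linarith)
    linarith [sq_abs_sub_one_le (v y)]
  have ho := hosc v s y hv hs0 (by simpa using hy)
  have ho2 : |v y - v 0| ≤ κ / 2 := by
    refine ho.trans ?_
    have h1 : 1 / s * ((∫ x in closedBall (0 : E 3) 4, gradSq v x)
      + ∫ x in closedBall (0 : E 3) 4, lapl v x ^ 2) ≤ s := by
      rw [one_div, inv_mul_le_iff₀ hs0, ← sq]
      exact hD
    have h2 : C * (s + s) = κ / 2 := by
      rw [hs]
      field_simp
      ring
    rw [← h2]
    gcongr
  have h3 := abs_abs_sub_abs_le_abs_sub (v y) (v 0)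
  rw [abs_le] at hvy h3 ⊢
  constructor <;> linarith [hvy.1, hvy.2, h3.1, h3.2]

/-- The clearing-out lemma for smooth functions, at unit scale. -/
theorem clearing_out_smooth {κ : ℝ} (hκ : 0 < κ) : ∃ η L₀, 0 < η ∧ 0 < L₀ ∧
    ∀ (v : E 3 → ℝ) (L : ℝ), ContDiff ℝ ∞ v → L₀ ≤ L →
    ∫ x in closedBall (0 : E 3) (2 * L), acEnergy v x ≤ η * L ^ 2 →
    ∫ x in closedBall (0 : E 3) (2 * L), acRes v x ^ 2 ≤ η → |(|v 0| - 1)| ≤ κ := by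
  obtain ⟨δ, hδ, hloc⟩ := abs_abs_sub_one_le_of_small hκ
  obtain ⟨C, hC, hen⟩ := energy_ball_le
  set a := min 1 (δ / (4 * C)) with ha
  have ha0 : 0 < a := by positivity
  have haC : C * a ≤ δ / 4 := by
    have := mul_le_mul_of_nonneg_left (min_le_right 1 (δ / (4 * C))) hC.le
    rw [show C * (δ / (4 * C)) = δ / 4 by field_simp] at this
    exact this
  have ha1 : a ≤ 1 := min_le_left _ _
  refine ⟨min (a ^ 2) δ, max 8 (1 / a), by positivity, by positivity, fun v L hv hL he hg => ?_⟩
  have hL8 : 8 ≤ L := (le_max_left _ _).trans hL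
  have hLa : 1 / a ≤ L := (le_max_right _ _).trans hL
  have hL0 : 0 < L := by linarith
  refine hloc v hv ((hen v a L hv ha0 ha1 hL8).trans ?_) ?_
  · have h1 : 1 / a * (∫ x in closedBall (0 : E 3) (2 * L), acRes v x ^ 2) ≤ a := by
      rw [one_div, inv_mul_le_iff₀ ha0, ← sq]
      exact hg.trans (min_le_left _ _)
    have h2 : 1 / L ^ 2 * (∫ x in closedBall (0 : E 3) (2 * L), acEnergy v x) ≤ a := by
      rw [one_div, inv_mul_le_iff₀ (by positivity), mul_comm (L ^ 2)]
      refine he.trans (mul_le_mul_of_nonneg_right ?_ (by positivity))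
      exact (min_le_left _ _).trans (by nlinarith)
    have h3 : 1 / L ≤ a := by
      rw [div_le_iff₀ hL0]
      rwa [div_le_iff₀ ha0, mul_comm] at hLa
    calc _ ≤ C * (a + a + a + a) := by gcongr
      _ ≤ δ := by linarith
  · refine le_trans ?_ (hg.trans (min_le_right _ _))
    exact setIntegral_mono_set
      (((contDiff_acRes hv).pow 2).continuous.continuousOn.integrableOn_compact
      (isCompact_closedBall 0 _)) (Filter.Eventually.of_forall fun x => sq_nonneg _)
      (closedBall_subset_closedBall (by linarith)).eventuallyLE

/-! ### Mollification -/

/-- The bump functions used for mollification. -/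
def mollBump (n : ℕ) : ContDiffBump (0 : E 3) :=
  ⟨1 / (2 * ((n : ℝ) + 1)), 1 / ((n : ℝ) + 1), by positivity,
    one_div_lt_one_div_of_lt (by positivity) (by linarith [Nat.cast_nonneg (α := ℝ) n])⟩

/-- Mollification of a function. -/
def moll (n : ℕ) (f : E 3 → ℝ) : E 3 → ℝ :=
  convolution ((mollBump n).normed volume) f (ContinuousLinearMap.lsmul ℝ ℝ) volume

theorem tendsto_moll {f : E 3 → ℝ} (hf : Continuous f) (x : E 3) :
    Tendsto (fun n => moll n f x) atTop (nhds (f x)) :=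
  ContDiffBump.convolution_tendsto_right_of_continuous
    (tendsto_one_div_add_atTop_nhds_zero_nat (𝕜 := ℝ)) hf x

theorem abs_moll_le {f : E 3 → ℝ} (hf : Continuous f) {C : ℝ} (hC : ∀ x, |f x| ≤ C) (n : ℕ)
    (x : E 3) : |moll n f x| ≤ 3 * C := by
  have h := ContDiffBump.dist_normed_convolution_le (φ := mollBump n) (μ := (volume : Measure (E 3)))
    (x₀ := x) (ε := 2 * C) hf.aestronglyMeasurable fun y _ => by
      rw [Real.dist_eq]
      exact (abs_sub _ _).trans (by linarith [hC x, hC y])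
  rw [Real.dist_eq] at h
  have h2 : |moll n f x - f x| ≤ 2 * C := h
  have := hC x
  rw [abs_le] at *
  constructor <;> linarith

theorem contDiff_moll {f : E 3 → ℝ} (hf : Continuous f) (n : ℕ) : ContDiff ℝ ∞ (moll n f) :=
  (mollBump n).hasCompactSupport_normed.contDiff_convolution_left _ (n := ⊤)
    (mollBump n).contDiff_normed hf.locallyIntegrable

theorem pd_moll {f : E 3 → ℝ} (hf : ContDiff ℝ 1 f) (hc : HasCompactSupport f) (n : ℕ) (i : Fin 3) :
    pd i (moll n f) = moll n (pd i f) := by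
  funext x
  have hl : LocallyIntegrable ((mollBump n).normed volume) (volume : Measure (E 3)) :=
    ((mollBump n).contDiff_normed (n := 0)).continuous.locallyIntegrable
  have h := hc.hasFDerivAt_convolution_right (ContinuousLinearMap.lsmul ℝ ℝ) hl hf x
  rw [pd, moll, h.fderiv]
  exact convolution_precompR_apply _ hl (hc.fderiv ℝ) (hf.continuous_fderiv (by norm_num)) x _

theorem contDiff_pd_of {f : E 3 → ℝ} (hf : ContDiff ℝ 2 f) (i : Fin 3) : ContDiff ℝ 1 (pd i f) :=
  (hf.fderiv_right (m := 1) (by norm_num)).clm_apply contDiff_const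

theorem continuous_pd_of {f : E 3 → ℝ} (hf : ContDiff ℝ 1 f) (i : Fin 3) : Continuous (pd i f) :=
  (hf.continuous_fderiv (by norm_num)).clm_apply continuous_const

theorem lapl_moll {f : E 3 → ℝ} (hf : ContDiff ℝ 2 f) (hc : HasCompactSupport f) (n : ℕ) (x : E 3) :
    lapl (moll n f) x = ∑ i, moll n (pd i (pd i f)) x := by
  refine Finset.sum_congr rfl fun i _ => ?_
  rw [pd_moll (hf.of_le (by norm_num)) hc, pd_moll (contDiff_pd_of hf i) (hc.fderiv_apply ℝ _)]

theorem exists_smooth_approx {v : E 3 → ℝ} (hv : ContDiff ℝ 2 v) (hc : HasCompactSupport v) :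
    ∃ w : ℕ → E 3 → ℝ, (∀ n, ContDiff ℝ ∞ (w n)) ∧ Tendsto (fun n => w n 0) atTop (nhds (v 0)) ∧
      ∀ F : E 3 × ℝ × (Fin 3 → ℝ) × ℝ → ℝ, Continuous F → ∀ r, Tendsto
        (fun n => ∫ x in closedBall (0 : E 3) r, F (x, w n x, fun i => pd i (w n) x, lapl (w n) x))
        atTop (nhds (∫ x in closedBall (0 : E 3) r, F (x, v x, fun i => pd i v x, lapl v x))) := by
  have hv1 : ContDiff ℝ 1 v := hv.of_le (by norm_num)
  have c1 : ∀ i, Continuous (pd i v) := fun i => continuous_pd_of hv1 i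
  have c2 : ∀ i, Continuous (pd i (pd i v)) := fun i => continuous_pd_of (contDiff_pd_of hv i) i
  have k1 : ∀ i, HasCompactSupport (pd i v) := fun i => hc.fderiv_apply ℝ _
  have k2 : ∀ i, HasCompactSupport (pd i (pd i v)) := fun i => (k1 i).fderiv_apply ℝ _
  obtain ⟨C0, h0⟩ := exists_bound_of_hasCompactSupport hv.continuous hc
  choose C1 h1 using fun i => exists_bound_of_hasCompactSupport (c1 i) (k1 i)
  choose C2 h2 using fun i => exists_bound_of_hasCompactSupport (c2 i) (k2 i)
  have sm : ∀ n, ContDiff ℝ ∞ (moll n v) := fun n => contDiff_moll hv.continuous n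
  refine ⟨fun n => moll n v, sm, tendsto_moll hv.continuous 0, fun F hF r => ?_⟩
  set S : Set (E 3 × ℝ × (Fin 3 → ℝ) × ℝ) := closedBall 0 r ×ˢ Icc (-(3 * C0)) (3 * C0) ×ˢ
    (univ.pi fun i => Icc (-(3 * C1 i)) (3 * C1 i)) ×ˢ Icc (-∑ i, 3 * C2 i) (∑ i, 3 * C2 i) with hS
  have hSc : IsCompact S := (isCompact_closedBall 0 r).prod (isCompact_Icc.prod
    ((isCompact_univ_pi fun i => isCompact_Icc).prod isCompact_Icc))
  obtain ⟨C, hC⟩ := hSc.exists_bound_of_continuousOn hF.continuousOn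
  have lapc : Continuous (lapl v) := continuous_finsetSum _ fun i _ => c2 i
  refine tendsto_integral_of_dominated_convergence (fun _ => C) (fun n => ?_) ?_ (fun n => ?_) ?_
  · have := (sm n).continuous
    have := (contDiff_lapl (sm n)).continuous
    have := fun i => (contDiff_pd (sm n) i).continuous
    exact (hF.comp (by fun_prop)).aestronglyMeasurable
  · exact continuous_const.continuousOn.integrableOn_compact (isCompact_closedBall 0 r)
  · refine (ae_restrict_iff' measurableSet_closedBall).2 (Filter.Eventually.of_forall fun x hx => ?_)
    refine hC _ ⟨hx, abs_le.1 (abs_moll_le hv.continuous h0 n x), fun i _ => ?_, abs_le.1 ?_⟩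
    · simp only
      rw [pd_moll hv1 hc]
      exact abs_le.1 (abs_moll_le (c1 i) (h1 i) n x)
    · simp only
      rw [lapl_moll hv hc]
      exact (Finset.abs_sum_le_sum_abs _ _).trans
        (Finset.sum_le_sum fun i _ => abs_moll_le (c2 i) (h2 i) n x)
  · refine Filter.Eventually.of_forall fun x => (hF.tendsto _).comp ?_
    refine tendsto_const_nhds.prodMk_nhds ((tendsto_moll hv.continuous x).prodMk_nhds
      (Tendsto.prodMk_nhds (tendsto_pi_nhds.2 fun i => ?_) ?_))
    · simp only [pd_moll hv1 hc]
      exact tendsto_moll (c1 i) x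
    · simp only [lapl_moll hv hc]
      exact tendsto_finsetSum _ fun i _ => tendsto_moll (c2 i) x

/-- The clearing-out lemma at unit scale. -/
theorem clearing_out {κ : ℝ} (hκ : 0 < κ) : ∃ η L₀, 0 < η ∧ 0 < L₀ ∧
    ∀ (v : E 3 → ℝ) (L : ℝ), ContDiff ℝ 2 v → HasCompactSupport v → L₀ ≤ L →
    ∫ x in closedBall (0 : E 3) (2 * L), acEnergy v x ≤ η * L ^ 2 →
    ∫ x in closedBall (0 : E 3) (2 * L), acRes v x ^ 2 ≤ η → |(|v 0| - 1)| ≤ κ := by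
  obtain ⟨η, L₀, hη, hL₀, h⟩ := clearing_out_smooth hκ
  refine ⟨η / 2, L₀, by linarith, hL₀, fun v L hv hc hL he hg => ?_⟩
  have hLp : 0 < L := by linarith
  obtain ⟨w, sw, w0, hw⟩ := exists_smooth_approx hv hc
  have te := hw (fun p => (∑ i, p.2.2.1 i ^ 2) / 2 + W p.2.1)
    (by have := contDiff_W.continuous; fun_prop) (2 * L)
  have tg := hw (fun p => (p.2.2.2 - W' p.2.1) ^ 2) (by unfold W'; fun_prop) (2 * L)
  refine le_of_tendsto ((w0.abs.sub_const 1).abs) ?_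
  have he' : ∫ x in closedBall (0 : E 3) (2 * L), acEnergy v x < η * L ^ 2 := by
    have : 0 < η * L ^ 2 := by positivity
    linarith
  have hg' : ∫ x in closedBall (0 : E 3) (2 * L), acRes v x ^ 2 < η := by linarith
  filter_upwards [te.eventually_lt_const he', tg.eventually_lt_const hg'] with n h1 h2
  exact h (w n) L (sw n) hL h1.le h2.le

theorem coercive_pointwise {χ v : E 3 → ℝ} {K L : ℝ} (hχ : IsCutoff χ K L) (hv : ContDiff ℝ ∞ v)
    (x : E 3) : χ x ^ 2 * ((3 * v x ^ 2 - 1) * gradSq v x + W' (v x) ^ 2 / 2) ≤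
      ∑ i, pd i (fun y => χ y ^ 2 * (W' (v y) * pd i v y)) x
        + 4 * (K / L) ^ 2 * gradSq v x + acRes v x ^ 2 := by
  rw [div_potential_field hχ.smooth hv]
  have hcs : (∑ i, pd i χ x * pd i v x) ^ 2 ≤ (K / L) ^ 2 * gradSq v x :=
    (Finset.sum_mul_sq_le_sq_mul_sq _ _ _).trans
      (mul_le_mul_of_nonneg_right (hχ.grad_le x) (gradSq_nonneg v x))
  have h1 : χ x ^ 2 ≤ 1 := pow_le_one₀ (hχ.nonneg x) (hχ.le_one x)
  generalize ∑ i, pd i χ x * pd i v x = P at *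
  generalize gradSq v x = G at *
  generalize acRes v x = g at *
  generalize W' (v x) = w at *
  have a2 : χ x ^ 2 * g ^ 2 ≤ g ^ 2 := mul_le_of_le_one_left (sq_nonneg _) h1
  have a4 : 0 ≤ χ x ^ 2 * (w / 2 + g) ^ 2 := by positivity
  have a5 := sq_nonneg (χ x * w / 2 + 2 * P)
  nlinarith

theorem coercive_integral_smooth {χ v : E 3 → ℝ} {K L : ℝ} (hχ : IsCutoff χ K L)
    (hv : ContDiff ℝ ∞ v) :
    ∫ x in closedBall (0 : E 3) (2 * L),
        χ x ^ 2 * ((3 * v x ^ 2 - 1) * gradSq v x + W' (v x) ^ 2 / 2) ≤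
      ∫ x in closedBall (0 : E 3) (2 * L), (4 * (K / L) ^ 2 * gradSq v x + acRes v x ^ 2) := by
  have ii : ∀ {f : E 3 → ℝ}, ContDiff ℝ ∞ f → IntegrableOn f (closedBall (0 : E 3) (2 * L)) :=
    fun hf => hf.continuous.continuousOn.integrableOn_compact (isCompact_closedBall 0 _)
  have sW : ContDiff ℝ ∞ fun x => W' (v x) := (hv.pow 3).sub hv
  have sG := contDiff_gradSq hv
  have sY : ∀ i, ContDiff ℝ ∞ fun y => χ y ^ 2 * (W' (v y) * pd i v y) := fun i =>
    (hχ.smooth.pow 2).mul (sW.mul (contDiff_pd hv i))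
  have hdiv := integral_closedBall_div (r := 2 * L) sY fun i y hy => by
    rw [hχ.eq_zero y (by linarith)]
    ring
  have sd : ContDiff ℝ ∞ fun x => ∑ i, pd i (fun y => χ y ^ 2 * (W' (v y) * pd i v y)) x :=
    ContDiff.sum fun i _ => contDiff_pd (sY i) i
  have s1 : ContDiff ℝ ∞ fun x => 4 * (K / L) ^ 2 * gradSq v x + acRes v x ^ 2 :=
    (contDiff_const.mul sG).add ((contDiff_acRes hv).pow 2)
  have s2 : ContDiff ℝ ∞ fun x =>
      χ x ^ 2 * ((3 * v x ^ 2 - 1) * gradSq v x + W' (v x) ^ 2 / 2) :=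
    (hχ.smooth.pow 2).mul ((((contDiff_const.mul (hv.pow 2)).sub contDiff_const).mul sG).add
      ((sW.pow 2).div_const 2))
  have h := setIntegral_mono (ii s2) (ii (sd.add s1)) fun x => by
    have := coercive_pointwise hχ hv x
    linarith
  rw [integral_add (ii sd) (ii s1), hdiv, zero_add] at h
  exact h

theorem coercive_integral {χ v : E 3 → ℝ} {K L : ℝ} (hχ : IsCutoff χ K L)
    (hv : ContDiff ℝ 2 v) (hc : HasCompactSupport v) :
    ∫ x in closedBall (0 : E 3) (2 * L),
        χ x ^ 2 * ((3 * v x ^ 2 - 1) * gradSq v x + W' (v x) ^ 2 / 2) ≤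
      ∫ x in closedBall (0 : E 3) (2 * L), (4 * (K / L) ^ 2 * gradSq v x + acRes v x ^ 2) := by
  obtain ⟨w, sw, -, hw⟩ := exists_smooth_approx hv hc
  have hχc := hχ.smooth.continuous
  have t1 := hw (fun p => χ p.1 ^ 2 * ((3 * p.2.1 ^ 2 - 1) * (∑ i, p.2.2.1 i ^ 2)
    + W' p.2.1 ^ 2 / 2)) (by unfold W'; fun_prop) (2 * L)
  have t2 := hw (fun p => 4 * (K / L) ^ 2 * (∑ i, p.2.2.1 i ^ 2) + (p.2.2.2 - W' p.2.1) ^ 2)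
    (by unfold W'; fun_prop) (2 * L)
  exact le_of_tendsto_of_tendsto' t1 t2 fun n => coercive_integral_smooth hχ (sw n)

/-! ### Rescaling -/

theorem exists_rescaled {Ω : Set (E 3)} (hΩ : IsOpen Ω) {u : E 3 → ℝ} (hu : ContDiffOn ℝ 2 u Ω)
    {x₀ : E 3} {ρ ε : ℝ} (hρ : 0 < ρ) (hε : 0 < ε) (hsub : closedBall x₀ ρ ⊆ Ω) :
    ∃ v : E 3 → ℝ, ContDiff ℝ 2 v ∧ HasCompactSupport v ∧ v 0 = u x₀ ∧
      ∀ y, x₀ + ε • y ∈ closedBall x₀ ρ → v y = u (x₀ + ε • y) ∧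
        gradSq v y = ε ^ 2 * ‖fderiv ℝ u (x₀ + ε • y)‖ ^ 2 ∧
        acEnergy v y = ε * areaDensity ε u (x₀ + ε • y) ∧
        acRes v y ^ 2 = ε ^ 2 * willDensity ε u (x₀ + ε • y) := by
  obtain ⟨a, ha, hsub2⟩ : ∃ a, 0 < a ∧ closedBall x₀ (ρ + a) ⊆ Ω := by
    obtain ⟨a, ha, h⟩ := (isCompact_closedBall x₀ ρ).exists_cthickening_subset_open hΩ hsub
    rw [cthickening_closedBall ha.le hρ.le] at h
    exact ⟨a, ha, by rwa [add_comm]⟩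
  let b : ContDiffBump x₀ := ⟨ρ + a / 2, ρ + a, by positivity, by linarith⟩
  set f : E 3 → ℝ := fun x => b x * u x with hf
  have fsupp : tsupport f ⊆ closedBall x₀ (ρ + a) := by
    refine (tsupport_mul_subset_left).trans ?_
    rw [b.tsupport_eq]
  have fC : ContDiff ℝ 2 f := contDiff_iff_contDiffAt.2 fun x => by
    by_cases hx : x ∈ tsupport f
    · exact b.contDiffAt.mul (hu.contDiffAt (hΩ.mem_nhds (hsub2 (fsupp hx))))
    · exact contDiffAt_const.congr_of_eventuallyEq (notMem_tsupport_iff_eventuallyEq.1 hx)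
  have fc : HasCompactSupport f := b.hasCompactSupport.mul_right
  have feq : ∀ x ∈ closedBall x₀ ρ, f =ᶠ[nhds x] u := fun x hx => by
    have hx' : x ∈ ball x₀ b.rIn := by
      have : dist x x₀ ≤ ρ := hx
      rw [mem_ball]
      show dist x x₀ < ρ + a / 2
      linarith
    filter_upwards [b.eventuallyEq_one_of_mem_ball hx'] with z hz
    rw [hf]
    simp only [hz, Pi.one_apply, one_mul]
  have hemb : Topology.IsClosedEmbedding fun y : E 3 => x₀ + ε • y :=
    (Homeomorph.addLeft x₀).isClosedEmbedding.comp
      (Homeomorph.smulOfNeZero ε hε.ne').isClosedEmbedding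
  have p1 : ∀ i, pd i (fun y => f (x₀ + ε • y)) = fun y => ε * pd i f (x₀ + ε • y) := fun i =>
    funext fun y => pd_comp_affine i (fC.differentiable (by norm_num)) ε x₀ y
  have d1 : ∀ i, Differentiable ℝ (pd i f) := fun i =>
    (contDiff_pd_of fC i).differentiable (by norm_num)
  refine ⟨fun y => f (x₀ + ε • y), fC.comp (by fun_prop : ContDiff ℝ 2 fun y : E 3 => x₀ + ε • y),
    fc.comp_isClosedEmbedding hemb, ?_, fun y hy => ?_⟩
  · simp only [smul_zero, add_zero]
    exact (feq x₀ (mem_closedBall_self hρ.le)).eq_of_nhds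
  · have e0 := (feq _ hy).eq_of_nhds
    have e1 := (feq _ hy).fderiv_eq (𝕜 := ℝ)
    have e2 : lapl f (x₀ + ε • y) = lap u (x₀ + ε • y) := by
      rw [← lap_eq_lapl fC, lap, lap, ((feq _ hy).fderiv (𝕜 := ℝ)).fderiv_eq]
    have hG : gradSq (fun y => f (x₀ + ε • y)) y = ε ^ 2 * ‖fderiv ℝ u (x₀ + ε • y)‖ ^ 2 := by
      rw [← e1, norm_fderiv_sq, gradSq, Finset.mul_sum]
      refine Finset.sum_congr rfl fun i _ => ?_
      rw [p1]
      ring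
    have hL : lapl (fun y => f (x₀ + ε • y)) y = ε ^ 2 * lap u (x₀ + ε • y) := by
      rw [← e2, lapl, lapl, Finset.mul_sum]
      refine Finset.sum_congr rfl fun i _ => ?_
      have hd : Differentiable ℝ fun y => pd i f (x₀ + ε • y) := (d1 i).comp (by fun_prop)
      rw [p1, pd_const_mul i ε hd]
      simp only [pd_comp_affine i (d1 i)]
      ring
    refine ⟨e0, hG, ?_, ?_⟩
    · simp only [acEnergy, hG, e0, areaDensity]
      field_simp
    · simp only [acRes, hL, e0, willDensity]
      field_simp

theorem setIntegral_rescale (f : E 3 → ℝ) (x₀ : E 3) {ρ ε : ℝ} (hε : 0 < ε) :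
    ∫ x in closedBall x₀ ρ, f x = ε ^ 3 * ∫ y in closedBall (0 : E 3) (ρ / ε), f (x₀ + ε • y) := by
  have h1 : ∫ x in closedBall x₀ ρ, f x = ∫ x in closedBall (0 : E 3) ρ, f (x₀ + x) := by
    have hp : (fun x : E 3 => x₀ + x) ⁻¹' closedBall x₀ ρ = closedBall 0 ρ := by
      ext x
      simp [dist_eq_norm]
    rw [← hp, (measurePreserving_add_left volume x₀).setIntegral_preimage_emb
      (measurableEmbedding_addLeft x₀)]
  have h2 := Measure.setIntegral_comp_smul_of_pos (volume : Measure (E 3)) (fun x => f (x₀ + x))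
    (closedBall (0 : E 3) (ρ / ε)) hε
  rw [h1, h2, smul_closedBall' hε.ne', smul_zero, Real.norm_of_nonneg hε.le,
    mul_div_cancel₀ _ hε.ne']
  simp only [finrank_euclideanSpace, Fintype.card_fin, smul_eq_mul]
  field_simp

/-- The clearing-out lemma on the ball of radius `2 * R` at scale `ε`. -/
theorem clearing_out_scaled {κ : ℝ} (hκ : 0 < κ) : ∃ η T, 0 < η ∧ 0 < T ∧
    ∀ {Ω : Set (E 3)} {u : E 3 → ℝ} {x₀ : E 3} {R ε : ℝ}, IsOpen Ω → ContDiffOn ℝ 2 u Ω →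
    closedBall x₀ (2 * R) ⊆ Ω → 0 < ε → T * ε ≤ R →
    ∫ x in closedBall x₀ (2 * R), areaDensity ε u x ≤ η * R ^ 2 →
    ∫ x in closedBall x₀ (2 * R), willDensity ε u x ≤ η * ε → |(|u x₀| - 1)| ≤ κ := by
  obtain ⟨η, T, hη, hT, h⟩ := clearing_out hκ
  refine ⟨η, T, hη, hT, fun {Ω u x₀ R ε} hΩ hu hsub hε hTR ha hw => ?_⟩
  have hR : 0 < R := lt_of_lt_of_le (by positivity) hTR
  obtain ⟨v, sv, cv, v0, hv⟩ := exists_rescaled hΩ hu (by positivity : 0 < 2 * R) hε hsub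
  have hmem : ∀ y ∈ closedBall (0 : E 3) (2 * (R / ε)), x₀ + ε • y ∈ closedBall x₀ (2 * R) :=
    fun y hy => by
      rw [mem_closedBall_zero_iff, ← mul_div_assoc, le_div_iff₀ hε] at hy
      simpa [dist_eq_norm, norm_smul, abs_of_pos hε, mul_comm ε] using hy
  rw [setIntegral_rescale _ _ hε, mul_div_assoc] at ha hw
  rw [← v0]
  refine h v (R / ε) sv cv ((le_div_iff₀ hε).2 hTR) ?_ ?_
  · rw [setIntegral_congr_fun measurableSet_closedBall fun y hy => (hv y (hmem y hy)).2.2.1,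
      integral_const_mul, div_pow, ← mul_div_assoc η, le_div_iff₀ (by positivity)]
    linarith
  · rw [setIntegral_congr_fun measurableSet_closedBall fun y hy => (hv y (hmem y hy)).2.2.2,
      integral_const_mul]
    refine le_of_mul_le_mul_right ?_ hε
    linarith

/-- Away from the transition region, the energy at scale `ε` is of order `ε ^ 2`. -/
theorem energy_decay : ∃ C, 0 < C ∧
    ∀ {Ω : Set (E 3)} {u : E 3 → ℝ} {x₀ : E 3} {R ε : ℝ}, IsOpen Ω → ContDiffOn ℝ 2 u Ω →
    closedBall x₀ (2 * R) ⊆ Ω → 0 < ε → 0 < R → (∀ x ∈ closedBall x₀ (2 * R), 9 / 10 ≤ |u x|) →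
    ∫ x in closedBall x₀ R, areaDensity ε u x ≤
      C * ε ^ 2 / R ^ 2 * (∫ x in closedBall x₀ (2 * R), areaDensity ε u x)
        + ε * ∫ x in closedBall x₀ (2 * R), willDensity ε u x := by
  obtain ⟨K, hK, hcut⟩ := exists_isCutoff
  refine ⟨8 * K ^ 2, by positivity, fun {Ω u x₀ R ε} hΩ hu hsub hε hR hpm => ?_⟩
  obtain ⟨v, sv, cv, -, hv⟩ := exists_rescaled hΩ hu (by positivity : 0 < 2 * R) hε hsub
  have hmem : ∀ y ∈ closedBall (0 : E 3) (2 * (R / ε)), x₀ + ε • y ∈ closedBall x₀ (2 * R) :=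
    fun y hy => by
      rw [mem_closedBall_zero_iff, ← mul_div_assoc, le_div_iff₀ hε] at hy
      simpa [dist_eq_norm, norm_smul, abs_of_pos hε, mul_comm ε] using hy
  have hL : 0 < R / ε := by positivity
  have hsubL : closedBall (0 : E 3) (R / ε) ⊆ closedBall 0 (2 * (R / ε)) :=
    closedBall_subset_closedBall (by linarith)
  obtain ⟨χ, hχ⟩ := hcut (R / ε) hL
  have ii : ∀ {f : E 3 → ℝ}, Continuous f → ∀ r, IntegrableOn f (closedBall (0 : E 3) r) :=
    fun hf r => hf.continuousOn.integrableOn_compact (isCompact_closedBall 0 r)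
  have cχ := hχ.smooth.continuous
  have cv' := sv.continuous
  have cpd := fun i => continuous_pd_of (sv.of_le one_le_two) i
  have cG : Continuous (gradSq v) := by unfold gradSq; fun_prop
  have cA : Continuous (acEnergy v) := by unfold acEnergy W; fun_prop
  have cR : Continuous (acRes v) := by
    have h1 : ∀ i, Continuous (pd i (pd i v)) := fun i =>
      ((contDiff_pd_of sv i).continuous_fderiv (by norm_num)).clm_apply continuous_const
    unfold acRes lapl W'
    fun_prop
  have h1 := coercive_integral hχ sv cv
  have h2 : ∫ x in closedBall (0 : E 3) (R / ε), acEnergy v x ≤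
      ∫ x in closedBall (0 : E 3) (2 * (R / ε)),
        χ x ^ 2 * ((3 * v x ^ 2 - 1) * gradSq v x + W' (v x) ^ 2 / 2) := by
    have e1 : ∫ x in closedBall (0 : E 3) (R / ε), acEnergy v x =
        ∫ x in closedBall (0 : E 3) (R / ε), χ x ^ 2 * acEnergy v x :=
      setIntegral_congr_fun measurableSet_closedBall fun x hx => by
        simp [hχ.eq_one x (mem_closedBall_zero_iff.1 hx)]
    rw [e1]
    refine (setIntegral_mono_set (ii (by fun_prop) _) ?_ hsubL.eventuallyLE).trans ?_
    · exact ae_of_all _ fun x => mul_nonneg (sq_nonneg _) (acEnergy_nonneg v x)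
    · refine setIntegral_mono_on (ii (by fun_prop) _) (ii (by unfold W'; fun_prop) _)
        measurableSet_closedBall fun x hx => mul_le_mul_of_nonneg_left ?_ (sq_nonneg _)
      have hx1 := hpm _ (hmem x hx)
      rw [← (hv x (hmem x hx)).1] at hx1
      have hsq : 81 / 100 ≤ v x ^ 2 := by
        rw [← sq_abs]
        nlinarith
      have hG := gradSq_nonneg v x
      have hw : W (v x) ≤ W' (v x) ^ 2 / 2 := by
        simp only [W, W']
        nlinarith [mul_nonneg (by linarith : 0 ≤ v x ^ 2 - 1 / 2) (sq_nonneg (v x ^ 2 - 1))]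
      simp only [acEnergy]
      nlinarith
  have h3 : ∫ x in closedBall (0 : E 3) (2 * (R / ε)),
        (4 * (K / (R / ε)) ^ 2 * gradSq v x + acRes v x ^ 2) ≤
      8 * (K / (R / ε)) ^ 2 * (∫ x in closedBall (0 : E 3) (2 * (R / ε)), acEnergy v x)
        + ∫ x in closedBall (0 : E 3) (2 * (R / ε)), acRes v x ^ 2 := by
    rw [← integral_const_mul, ← integral_add (ii (by fun_prop) _) (ii (by fun_prop) _)]
    refine setIntegral_mono (ii (by fun_prop) _) (ii (by fun_prop) _) fun x => ?_
    have hw := W_nonneg (v x)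
    have hp : 0 ≤ (K / (R / ε)) ^ 2 * W (v x) := by positivity
    simp only [acEnergy]
    linarith
  have h4 := h2.trans (h1.trans h3)
  rw [setIntegral_congr_fun measurableSet_closedBall
      fun y hy => (hv y (hmem y (hsubL hy))).2.2.1,
    setIntegral_congr_fun measurableSet_closedBall fun y hy => (hv y (hmem y hy)).2.2.1,
    setIntegral_congr_fun measurableSet_closedBall fun y hy => (hv y (hmem y hy)).2.2.2,
    integral_const_mul, integral_const_mul, integral_const_mul] at h4
  rw [setIntegral_rescale (areaDensity ε u) x₀ (ρ := R) hε,
    setIntegral_rescale (areaDensity ε u) x₀ (ρ := 2 * R) hε,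
    setIntegral_rescale (willDensity ε u) x₀ hε, mul_div_assoc 2 R ε]
  have h5 := mul_le_mul_of_nonneg_left h4 (sq_nonneg ε)
  have e : (K / (R / ε)) ^ 2 = K ^ 2 * ε ^ 2 / R ^ 2 := by field_simp
  rw [e] at h5
  refine le_trans (le_of_eq ?_) (h5.trans (le_of_eq ?_)) <;> ring

/-! ### Mass bounds on balls under weak convergence -/

theorem exists_bump (x : E 3) {r R : ℝ} (hr : 0 < r) (hrR : r < R) :
    ∃ φ : BoundedContinuousFunction (E 3) ℝ, (∀ y, 0 ≤ φ y) ∧ (∀ y, φ y ≤ 1) ∧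
      (∀ y ∈ closedBall x r, φ y = 1) ∧ ∀ y, y ∉ closedBall x R → φ y = 0 := by
  let b : ContDiffBump x := ⟨r, R, hr, hrR⟩
  refine ⟨BoundedContinuousFunction.ofNormedAddCommGroup b b.continuous 1 fun y => ?_,
    fun y => b.nonneg, fun y => b.le_one, fun y hy => b.one_of_mem_closedBall hy, fun y hy => ?_⟩
  · rw [Real.norm_of_nonneg b.nonneg]
    exact b.le_one
  · refine b.zero_of_le_dist ?_
    rw [mem_closedBall, not_le] at hy
    exact hy.le

section WeakConvergence

variable {Ω : Set (E 3)} {f : ℕ → E 3 → ℝ} {ν : Measure (E 3)} {x : E 3} {r R : ℝ}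

theorem setIntegral_bump_mul {φ : BoundedContinuousFunction (E 3) ℝ} {g : E 3 → ℝ}
    (hφ : ∀ y, y ∉ closedBall x R → φ y = 0) (hsub : closedBall x R ⊆ Ω) (hΩ : IsOpen Ω) :
    ∫ y in Ω, φ y * g y = ∫ y in closedBall x R, φ y * g y :=
  setIntegral_eq_of_subset_of_forall_sdiff_eq_zero hΩ.measurableSet hsub fun y hy => by
    rw [hφ y hy.2, zero_mul]

theorem eventually_setIntegral_closedBall_le [IsFiniteMeasure ν] (hΩ : IsOpen Ω)
    (hf : ∀ k, ContinuousOn (f k) Ω) (hf0 : ∀ k y, 0 ≤ f k y)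
    (hconv : ∀ φ : BoundedContinuousFunction (E 3) ℝ,
      Tendsto (fun k => ∫ y in Ω, φ y * f k y) atTop (nhds (∫ y, φ y ∂ν)))
    (hr : 0 < r) (hrR : r < R) (hsub : closedBall x R ⊆ Ω) {c : ℝ}
    (hc : ν.real (closedBall x R) < c) :
    ∀ᶠ k in atTop, ∫ y in closedBall x r, f k y ≤ c := by
  obtain ⟨φ, φ0, φ1, φone, φzero⟩ := exists_bump x hr hrR
  have hle : ∫ y, φ y ∂ν ≤ ν.real (closedBall x R) := by
    rw [← setIntegral_eq_integral_of_forall_compl_eq_zero φzero]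
    refine (setIntegral_mono (φ.integrable ν).integrableOn (integrable_const 1) φ1).trans ?_
    simp
  filter_upwards [(hconv φ).eventually_lt_const (hle.trans_lt hc)] with k hk
  rw [setIntegral_bump_mul φzero hsub hΩ] at hk
  refine le_trans ?_ hk.le
  have e : ∫ y in closedBall x r, f k y = ∫ y in closedBall x r, φ y * f k y :=
    setIntegral_congr_fun measurableSet_closedBall fun y hy => by
      rw [φone y hy, one_mul]
  rw [e]
  refine setIntegral_mono_set ?_ (ae_of_all _ fun y => mul_nonneg (φ0 y) (hf0 k y))
    (closedBall_subset_closedBall hrR.le).eventuallyLE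
  exact ((φ.continuous.continuousOn).mul ((hf k).mono hsub)).integrableOn_compact
    (isCompact_closedBall x R)

theorem measure_closedBall_eq_zero [IsFiniteMeasure ν] (hΩ : IsOpen Ω)
    (hf : ∀ k, ContinuousOn (f k) Ω) (hf0 : ∀ k y, 0 ≤ f k y)
    (hconv : ∀ φ : BoundedContinuousFunction (E 3) ℝ,
      Tendsto (fun k => ∫ y in Ω, φ y * f k y) atTop (nhds (∫ y, φ y ∂ν)))
    (hr : 0 < r) (hrR : r < R) (hsub : closedBall x R ⊆ Ω) {b : ℕ → ℝ}
    (hb : Tendsto b atTop (nhds 0)) (hfb : ∀ᶠ k in atTop, ∫ y in closedBall x R, f k y ≤ b k) :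
    ν (closedBall x r) = 0 := by
  obtain ⟨φ, φ0, φ1, φone, φzero⟩ := exists_bump x hr hrR
  have hle : ∫ y, φ y ∂ν ≤ 0 := by
    refine le_of_tendsto_of_tendsto (hconv φ) hb ?_
    filter_upwards [hfb] with k hk
    rw [setIntegral_bump_mul φzero hsub hΩ]
    have hc := (hf k).mono hsub
    refine (setIntegral_mono
      ((φ.continuous.continuousOn.mul hc).integrableOn_compact (isCompact_closedBall x R))
      (hc.integrableOn_compact (isCompact_closedBall x R))
      fun y => mul_le_of_le_one_left (hf0 k y) (φ1 y)).trans hk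
  have hge : ν.real (closedBall x r) ≤ ∫ y, φ y ∂ν := by
    have e : ν.real (closedBall x r) = ∫ y in closedBall x r, φ y ∂ν := by
      rw [setIntegral_congr_fun measurableSet_closedBall fun y hy => φone y hy]
      simp
    rw [e]
    exact setIntegral_le_integral (φ.integrable ν) (ae_of_all _ φ0)
  exact (measureReal_eq_zero_iff).1 (le_antisymm (hge.trans hle) measureReal_nonneg)

end WeakConvergence

theorem c0_pos : 0 < c0 := by
  unfold c0
  positivity

section Densities

variable {Ω : Set (E 3)} {u : E 3 → ℝ} {ε : ℝ}

theorem areaDensity_nonneg (hε : 0 < ε) (x : E 3) : 0 ≤ areaDensity ε u x := by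
  have := W_nonneg (u x)
  unfold areaDensity
  positivity

theorem willDensity_nonneg (x : E 3) : 0 ≤ willDensity ε u x := sq_nonneg _

theorem continuousOn_areaDensity (hΩ : IsOpen Ω) (hu : ContDiffOn ℝ 2 u Ω) :
    ContinuousOn (areaDensity ε u) Ω := by
  have h0 := hu.continuousOn
  have h1 : ContinuousOn (fderiv ℝ u) Ω := hu.continuousOn_fderiv_of_isOpen hΩ (by norm_num)
  unfold areaDensity W
  fun_prop

theorem continuousOn_willDensity (hΩ : IsOpen Ω) (hu : ContDiffOn ℝ 2 u Ω) :
    ContinuousOn (willDensity ε u) Ω := by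
  have h0 := hu.continuousOn
  have h2 : ContinuousOn (fderiv ℝ (fderiv ℝ u)) Ω :=
    (hu.fderiv_of_isOpen (m := 1) hΩ (by norm_num)).continuousOn_fderiv_of_isOpen hΩ le_rfl
  have h3 : ContinuousOn (lap u) Ω := by
    unfold lap
    exact continuousOn_finsetSum _ fun i _ =>
      (h2.clm_apply continuousOn_const).clm_apply continuousOn_const
  unfold willDensity W'
  fun_prop

end Densities

/-! ### Local behaviour of the sequence -/

section Sequence

variable {Ω : Set (E 3)} {ε : ℕ → ℝ} {u : ℕ → E 3 → ℝ} {μ α : Measure (E 3)} {x : E 3} {r R : ℝ}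

theorem weakConvA.tendsto_integral_mul (hμ : weakConvA Ω ε u μ)
    (φ : BoundedContinuousFunction (E 3) ℝ) :
    Tendsto (fun k => ∫ y in Ω, φ y * (1 / c0 * areaDensity (ε k) (u k) y)) atTop
      (nhds (∫ y, φ y ∂μ)) := by
  simpa only [← integral_const_mul, mul_left_comm] using hμ φ

theorem weakConvW.tendsto_integral_mul (hα : weakConvW Ω ε u α)
    (φ : BoundedContinuousFunction (E 3) ℝ) :
    Tendsto (fun k => ∫ y in Ω, φ y * (1 / (c0 * ε k) * willDensity (ε k) (u k) y)) atTop
      (nhds (∫ y, φ y ∂α)) := by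
  simpa only [← integral_const_mul, mul_left_comm] using hα φ

theorem eventually_area_le [IsFiniteMeasure μ] (hΩ : IsOpen Ω) (hε : ∀ k, 0 < ε k)
    (hu : ∀ k, ContDiffOn ℝ 2 (u k) Ω) (hμ : weakConvA Ω ε u μ)
    (hr : 0 < r) (hrR : r < R) (hsub : closedBall x R ⊆ Ω) {c : ℝ}
    (hc : c0 * μ.real (closedBall x R) < c) :
    ∀ᶠ k in atTop, ∫ y in closedBall x r, areaDensity (ε k) (u k) y ≤ c := by
  have h0 := c0_pos
  have h := eventually_setIntegral_closedBall_le
    (f := fun k y => 1 / c0 * areaDensity (ε k) (u k) y) hΩ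
    (fun k => continuousOn_const.mul (continuousOn_areaDensity hΩ (hu k)))
    (fun k y => mul_nonneg (by positivity) (areaDensity_nonneg (hε k) y))
    hμ.tendsto_integral_mul hr hrR hsub (c := c / c0) (by rw [lt_div_iff₀ h0]; linarith)
  filter_upwards [h] with k hk
  rwa [integral_const_mul, one_div_mul_eq_div, div_le_div_iff_of_pos_right h0] at hk

theorem eventually_will_le [IsFiniteMeasure α] (hΩ : IsOpen Ω) (hε : ∀ k, 0 < ε k)
    (hu : ∀ k, ContDiffOn ℝ 2 (u k) Ω) (hα : weakConvW Ω ε u α)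
    (hr : 0 < r) (hrR : r < R) (hsub : closedBall x R ⊆ Ω) {c : ℝ}
    (hc : c0 * α.real (closedBall x R) < c) :
    ∀ᶠ k in atTop, ∫ y in closedBall x r, willDensity (ε k) (u k) y ≤ c * ε k := by
  have h0 := c0_pos
  have h := eventually_setIntegral_closedBall_le
    (f := fun k y => 1 / (c0 * ε k) * willDensity (ε k) (u k) y) hΩ
    (fun k => continuousOn_const.mul (continuousOn_willDensity hΩ (hu k)))
    (fun k y => mul_nonneg (by have := hε k; positivity) (willDensity_nonneg y))
    hα.tendsto_integral_mul hr hrR hsub (c := c / c0) (by rw [lt_div_iff₀ h0]; linarith)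
  filter_upwards [h] with k hk
  have hk0 := hε k
  rw [integral_const_mul, one_div_mul_eq_div, div_le_div_iff₀ (by positivity) h0] at hk
  refine le_of_mul_le_mul_right ?_ h0
  linarith

/-- Small limit measures near `x` force `|u k|` to be uniformly close to `1` near `x`. -/
theorem eventually_abs_near_one {κ : ℝ} (hκ : 0 < κ) : ∃ η, 0 < η ∧
    ∀ {Ω : Set (E 3)} {ε : ℕ → ℝ} {u : ℕ → E 3 → ℝ} {μ α : Measure (E 3)} [IsFiniteMeasure μ]
    [IsFiniteMeasure α] {x : E 3} {R : ℝ}, IsOpen Ω → (∀ k, 0 < ε k) →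
    Tendsto ε atTop (nhds 0) → (∀ k, ContDiffOn ℝ 2 (u k) Ω) → weakConvA Ω ε u μ →
    weakConvW Ω ε u α → 0 < R → closedBall x (4 * R) ⊆ Ω →
    c0 * μ.real (closedBall x (4 * R)) < η * R ^ 2 → c0 * α.real (closedBall x (4 * R)) < η →
    ∀ᶠ k in atTop, ∀ y ∈ closedBall x R, |(|u k y| - 1)| ≤ κ := by
  obtain ⟨η, T, hη, hT, h⟩ := clearing_out_scaled hκ
  refine ⟨η, hη, fun {Ω ε u μ α _ _ x R} hΩ hε hε0 hu hμ hα hR hsub hm ha => ?_⟩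
  have hTε : ∀ᶠ k in atTop, T * ε k < R :=
    (hε0.const_mul T).eventually_lt_const (by simpa using hR)
  filter_upwards [eventually_area_le hΩ hε hu hμ (by linarith : 0 < 3 * R) (by linarith) hsub hm,
    eventually_will_le hΩ hε hu hα (by linarith : 0 < 3 * R) (by linarith) hsub ha,
    hTε] with k h1 h2 h3 y hy
  have hb1 : closedBall y (2 * R) ⊆ closedBall x (3 * R) :=
    closedBall_subset_closedBall' (by rw [mem_closedBall] at hy; linarith)
  have hb2 : closedBall x (3 * R) ⊆ Ω :=
    (closedBall_subset_closedBall (by linarith)).trans hsub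
  refine h hΩ (hu k) (hb1.trans hb2) (hε k) h3.le (le_trans ?_ h1) (le_trans ?_ h2)
  · exact setIntegral_mono_set (((continuousOn_areaDensity hΩ (hu k)).mono hb2).integrableOn_compact
      (isCompact_closedBall _ _)) (ae_of_all _ (areaDensity_nonneg (hε k))) hb1.eventuallyLE
  · exact setIntegral_mono_set (((continuousOn_willDensity hΩ (hu k)).mono hb2).integrableOn_compact
      (isCompact_closedBall _ _)) (ae_of_all _ willDensity_nonneg) hb1.eventuallyLE

/-- Small limit measures near `x` keep `x` off the support of the limit energy. -/
theorem notMem_sptM_of_small : ∃ η, 0 < η ∧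
    ∀ {Ω : Set (E 3)} {ε : ℕ → ℝ} {u : ℕ → E 3 → ℝ} {μ α : Measure (E 3)} [IsFiniteMeasure μ]
    [IsFiniteMeasure α] {x : E 3} {R : ℝ}, IsOpen Ω → (∀ k, 0 < ε k) →
    Tendsto ε atTop (nhds 0) → (∀ k, ContDiffOn ℝ 2 (u k) Ω) → weakConvA Ω ε u μ →
    weakConvW Ω ε u α → 0 < R → closedBall x (4 * R) ⊆ Ω →
    c0 * μ.real (closedBall x (4 * R)) < η * R ^ 2 → c0 * α.real (closedBall x (4 * R)) < η →
    x ∉ sptM μ := by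
  obtain ⟨η, hη, h⟩ := eventually_abs_near_one (κ := 1 / 10) (by norm_num)
  obtain ⟨C, hC, hdecay⟩ := energy_decay
  refine ⟨η, hη, fun {Ω ε u μ α _ _ x R} hΩ hε hε0 hu hμ hα hR hsub hm ha => ?_⟩
  have hsub' : closedBall x R ⊆ Ω := (closedBall_subset_closedBall (by linarith)).trans hsub
  have h0 := c0_pos
  have e2 : 2 * (R / 2) = R := by ring
  have hb : Tendsto (fun k => 1 / c0 * (C * ε k ^ 2 / (R / 2) ^ 2 * (η * R ^ 2)
      + ε k * (η * ε k))) atTop (nhds 0) := by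
    have hc : Continuous fun t : ℝ => 1 / c0 * (C * t ^ 2 / (R / 2) ^ 2 * (η * R ^ 2)
      + t * (η * t)) := by fun_prop
    have := (hc.tendsto 0).comp hε0
    simpa [Function.comp_def] using this
  have hzero : μ (closedBall x (R / 4)) = 0 := by
    refine measure_closedBall_eq_zero
      (f := fun k y => 1 / c0 * areaDensity (ε k) (u k) y) hΩ
      (fun k => continuousOn_const.mul (continuousOn_areaDensity hΩ (hu k)))
      (fun k y => mul_nonneg (by positivity) (areaDensity_nonneg (hε k) y))
      hμ.tendsto_integral_mul (by linarith : 0 < R / 4) (by linarith : R / 4 < R / 2)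
      ((closedBall_subset_closedBall (by linarith)).trans hsub') hb ?_
    filter_upwards [eventually_area_le hΩ hε hu hμ hR (by linarith) hsub hm,
      eventually_will_le hΩ hε hu hα hR (by linarith) hsub ha,
      h hΩ hε hε0 hu hμ hα hR hsub hm ha] with k h1 h2 h3
    have hd := hdecay (x₀ := x) (R := R / 2) hΩ (hu k) (by rwa [e2]) (hε k) (by linarith)
      fun y hy => by
        rw [e2] at hy
        have := (abs_le.1 (h3 y hy)).1
        linarith
    rw [e2] at hd
    have hk := hε k
    rw [integral_const_mul]
    gcongr
    refine hd.trans ?_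
    gcongr
  intro hx
  exact (hx (R / 4) (by linarith)).ne' (measure_mono_null ball_subset_closedBall hzero)

end Sequence

/-! ### The support of the limit energy is a null set -/

theorem countable_setOf_measure_singleton_ne_zero (α : Measure (E 3)) [IsFiniteMeasure α] :
    {x | α {x} ≠ 0}.Countable := by
  have h := Measure.countable_meas_level_set_pos (μ := α) (measurable_id (α := E 3))
  simpa only [id, ofPred_eq_eq_singleton, pos_iff_ne_zero] using h

theorem eventually_small_radius {Ω : Set (E 3)} {μ α : Measure (E 3)} [IsFiniteMeasure α]
    {x : E 3} (hΩ : IsOpen Ω) (hx : x ∈ Ω) (hα : α {x} = 0)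
    (hμ : Tendsto (fun r => μ.real (closedBall x r) / r ^ 2) (nhdsWithin 0 (Ioi 0)) (nhds 0))
    {η : ℝ} (hη : 0 < η) :
    ∀ᶠ r in nhdsWithin (0 : ℝ) (Ioi 0), closedBall x (4 * r) ⊆ Ω ∧
      c0 * μ.real (closedBall x (4 * r)) < η * r ^ 2 ∧ c0 * α.real (closedBall x (4 * r)) < η := by
  have h0 := c0_pos
  have hscale : Tendsto (fun r : ℝ => 4 * r) (nhdsWithin 0 (Ioi 0)) (nhdsWithin 0 (Ioi 0)) := by
    refine tendsto_nhdsWithin_iff.2 ⟨?_, ?_⟩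
    · have : Continuous fun r : ℝ => 4 * r := by fun_prop
      simpa using (this.tendsto 0).mono_left nhdsWithin_le_nhds
    · filter_upwards [self_mem_nhdsWithin] with r hr
      have : 0 < r := hr
      show (0 : ℝ) < 4 * r
      linarith
  obtain ⟨δ, hδ, hball⟩ := Metric.isOpen_iff.1 hΩ x hx
  have h1 : ∀ᶠ r in nhdsWithin (0 : ℝ) (Ioi 0), closedBall x (4 * r) ⊆ Ω := by
    filter_upwards [(tendsto_nhdsWithin_iff.1 hscale).1.eventually_lt_const hδ] with r hr
    exact (closedBall_subset_ball hr).trans hball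
  have h2 : ∀ᶠ r in nhdsWithin (0 : ℝ) (Ioi 0),
      μ.real (closedBall x (4 * r)) / (4 * r) ^ 2 < η / (16 * c0) :=
    (hμ.comp hscale).eventually_lt_const (by positivity)
  have h3 : Tendsto (fun r => α (closedBall x r)) (nhdsWithin 0 (Ioi 0)) (nhds 0) := by
    have h := tendsto_measure_cthickening (μ := α) (s := {x}) ⟨1, one_pos, measure_ne_top _ _⟩
    rw [closure_singleton, hα] at h
    refine (h.mono_left nhdsWithin_le_nhds).congr' ?_
    filter_upwards [self_mem_nhdsWithin] with r hr
    rw [cthickening_singleton x (le_of_lt hr)]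
  have h4 : Tendsto (fun r => c0 * α.real (closedBall x (4 * r))) (nhdsWithin 0 (Ioi 0))
      (nhds 0) := by
    have := (((ENNReal.tendsto_toReal ENNReal.zero_ne_top).comp h3).comp hscale).const_mul c0
    simpa [Measure.real] using this
  filter_upwards [h1, h2, h4.eventually_lt_const hη, self_mem_nhdsWithin] with r a1 a2 a3 a4
  have hr : 0 < r := a4
  refine ⟨a1, ?_, a3⟩
  rw [div_lt_div_iff₀ (by positivity) (by positivity)] at a2
  nlinarith

theorem ae_notMem_sptM {Ω : Set (E 3)} {ε : ℕ → ℝ} {u : ℕ → E 3 → ℝ} {μ α : Measure (E 3)}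
    [IsFiniteMeasure μ] [IsFiniteMeasure α] (hΩ : IsOpen Ω) (hε : ∀ k, 0 < ε k)
    (hε0 : Tendsto ε atTop (nhds 0)) (hu : ∀ k, ContDiffOn ℝ 2 (u k) Ω)
    (hμ : weakConvA Ω ε u μ) (hα : weakConvW Ω ε u α) :
    ∀ᵐ x : E 3, x ∈ Ω → x ∉ sptM μ := by
  obtain ⟨η, hη, h⟩ := notMem_sptM_of_small
  filter_upwards [Besicovitch.ae_tendsto_rnDeriv μ volume,
    Measure.rnDeriv_lt_top μ (volume : Measure (E 3)),
    (countable_setOf_measure_singleton_ne_zero α).ae_notMem volume] with x h1 h2 h3 hx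
  have hα0 : α {x} = 0 := by simpa using h3
  have hd : Tendsto (fun r => μ.real (closedBall x r) / r ^ 2) (nhdsWithin 0 (Ioi 0))
      (nhds 0) := by
    have t1 := (ENNReal.tendsto_toReal h2.ne).comp h1
    have t2 : Tendsto (fun r : ℝ => r * volume.real (ball (0 : E 3) 1)) (nhdsWithin 0 (Ioi 0))
        (nhds 0) := by
      have : Continuous fun r : ℝ => r * volume.real (ball (0 : E 3) 1) := by fun_prop
      simpa using (this.tendsto 0).mono_left nhdsWithin_le_nhds
    have t3 := t1.mul t2
    rw [mul_zero] at t3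
    refine t3.congr' ?_
    filter_upwards [self_mem_nhdsWithin] with r hr
    have hr : 0 < r := hr
    have hV : 0 < volume.real (ball (0 : E 3) 1) :=
      ENNReal.toReal_pos (measure_ball_pos _ _ one_pos).ne' measure_ball_lt_top.ne
    have hvol := Measure.addHaar_real_closedBall (volume : Measure (E 3)) x hr.le
    rw [finrank_euclideanSpace, Fintype.card_fin] at hvol
    simp only [Function.comp_apply, ENNReal.toReal_div]
    change μ.real _ / volume.real _ * _ = _
    rw [hvol]
    field_simp
  obtain ⟨r, ⟨a1, a2, a3⟩, a4⟩ :=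
    ((eventually_small_radius hΩ hx hα0 hd hη).and self_mem_nhdsWithin).exists
  exact h hΩ hε hε0 hu hμ hα a4 a1 a2 a3

/-! ### Pointwise convergence -/

theorem isOpen_compl_sptM (μ : Measure (E 3)) : IsOpen (sptM μ)ᶜ := by
  rw [Metric.isOpen_iff]
  intro x hx
  simp only [sptM, mem_compl_iff, mem_ofPred_eq, not_forall, not_lt, nonpos_iff_eq_zero] at hx
  obtain ⟨r, hr, h0⟩ := hx
  refine ⟨r, hr, fun y hy hys => ?_⟩
  refine (hys (r - dist y x) (by rw [mem_ball] at hy; linarith)).ne' ?_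
  exact measure_mono_null (ball_subset_ball' (by linarith)) h0

theorem integrableOn_of_locally_sign {Ω S : Set (E 3)} {w : E 3 → ℝ} (hΩ : IsOpen Ω)
    (hΩb : Bornology.IsBounded Ω) (hS : IsOpen Sᶜ) (hnull : ∀ᵐ x : E 3, x ∈ Ω → x ∉ S)
    (hpm : ∀ x ∈ Ω \ S, w x = 1 ∨ w x = -1)
    (hlc : ∀ x ∈ Ω \ S, ∃ ρ > 0, ∀ y ∈ ball x ρ, y ∈ Ω \ S → w y = w x) :
    IntegrableOn w Ω := by
  have ho : IsOpen (Ω \ S) := hΩ.inter hS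
  have hae : (Ω \ S : Set (E 3)) =ᵐ[volume] Ω := by
    filter_upwards [hnull] with x hx
    exact propext ⟨fun h => h.1, fun h => ⟨h, hx h⟩⟩
  refine IntegrableOn.congr_set_ae ?_ hae.symm
  have hc : ContinuousOn w (Ω \ S) := fun x hx => by
    obtain ⟨ρ, hρ, h⟩ := hlc x hx
    refine (continuousWithinAt_const (b := w x)).congr_of_eventuallyEq ?_ rfl
    filter_upwards [self_mem_nhdsWithin, mem_nhdsWithin_of_mem_nhds (ball_mem_nhds x hρ)]
      with y hy hyb
    exact h y hyb hy
  refine IntegrableOn.of_bound ?_ (hc.aestronglyMeasurable ho.measurableSet) 1 ?_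
  · exact (hΩb.subset sdiff_subset).measure_lt_top
  · filter_upwards [ae_restrict_mem ho.measurableSet] with x hx
    rcases hpm x hx with h | h <;> simp [h]

/-- If `|v|` is near `1` on a ball and `v` is close to the sign `σ` in mean, then `v` has the sign
`σ` at the centre. -/
theorem abs_sub_le_of_near_sign {v : E 3 → ℝ} {x : E 3} {r κ σ : ℝ} (hr : 0 < r)
    (hv : ContinuousOn v (closedBall x r)) (hσ : σ = 1 ∨ σ = -1) (hκ : κ < 1)
    (hnear : ∀ y ∈ closedBall x r, |(|v y| - 1)| ≤ κ)
    (hmean : ∫ y in closedBall x r, |v y - σ| < volume.real (closedBall x r)) :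
    |v x - σ| ≤ κ := by
  have hσ2 : σ * σ = 1 := by rcases hσ with h | h <;> simp [h]
  have hσa : |σ| = 1 := by rcases hσ with h | h <;> simp [h]
  have hx : x ∈ closedBall x r := mem_closedBall_self hr.le
  have hne : ∀ y ∈ closedBall x r, σ * v y ≠ 0 := fun y hy h0 => by
    have h1 : v y = 0 := by
      rcases mul_eq_zero.1 h0 with h | h
      · rw [h] at hσ2; norm_num at hσ2
      · exact h
    have := hnear y hy
    rw [h1] at this
    norm_num at this
    linarith
  have habs : ∀ y, |σ * v y| = |v y| := fun y => by rw [abs_mul, hσa, one_mul]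
  have hdist : ∀ y, |v y - σ| = |σ * v y - 1| := fun y => by
    have : σ * v y - 1 = σ * (v y - σ) := by rw [mul_sub, hσ2]
    rw [this, abs_mul, hσa, one_mul]
  have hpos : 0 < σ * v x := by
    by_contra hneg
    have hlt : ∀ y ∈ closedBall x r, σ * v y < 0 := fun y hy => by
      by_contra hge
      have hpre := (convex_closedBall x r).isPreconnected.image (fun y => σ * v y)
        (continuousOn_const.mul hv)
      obtain ⟨z, hz, hz0⟩ := hpre.ordConnected.out (mem_image_of_mem _ hx) (mem_image_of_mem _ hy)
        ⟨not_lt.1 hneg, not_lt.1 hge⟩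
      exact hne z hz hz0
    have hge : volume.real (closedBall x r) ≤ ∫ y in closedBall x r, |v y - σ| := by
      have e : volume.real (closedBall x r) = ∫ _ in closedBall x r, (1 : ℝ) := by simp
      rw [e]
      refine setIntegral_mono_on ?_ ?_ measurableSet_closedBall fun y hy => ?_
      · exact continuousOn_const.integrableOn_compact (isCompact_closedBall x r)
      · exact ((hv.sub continuousOn_const).abs).integrableOn_compact (isCompact_closedBall x r)
      · rw [hdist, abs_of_neg (by linarith [hlt y hy])]
        linarith [hlt y hy]
    linarith
  have := hnear x hx
  rwa [← habs x, abs_of_pos hpos, ← hdist] at this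

theorem tendsto_of_measure_singleton_eq_zero {Ω : Set (E 3)} (hΩ : IsOpen Ω)
    (hΩb : Bornology.IsBounded Ω) {ε : ℕ → ℝ} (hε : ∀ k, 0 < ε k)
    (hε0 : Tendsto ε atTop (nhds 0)) {u : ℕ → E 3 → ℝ}
    (hu : ∀ k, ContDiffOn ℝ 2 (u k) (closure Ω)) {μ α : Measure (E 3)}
    [IsFiniteMeasure μ] [IsFiniteMeasure α] (hμ : weakConvA Ω ε u μ) (hα : weakConvW Ω ε u α)
    {ulim : E 3 → ℝ} (hL1 : Tendsto (fun k => ∫ x in Ω, |u k x - ulim x|) atTop (nhds 0))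
    (hpm : ∀ x ∈ Ω \ sptM μ, ulim x = 1 ∨ ulim x = -1)
    (hlc : ∀ x ∈ Ω \ sptM μ, ∃ ρ > 0, ∀ y ∈ ball x ρ, y ∈ Ω \ sptM μ → ulim y = ulim x)
    {x : E 3} (hx : x ∈ Ω \ sptM μ) (hαx : α {x} = 0) :
    Tendsto (fun k => u k x) atTop (nhds (ulim x)) := by
  have huΩ : ∀ k, ContDiffOn ℝ 2 (u k) Ω := fun k => (hu k).mono subset_closure
  have habs : ∀ k, IntegrableOn (fun y => |u k y - ulim y|) Ω := fun k => by
    have h1 : IntegrableOn (u k) Ω :=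
      ((hu k).continuousOn.integrableOn_compact hΩb.isCompact_closure).mono_set subset_closure
    have h2 := integrableOn_of_locally_sign hΩ hΩb (isOpen_compl_sptM μ)
      (ae_notMem_sptM hΩ hε hε0 huΩ hμ hα) hpm hlc
    exact (h1.sub h2).abs
  obtain ⟨δ, hδ, hball⟩ := Metric.isOpen_iff.1 (hΩ.inter (isOpen_compl_sptM μ)) x hx
  obtain ⟨ρ, hρ, hconst⟩ := hlc x hx
  obtain ⟨s, hs, hs0⟩ : ∃ s > 0, μ (ball x s) = 0 := by
    have := hx.2
    simpa only [sptM, mem_ofPred_eq, not_forall, not_lt, nonpos_iff_eq_zero, exists_prop,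
      gt_iff_lt] using this
  have hd : Tendsto (fun r => μ.real (closedBall x r) / r ^ 2) (nhdsWithin 0 (Ioi 0))
      (nhds 0) := by
    refine tendsto_const_nhds.congr' ?_
    filter_upwards [mem_nhdsWithin_of_mem_nhds (Iio_mem_nhds hs)] with r hr
    have h0 : μ (closedBall x r) = 0 := measure_mono_null (closedBall_subset_ball hr) hs0
    simp [Measure.real, h0]
  rw [Metric.tendsto_atTop']
  intro τ hτ
  set κ := min (τ / 2) (1 / 2) with hκdef
  have hκ : 0 < κ := by positivity
  have hκ1 : κ < 1 := (min_le_right _ _).trans_lt (by norm_num)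
  have hκτ : κ < τ := (min_le_left _ _).trans_lt (by linarith)
  have hlt : ∀ {t : ℝ}, 0 < t → ∀ᶠ r in nhdsWithin (0 : ℝ) (Ioi 0), r < t := fun ht =>
    mem_nhdsWithin_of_mem_nhds (Iio_mem_nhds ht)
  obtain ⟨η, hη, hnear⟩ := eventually_abs_near_one hκ
  obtain ⟨r, ⟨⟨a1, a2, a3⟩, a4, a5⟩, a6⟩ :=
    (((eventually_small_radius hΩ hx.1 hαx hd hη).and
      ((hlt hδ).and (hlt hρ))).and self_mem_nhdsWithin).exists
  have hr : 0 < r := a6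
  have hbδ : closedBall x r ⊆ Ω \ sptM μ := (closedBall_subset_ball a4).trans hball
  have hbΩ : closedBall x r ⊆ Ω := hbδ.trans sdiff_subset
  have hvol : 0 < volume.real (closedBall x r) :=
    ENNReal.toReal_pos (measure_closedBall_pos _ _ hr).ne' measure_closedBall_lt_top.ne
  obtain ⟨N, hN⟩ := eventually_atTop.1 ((hL1.eventually_lt_const hvol).and
    (hnear hΩ hε hε0 huΩ hμ hα hr a1 a2 a3))
  refine ⟨N, fun k hk => ?_⟩
  obtain ⟨b1, b2⟩ := hN k hk.le
  rw [Real.dist_eq]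
  refine (abs_sub_le_of_near_sign hr ((huΩ k).continuousOn.mono hbΩ) (hpm x hx) hκ1 b2
    (lt_of_le_of_lt ?_ b1)).trans_lt hκτ
  have e : ∫ y in closedBall x r, |u k y - ulim x| = ∫ y in closedBall x r, |u k y - ulim y| :=
    setIntegral_congr_fun measurableSet_closedBall fun y hy => by
      rw [hconst y (closedBall_subset_ball a5 hy) (hbδ hy)]
  rw [e]
  exact setIntegral_mono_set (habs k) (ae_of_all _ fun y => abs_nonneg _) hbΩ.eventuallyLE

theorem stmt15 (Ω : Set (E 3)) (hΩo : IsOpen Ω) (hΩb : Bornology.IsBounded Ω)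
    (ε : ℕ → ℝ) (hεpos : ∀ k, 0 < ε k) (hε0 : Tendsto ε atTop (nhds 0))
    (u : ℕ → E 3 → ℝ) (hu : ∀ k, ContDiffOn ℝ 2 (u k) (closure Ω))
    (A : ℝ) (hA : ∀ k, Se (ε k) Ω (u k) + We (ε k) Ω (u k) ≤ A)
    (θ : ℝ) (hθ : 1 ≤ θ) (hbd : ∀ k, ∀ x ∈ frontier Ω, |u k x| ≤ θ)
    (μ α : Measure (E 3)) [IsFiniteMeasure μ] [IsFiniteMeasure α]
    (hμ : weakConvA Ω ε u μ) (hα : weakConvW Ω ε u α)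
    (ulim : E 3 → ℝ)
    (hL1 : Tendsto (fun k => ∫ x in Ω, |u k x - ulim x|) atTop (nhds 0))
    (hpm : ∀ x ∈ Ω \ sptM μ, ulim x = 1 ∨ ulim x = -1)
    (hlc : ∀ x ∈ Ω \ sptM μ, ∃ ρ > 0, ∀ y ∈ ball x ρ, y ∈ Ω \ sptM μ → ulim y = ulim x) :
    ∃ Δ : Set (E 3), Δ.Countable ∧ Δ ⊆ Ω \ sptM μ ∧
      (∀ x ∈ Ω \ (sptM μ ∪ Δ), Tendsto (fun k => u k x) atTop (nhds (ulim x))) ∧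
      ∀ (C : Set (E 3)) (s : ℝ), closure C ⊆ Ω \ sptM μ → IsCompact (closure C) →
        0 < s → Measure.hausdorffMeasure s C < ⊤ →
        ∀ᵐ x ∂(Measure.hausdorffMeasure s : Measure (E 3)).restrict C,
          Tendsto (fun k => u k x) atTop (nhds (ulim x)) := by
  have hconv : ∀ x ∈ Ω \ sptM μ, α {x} = 0 → Tendsto (fun k => u k x) atTop (nhds (ulim x)) :=
    fun x hx hαx =>
      tendsto_of_measure_singleton_eq_zero hΩo hΩb hεpos hε0 hu hμ hα hL1 hpm hlc hx hαx
  have hcount := countable_setOf_measure_singleton_ne_zero α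
  refine ⟨{x | x ∈ Ω \ sptM μ ∧ α {x} ≠ 0}, hcount.mono fun x hx => hx.2, fun x hx => hx.1,
    fun x hx => ?_, fun C s hC _ hs _ => ?_⟩
  · have hxs : x ∉ sptM μ := fun h => hx.2 (Or.inl h)
    refine hconv x ⟨hx.1, hxs⟩ ?_
    by_contra h
    exact hx.2 (Or.inr ⟨⟨hx.1, hxs⟩, h⟩)
  · have := Measure.nullSingletonClass_hausdorff (E 3) hs
    have hmem : ∀ᵐ x ∂(Measure.hausdorffMeasure s : Measure (E 3)).restrict C, x ∈ closure C :=
      ae_mono (Measure.restrict_mono subset_closure le_rfl)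
        (ae_restrict_mem isClosed_closure.measurableSet)
    filter_upwards [hmem, ae_restrict_of_ae (hcount.ae_notMem (Measure.hausdorffMeasure s))]
      with x hx hxα
    exact hconv x (hC hx) (by simpa using hxα)

end
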